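/- Let M = g⁻¹(0) be a nonempty compact hypersurface in ℝ⁴ contained in the open cylinder Z = {(x₁, y₁, x₂, y₂) ∈ ℝ⁴ : x₁² + y₁² < 1} (g : ℝ⁴ → ℝ smooth with dg_x ≠ 0 for all x ∈ M), and let Y be a Liouville vector field for ω_st defined on an open set U ⊆ ℝ⁴ containing M and transverse to M. Then the induced contact form α = (ι_Y ω_st)|TM has a closed Reeb orbit of period T with 0 < T ≤ π: there exist such a T and a nonconstant smooth map γ : ℝ → ℝ⁴ with image in M such that for all t ∈ ℝ one has γ(t + T) = γ(t), γ′(t) ∈ ker(dg_{γ(t)}), ω_st(γ′(t), v) = 0 for all v ∈ ker(dg_{γ(t)}), and ω_st(Y(γ(t)), γ′(t)) = 1. -/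

import Mathlib

noncomputable section

open scoped ContDiff
open Real

/-- ℝ⁴ with the Euclidean inner product. -/
abbrev R4 : Type := EuclideanSpace ℝ (Fin 4)

/-- The standard symplectic form ω_st = dx₁∧dy₁ + dx₂∧dy₂ on ℝ⁴. -/
def omegaSt (u v : R4) : ℝ := u 0 * v 1 - u 1 * v 0 + u 2 * v 3 - u 3 * v 2

open MeasureTheory Metric Set in
lemma exists_interpolation_nodes (n : ℕ) (ε : ℝ) (hε : 0 < ε) :
    ∃ (t c : ℕ → ℝ), (∀ j ≤ n, 0 < t j ∧ t j ≤ ε) ∧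
      ∀ p : Polynomial ℝ, p.natDegree ≤ n →
        p.eval 1 = ∑ j ∈ Finset.range (n + 1), c j * p.eval (t j) := by
  let t : ℕ → ℝ := fun j => ε / (j + 1)
  have hinj : Set.InjOn t (Finset.range (n + 1)) := by
    intro a _ b _ h
    simp only [t] at h
    have ha : (0:ℝ) < a + 1 := by positivity
    have hb : (0:ℝ) < b + 1 := by positivity
    rw [div_eq_div_iff ha.ne' hb.ne'] at h
    have := mul_left_cancel₀ hε.ne' h
    have : (b:ℝ) = a := by linarith
    exact_mod_cast this.symm
  refine ⟨t, fun j => (Lagrange.basis (Finset.range (n + 1)) t j).eval 1, ?_, ?_⟩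
  · intro j _
    refine ⟨by simp only [t]; positivity, ?_⟩
    simp only [t]
    apply div_le_self hε.le
    have : (0:ℝ) ≤ j := by positivity
    linarith
  · intro p hp
    have hdeg : p.degree < (Finset.range (n + 1)).card := by
      rw [Finset.card_range]
      refine lt_of_le_of_lt Polynomial.degree_le_natDegree ?_
      exact_mod_cast Nat.lt_succ_of_le hp
    have h := Lagrange.eq_interpolate_of_eval_eq (s := Finset.range (n+1)) (v := t)
      (fun j => p.eval (t j)) hinj hdeg (fun i _ => rfl)
    conv_lhs => rw [h, Lagrange.interpolate_apply]
    rw [Polynomial.eval_finsetSum]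
    refine Finset.sum_congr rfl fun j _ => ?_
    simp [mul_comm]

lemma exists_polynomial_det_one_add_smul {E : Type*} [NormedAddCommGroup E] [NormedSpace ℝ E]
    [FiniteDimensional ℝ E] (A : E →L[ℝ] E) :
    ∃ p : Polynomial ℝ, p.natDegree ≤ Module.finrank ℝ E ∧
      ∀ t : ℝ, p.eval t = (ContinuousLinearMap.id ℝ E + t • A).det := by
  let b := Module.finBasis ℝ E
  let M := LinearMap.toMatrix b b (A : E →ₗ[ℝ] E)
  refine ⟨(((Polynomial.X : Polynomial ℝ) • M.map Polynomial.C + (1 : Matrix _ _ ℝ).map Polynomial.C)).det,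
    ?_, ?_⟩
  · simpa using Polynomial.natDegree_det_X_add_C_le M 1
  · intro t
    rw [← Polynomial.coe_evalRingHom, RingHom.map_det, ContinuousLinearMap.det, ← LinearMap.det_toMatrix b]
    congr 1
    have h1 : LinearMap.toMatrix b b ((ContinuousLinearMap.id ℝ E + t • A : E →L[ℝ] E) : E →ₗ[ℝ] E)
        = 1 + t • M := by
      have : ((ContinuousLinearMap.id ℝ E + t • A : E →L[ℝ] E) : E →ₗ[ℝ] E)
        = LinearMap.id + t • (A : E →ₗ[ℝ] E) := by ext; simp
      rw [this, map_add, map_smul, LinearMap.toMatrix_id]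
    rw [h1]
    ext i j
    simp [Matrix.one_apply]
    split_ifs <;> simp <;> ring

lemma det_one_add_pos {E : Type*} [NormedAddCommGroup E] [NormedSpace ℝ E]
    [FiniteDimensional ℝ E] (A : E →L[ℝ] E) (hA : ‖A‖ < 1) :
    0 < (ContinuousLinearMap.id ℝ E + A).det := by
  obtain ⟨p, -, hp⟩ := exists_polynomial_det_one_add_smul A
  have hne : ∀ t ∈ Set.Icc (0:ℝ) 1, p.eval t ≠ 0 := by
    intro t ht h0
    rw [hp] at h0
    have hker : ∃ v : E, v ≠ 0 ∧ (ContinuousLinearMap.id ℝ E + t • A) v = 0 := by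
      have := LinearMap.bot_lt_ker_of_det_eq_zero h0
      obtain ⟨v, hv, hv0⟩ := (Submodule.ne_bot_iff _).1 this.ne'
      exact ⟨v, hv0, hv⟩
    obtain ⟨v, hv0, hv⟩ := hker
    have h1 : v = -(t • A v) := by
      have : v + t • A v = 0 := by simpa using hv
      exact eq_neg_of_add_eq_zero_left this
    have h2 : ‖v‖ ≤ ‖A‖ * ‖v‖ := by
      calc ‖v‖ = ‖-(t • A v)‖ := by rw [← h1]
        _ = t * ‖A v‖ := by rw [norm_neg, norm_smul, Real.norm_of_nonneg ht.1]
        _ ≤ 1 * ‖A v‖ := by gcongr; exact ht.2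
        _ ≤ ‖A‖ * ‖v‖ := by rw [one_mul]; exact A.le_opNorm v
    have : 0 < ‖v‖ := norm_pos_iff.2 hv0
    nlinarith
  have h0 : p.eval 0 = 1 := by rw [hp]; simp [ContinuousLinearMap.det]
  have h1 : p.eval 1 = (ContinuousLinearMap.id ℝ E + A).det := by rw [hp]; simp
  rw [← h1]
  by_contra hcon
  push Not at hcon
  have hcont : ContinuousOn (fun t => p.eval t) (Set.Icc (0:ℝ) 1) := p.continuous.continuousOn
  obtain ⟨t, ht, ht0⟩ := intermediate_value_Icc' zero_le_one hcont (show (0:ℝ) ∈ _ from ⟨hcon, by rw [h0]; exact zero_le_one⟩)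
  exact hne t ht ht0

open MeasureTheory Metric Set in
lemma setIntegral_det_one_add_smul_fderiv {E : Type*} [NormedAddCommGroup E] [NormedSpace ℝ E]
    [FiniteDimensional ℝ E] [MeasurableSpace E] [BorelSpace E] (μ : Measure E)
    [μ.IsAddHaarMeasure] {g : E → E} {K : NNReal} (hg : LipschitzWith K g) {R : ℝ}
    (h0 : ∀ x, R ≤ ‖x‖ → g x = 0) (hd : ∀ x ∈ ball (0:E) R, DifferentiableAt ℝ g x)
    {t : ℝ} (ht : 0 < t) (htK : t * K < 1) :
    IntegrableOn (fun x => (ContinuousLinearMap.id ℝ E + t • fderiv ℝ g x).det) (ball 0 R) μ ∧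
    ∫ x in ball 0 R, (ContinuousLinearMap.id ℝ E + t • fderiv ℝ g x).det ∂μ
      = μ.real (ball 0 R) := by
  let f : E → E := fun x => x + t • g x
  let c : NNReal := ⟨t, ht.le⟩ * K
  have happ : ApproximatesLinearOn f ((ContinuousLinearEquiv.refl ℝ E : E ≃L[ℝ] E) : E →L[ℝ] E)
      univ c := by
    intro x _ y _
    have : f x - f y - ((ContinuousLinearEquiv.refl ℝ E : E ≃L[ℝ] E) : E →L[ℝ] E) (x - y)
        = t • (g x - g y) := by
      simp [f, smul_sub]; abel
    rw [this, norm_smul, Real.norm_of_nonneg ht.le]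
    have := hg.norm_sub_le x y
    calc t * ‖g x - g y‖ ≤ t * (K * ‖x - y‖) := by gcongr
      _ = (t * K) * ‖x - y‖ := by ring
      _ = c * ‖x - y‖ := rfl
  have hc : Subsingleton E ∨ c < ‖((ContinuousLinearEquiv.refl ℝ E : E ≃L[ℝ] E).symm : E →L[ℝ] E)‖₊⁻¹ := by
    rcases subsingleton_or_nontrivial E with h | h
    · exact Or.inl h
    · right
      have : ‖((ContinuousLinearEquiv.refl ℝ E : E ≃L[ℝ] E).symm : E →L[ℝ] E)‖₊ = 1 := by
        have : ((ContinuousLinearEquiv.refl ℝ E : E ≃L[ℝ] E).symm : E →L[ℝ] E) = ContinuousLinearMap.id ℝ E := rfl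
        rw [this]
        exact NNReal.eq (by simp)
      rw [this, inv_one]
      exact htK
  have hinj : Function.Injective f := injOn_univ.1 (happ.injOn hc)
  have hsurj : Function.Surjective f := happ.surjective hc
  have hout : ∀ x, R ≤ ‖x‖ → f x = x := fun x hx => by simp [f, h0 x hx]
  have himg : f '' ball 0 R = ball 0 R := by
    ext y
    constructor
    · rintro ⟨x, hx, rfl⟩
      by_contra hcon
      rw [mem_ball_zero_iff, not_lt] at hcon
      have := hinj (hout (f x) hcon)
      rw [this] at hcon
      rw [mem_ball_zero_iff] at hx
      linarith
    · intro hy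
      obtain ⟨x, rfl⟩ := hsurj y
      refine ⟨x, ?_, rfl⟩
      by_contra hcon
      rw [mem_ball_zero_iff, not_lt] at hcon
      rw [hout x hcon, mem_ball_zero_iff] at hy
      linarith
  have hder : ∀ x ∈ ball (0:E) R, HasFDerivWithinAt f
      (ContinuousLinearMap.id ℝ E + t • fderiv ℝ g x) (ball 0 R) x := fun x hx =>
    ((hasFDerivAt_id x).add ((hd x hx).hasFDerivAt.const_smul t)).hasFDerivWithinAt
  have hpos : ∀ x, 0 < (ContinuousLinearMap.id ℝ E + t • fderiv ℝ g x).det := by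
    intro x
    apply det_one_add_pos
    rw [norm_smul, Real.norm_of_nonneg ht.le]
    have : ‖fderiv ℝ g x‖ ≤ K := norm_fderiv_le_of_lipschitz ℝ hg
    calc t * ‖fderiv ℝ g x‖ ≤ t * K := by gcongr
      _ < 1 := htK
  have hInt := integrableOn_image_iff_integrableOn_abs_det_fderiv_smul μ measurableSet_ball hder
    hinj.injOn (fun _ => (1:ℝ))
  have heq := integral_image_eq_integral_abs_det_fderiv_smul μ measurableSet_ball hder
    hinj.injOn (fun _ => (1:ℝ))
  rw [himg] at hInt heq
  simp only [abs_of_pos (hpos _), smul_eq_mul, mul_one] at hInt heq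
  refine ⟨hInt.1 ?_, ?_⟩
  · exact integrableOn_const (measure_ball_lt_top.ne)
  · rw [← heq]; simp

open MeasureTheory Metric Set in
lemma setIntegral_det_one_add_fderiv {E : Type*} [NormedAddCommGroup E] [NormedSpace ℝ E]
    [FiniteDimensional ℝ E] [MeasurableSpace E] [BorelSpace E] (μ : Measure E)
    [μ.IsAddHaarMeasure] {g : E → E} {K : NNReal} (hg : LipschitzWith K g) {R : ℝ}
    (h0 : ∀ x, R ≤ ‖x‖ → g x = 0) (hd : ∀ x ∈ ball (0:E) R, DifferentiableAt ℝ g x) :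
    ∫ x in ball 0 R, (ContinuousLinearMap.id ℝ E + fderiv ℝ g x).det ∂μ
      = μ.real (ball 0 R) := by
  obtain ⟨t, c, ht, hp⟩ := exists_interpolation_nodes (Module.finrank ℝ E) (1 / (2 * (K + 1)))
    (by positivity)
  have htK : ∀ j ≤ Module.finrank ℝ E, t j * K < 1 := by
    intro j hj
    have hK : (0:ℝ) ≤ K := K.2
    calc t j * K ≤ 1 / (2 * (K + 1)) * K := by gcongr; exact (ht j hj).2
      _ < 1 := by rw [div_mul_eq_mul_div, div_lt_one (by positivity)]; linarith
  have key : ∀ x, (ContinuousLinearMap.id ℝ E + fderiv ℝ g x).det =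
      ∑ j ∈ Finset.range (Module.finrank ℝ E + 1),
        c j * (ContinuousLinearMap.id ℝ E + t j • fderiv ℝ g x).det := by
    intro x
    obtain ⟨p, hpd, hpe⟩ := exists_polynomial_det_one_add_smul (fderiv ℝ g x)
    have := hp p hpd
    simpa [hpe] using this
  have hsum : ∑ j ∈ Finset.range (Module.finrank ℝ E + 1), c j = 1 := by
    have := hp 1 (by simp)
    simpa using this.symm
  simp_rw [key]
  rw [integral_finsetSum]
  · rw [Finset.sum_congr rfl (g := fun j => c j * μ.real (ball 0 R)), ← Finset.sum_mul, hsum, one_mul]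
    intro j hj
    have hj' : j ≤ Module.finrank ℝ E := Nat.lt_succ_iff.1 (Finset.mem_range.1 hj)
    rw [integral_const_mul, (setIntegral_det_one_add_smul_fderiv μ hg h0 hd (ht j hj').1 (htK j hj')).2]
  · intro j hj
    have hj' : j ≤ Module.finrank ℝ E := Nat.lt_succ_iff.1 (Finset.mem_range.1 hj)
    exact ((setIntegral_det_one_add_smul_fderiv μ hg h0 hd (ht j hj').1 (htK j hj')).1).const_mul _

open Metric Set in
lemma exists_lipschitzWith_indicator_ball {E F : Type*} [NormedAddCommGroup E] [NormedSpace ℝ E]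
    [NormedAddCommGroup F] {R : ℝ} {K : NNReal} {g : E → F}
    (hg : LipschitzOnWith K g (closedBall 0 R)) (h0 : ∀ x, ‖x‖ = R → g x = 0)
    (hout : ∀ x, R < ‖x‖ → g x = 0) : LipschitzWith K g := by
  have key : ∀ x y : E, ‖x‖ ≤ R → R < ‖y‖ → dist (g x) (g y) ≤ K * dist x y := by
    intro x y hx hy
    have hc : ContinuousOn (fun t : ℝ => ‖AffineMap.lineMap x y t‖) (Icc (0:ℝ) 1) := by
      apply Continuous.continuousOn
      exact (AffineMap.lineMap_continuous).norm
    obtain ⟨t, ht, htR⟩ := intermediate_value_Icc zero_le_one hc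
      (show R ∈ _ from ⟨by simpa using hx, by simpa using hy.le⟩)
    set z := AffineMap.lineMap x y t with hz
    have hz0 : g z = 0 := h0 z htR
    have h1 : dist (g x) (g z) ≤ K * dist x z :=
      hg.dist_le_mul x (by simpa using hx) z (by rw [mem_closedBall_zero_iff]; exact htR.le)
    rw [hout y hy, ← hz0]
    refine h1.trans ?_
    gcongr
    rw [hz, dist_left_lineMap, Real.norm_of_nonneg ht.1]
    exact mul_le_of_le_one_left dist_nonneg ht.2
  refine LipschitzWith.of_dist_le_mul fun x y => ?_
  by_cases hx : ‖x‖ ≤ R <;> by_cases hy : ‖y‖ ≤ R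
  · exact hg.dist_le_mul x (by simpa using hx) y (by simpa using hy)
  · exact key x y hx (not_le.1 hy)
  · rw [dist_comm, dist_comm x]; exact key y x hy (not_le.1 hx)
  · rw [hout x (not_le.1 hx), hout y (not_le.1 hy), dist_self]; positivity

open Metric Set MeasureTheory in
lemma not_exists_contDiff_retraction {E : Type*} [NormedAddCommGroup E] [InnerProductSpace ℝ E]
    [FiniteDimensional ℝ E] {R : ℝ} (hR : 0 < R) {r : E → E} (hr : ContDiff ℝ 1 r)
    (hn : ∀ x, ‖r x‖ = R) (hb : ∀ x, ‖x‖ = R → r x = x) : False := by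
  borelize E
  let μ : Measure E := Measure.addHaar
  let g : E → E := fun x => if ‖x‖ ≤ R then r x - x else 0
  have hsm : ContDiff ℝ 1 (fun x => r x - x) := hr.sub contDiff_id
  obtain ⟨K, hK⟩ : ∃ K : NNReal, LipschitzOnWith K (fun x => r x - x) (closedBall 0 R) := by
    exact hsm.locallyLipschitz.locallyLipschitzOn.exists_lipschitzOnWith_of_compact
      (isCompact_closedBall 0 R)
  have hgin : ∀ x, ‖x‖ ≤ R → g x = r x - x := fun x hx => if_pos hx
  have hglip : LipschitzWith K g := by
    apply exists_lipschitzWith_indicator_ball (R := R)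
    · intro x hx y hy
      rw [hgin x (by simpa using hx), hgin y (by simpa using hy)]
      exact hK hx hy
    · intro x hx
      rw [hgin x hx.le, hb x hx, sub_self]
    · intro x hx
      exact if_neg (not_le.2 hx)
  have heq : ∀ x ∈ ball (0:E) R, g =ᶠ[nhds x] fun x => r x - x := by
    intro x hx
    filter_upwards [isOpen_ball.mem_nhds hx] with y hy
    exact hgin y (by simpa using (mem_ball_zero_iff.1 hy).le)
  have hrd : Differentiable ℝ r := hr.differentiable (by norm_num)
  have h := setIntegral_det_one_add_fderiv μ hglip (R := R)
    (fun x hx => by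
      rcases hx.eq_or_lt with h | h
      · rw [hgin x h.ge, hb x h.symm, sub_self]
      · exact if_neg (not_le.2 h))
    (fun x hx => ((hrd x).sub differentiableAt_id).congr_of_eventuallyEq (heq x hx))
  have hdet : ∀ x ∈ ball (0:E) R, (ContinuousLinearMap.id ℝ E + fderiv ℝ g x).det = 0 := by
    intro x hx
    have h1 : ContinuousLinearMap.id ℝ E + fderiv ℝ g x = fderiv ℝ r x := by
      rw [(heq x hx).fderiv_eq, fderiv_fun_sub (hrd x) differentiableAt_fun_id, fderiv_fun_id]
      abel
    rw [h1]
    by_contra hdet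
    have hunit : IsUnit (fderiv ℝ r x : E →ₗ[ℝ] E) := by
      rw [LinearMap.isUnit_iff_isUnit_det]; exact isUnit_iff_ne_zero.2 hdet
    have hsurj := (Module.End.isUnit_iff _).1 hunit |>.2
    obtain ⟨v, hv⟩ := hsurj (r x)
    have hconst : (fun y => inner ℝ (r y) (r y)) = fun _ => R ^ 2 := by
      ext y; rw [real_inner_self_eq_norm_sq, hn]
    have hder := ((hrd x).hasFDerivAt.inner ℝ (hrd x).hasFDerivAt)
    rw [hconst] at hder
    have := hder.unique (hasFDerivAt_const _ _)
    have := congrArg (fun L => L v) this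
    have hv' : fderiv ℝ r x v = r x := hv
    simp [hv', hn] at this
    exact hR.ne' this
  rw [setIntegral_congr_fun measurableSet_ball (g := fun _ => (0:ℝ)) hdet] at h
  simp only [integral_zero] at h
  have hpos : 0 < μ (ball (0:E) R) := measure_ball_pos μ 0 hR
  have : 0 < μ.real (ball (0:E) R) := ENNReal.toReal_pos hpos.ne' measure_ball_lt_top.ne
  exact this.ne h

open Metric Set in
lemma exists_fixedPoint_of_bounded_inner {E : Type*} [NormedAddCommGroup E]
    [InnerProductSpace ℝ E] [FiniteDimensional ℝ E] {f : E → E} (hf : Continuous f) {C : ℝ}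
    (hC : ∀ x, ‖f x‖ ≤ C) : ∃ x, f x = x := by
  by_contra! hno
  have hC0 : 0 ≤ C := (norm_nonneg _).trans (hC 0)
  set r := C + 1 with hr
  have hr1 : 1 ≤ r := by linarith
  obtain ⟨ε, hε, hε1, hεf⟩ : ∃ ε, 0 < ε ∧ ε ≤ 1 ∧ ∀ x ∈ closedBall (0:E) (3 * r), ε ≤ ‖f x - x‖ := by
    obtain ⟨x0, hx0, hmin⟩ := (isCompact_closedBall (0:E) (3 * r)).exists_isMinOn
      ⟨0, by simp; linarith⟩ ((hf.sub continuous_id).norm.continuousOn)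
    refine ⟨min 1 ‖f x0 - x0‖, ?_, min_le_left _ _, fun x hx => (min_le_right _ _).trans (hmin hx)⟩
    exact lt_min one_pos (norm_pos_iff.2 (sub_ne_zero.2 (hno x0)))
  obtain ⟨f', hf', hff', -⟩ := hf.exists_contDiff_approx 1 (ε := fun _ => ε) continuous_const
    (fun _ => hε)
  have hbd : ∀ x, ‖f' x‖ < r := by
    intro x
    have h1 := hff' x
    rw [dist_eq_norm] at h1
    calc ‖f' x‖ = ‖(f' x - f x) + f x‖ := by congr 1; abel
      _ ≤ ‖f' x - f x‖ + ‖f x‖ := norm_add_le _ _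
      _ < ε + C := by linarith [hC x]
      _ ≤ r := by linarith
  let η : ContDiffBump (0 : E) := ⟨2 * r, 3 * r, by linarith, by linarith⟩
  let F : E → E := fun x => x - η x • f' x
  have hF : ContDiff ℝ 1 F := contDiff_id.sub (η.contDiff.smul hf')
  have hF0 : ∀ x, F x ≠ 0 := by
    intro x hx
    have hx' : x = η x • f' x := sub_eq_zero.1 hx
    by_cases hxr : ‖x‖ ≤ 2 * r
    · have h1 : η x = 1 := η.one_of_mem_closedBall (by simpa [η] using hxr)
      rw [h1, one_smul] at hx'
      have h2 := hεf x (by simp; linarith)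
      have h3 := hff' x
      rw [← hx', dist_comm, dist_eq_norm] at h3
      linarith
    · have h1 : ‖x‖ ≤ ‖f' x‖ := by
        conv_lhs => rw [hx', norm_smul, Real.norm_of_nonneg η.nonneg]
        exact mul_le_of_le_one_left (norm_nonneg _) η.le_one
      have := hbd x
      linarith
  refine not_exists_contDiff_retraction (R := 4 * r) (by linarith) (r := fun x => (4 * r * ‖F x‖⁻¹) • F x)
    ?_ ?_ ?_
  · exact (contDiff_const.mul ((hF.norm ℝ hF0).inv (fun x => norm_ne_zero_iff.2 (hF0 x)))).smul hF
  · intro x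
    have : 0 < ‖F x‖ := norm_pos_iff.2 (hF0 x)
    rw [norm_smul, Real.norm_of_nonneg (by positivity)]
    field_simp
  · intro x hx
    have h1 : η x = 0 := η.zero_of_le_dist (by simp [η, hx]; linarith)
    have h2 : F x = x := by simp [F, h1]
    simp only [h2, hx]
    rw [mul_inv_cancel₀ (by positivity), one_smul]

/-- A bounded continuous self-map of a finite-dimensional real normed space has a fixed point. -/
theorem exists_fixedPoint_of_bounded {E : Type*} [NormedAddCommGroup E]
    [NormedSpace ℝ E] [FiniteDimensional ℝ E] {f : E → E} (hf : Continuous f) {C : ℝ}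
    (hC : ∀ x, ‖f x‖ ≤ C) : ∃ x, f x = x := by
  let e : E ≃L[ℝ] EuclideanSpace ℝ (Fin (Module.finrank ℝ E)) :=
    ContinuousLinearEquiv.ofFinrankEq (by simp)
  let e' : E →L[ℝ] EuclideanSpace ℝ (Fin (Module.finrank ℝ E)) := e
  obtain ⟨x, hx⟩ := exists_fixedPoint_of_bounded_inner (f := fun x => e (f (e.symm x)))
    (e.continuous.comp (hf.comp e.symm.continuous)) (C := ‖e'‖ * C) (fun x => by
      refine (e'.le_opNorm _).trans ?_
      gcongr
      exact hC _)
  refine ⟨e.symm x, ?_⟩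
  apply e.injective
  simpa using hx

/-- A discrete gradient step, truncated below the level `0`. -/
def gradStep {X : Type*} [AddCommGroup X] [Module ℝ X] (Φ : X → ℝ) (D : X → X)
    (τ β : ℝ) (x : X) : X :=
  x - (τ * max 0 (min 1 (Φ x / β))) • D x

lemma continuous_gradStep {X : Type*} [NormedAddCommGroup X] [NormedSpace ℝ X] {Φ : X → ℝ}
    {D : X → X} (hΦ : Continuous Φ) (hD : Continuous D) (τ β : ℝ) :
    Continuous (gradStep Φ D τ β) := by
  unfold gradStep
  fun_prop

section
variable {X : Type*} [AddCommGroup X] [Module ℝ X] {Φ : X → ℝ} {D : X → X} {q : X → ℝ} {τ β : ℝ}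

lemma gradStep_eq_self (hβ : 0 < β) {x : X} (hx : Φ x ≤ 0) : gradStep Φ D τ β x = x := by
  have h1 : Φ x / β ≤ 0 := div_nonpos_of_nonpos_of_nonneg hx hβ.le
  have : max 0 (min 1 (Φ x / β)) = 0 := max_eq_left ((min_le_right _ _).trans h1)
  simp [gradStep, this]

lemma iterate_gradStep_eq_self (hβ : 0 < β) {x : X} (hx : Φ x ≤ 0) (k : ℕ) :
    (gradStep Φ D τ β)^[k] x = x :=
  Function.iterate_fixed (gradStep_eq_self hβ hx) k

lemma gradStep_le (hτ : 0 < τ) (hq : ∀ x, 0 ≤ q x)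
    (hdesc : ∀ x, ∀ t, 0 ≤ t → t ≤ τ → Φ (x - t • D x) ≤ Φ x - t / 2 * q x) (x : X) :
    Φ (gradStep Φ D τ β x) ≤ Φ x := by
  have h0 : 0 ≤ max 0 (min 1 (Φ x / β)) := le_max_left _ _
  have h1 : max 0 (min 1 (Φ x / β)) ≤ 1 := max_le zero_le_one (min_le_left _ _)
  have := hdesc x (τ * max 0 (min 1 (Φ x / β))) (by positivity)
    (mul_le_of_le_one_right hτ.le h1)
  refine this.trans ?_
  have := hq x
  have : 0 ≤ τ * max 0 (min 1 (Φ x / β)) / 2 * q x := by positivity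
  linarith

lemma gradStep_le_of_ge (hτ : 0 < τ) (hβ : 0 < β)
    (hdesc : ∀ x, ∀ t, 0 ≤ t → t ≤ τ → Φ (x - t • D x) ≤ Φ x - t / 2 * q x) {x : X}
    (hx : β ≤ Φ x) : Φ (gradStep Φ D τ β x) ≤ Φ x - τ / 2 * q x := by
  have h1 : max 0 (min 1 (Φ x / β)) = 1 := by
    rw [min_eq_left ((one_le_div hβ).2 hx)]; simp
  have := hdesc x τ hτ.le le_rfl
  simpa [gradStep, h1] using this

lemma iterate_gradStep_lt (hτ : 0 < τ) (hβ : 0 < β) (hq : ∀ x, 0 ≤ q x)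
    (hdesc : ∀ x, ∀ t, 0 ≤ t → t ≤ τ → Φ (x - t • D x) ≤ Φ x - t / 2 * q x) {ε : ℝ}
    (hε : ∀ x, β ≤ Φ x → ε ≤ q x) (x : X) (k : ℕ) (hk : β ≤ Φ ((gradStep Φ D τ β)^[k] x)) :
    Φ ((gradStep Φ D τ β)^[k] x) ≤ Φ x - k * (τ / 2 * ε) := by
  induction k with
  | zero => simp
  | succ k ih =>
    rw [Function.iterate_succ_apply'] at hk ⊢
    have h1 : β ≤ Φ ((gradStep Φ D τ β)^[k] x) := hk.trans (gradStep_le hτ hq hdesc _)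
    have h2 := gradStep_le_of_ge hτ hβ hdesc h1
    have h3 := ih h1
    have h4 : τ / 2 * ε ≤ τ / 2 * q ((gradStep Φ D τ β)^[k] x) := by
      gcongr; exact hε _ h1
    push_cast
    linarith
end

/-- Finite-dimensional linking: existence of almost critical points above level `β`. -/
theorem exists_almost_critical_of_linking {X : Type*} [NormedAddCommGroup X] [NormedSpace ℝ X]
    [FiniteDimensional ℝ X] {Φ ρ : X → ℝ} {D : X → X} {q : X → ℝ} (hΦ : Continuous Φ)
    (hD : Continuous D) (hρ : Continuous ρ) (P : X →L[ℝ] X) (hP : ∀ x, P (P x) = P x)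
    {e : X} (he : P e = 0) (hρe : ∀ w, ∀ s : ℝ, 0 ≤ s → ρ (P w + s • e) = s)
    {τ : ℝ} (hτ : 0 < τ) (hq : ∀ x, 0 ≤ q x)
    (hdesc : ∀ x, ∀ t, 0 ≤ t → t ≤ τ → Φ (x - t • D x) ≤ Φ x - t / 2 * q x)
    {R : ℝ} (hR : ∀ w, ∀ s : ℝ, 0 ≤ s → R ≤ ‖P w + s • e‖ → Φ (P w + s • e) ≤ 0)
    (hneg : ∀ w, Φ (P w) ≤ 0) {α β : ℝ} (hα : 0 < α) (hβ : 0 < β)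
    (hΓ : ∀ x, P x = 0 → ρ x = α → β ≤ Φ x) {ε : ℝ} (hε : 0 < ε) :
    ∃ y, β ≤ Φ y ∧ q y ≤ ε := by
  by_contra! hcon
  set S := gradStep Φ D τ β with hS
  have hScont : Continuous S := continuous_gradStep hΦ hD τ β
  obtain ⟨B, hB⟩ : ∃ B, ∀ x ∈ Metric.closedBall (0:X) R, Φ x ≤ B := by
    obtain ⟨B, hB⟩ := (isCompact_closedBall (0:X) R).bddAbove_image hΦ.continuousOn
    exact ⟨B, fun x hx => hB ⟨x, hx, rfl⟩⟩
  obtain ⟨k, hk⟩ := exists_nat_gt ((max B 0 - β) / (τ / 2 * ε))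
  have hk' : max B 0 - β < k * (τ / 2 * ε) := by
    rwa [div_lt_iff₀ (by positivity)] at hk
  have hlow : ∀ x, Φ x ≤ max B 0 → Φ (S^[k] x) < β := by
    intro x hx
    by_contra! h
    have := iterate_gradStep_lt (q := q) hτ hβ hq hdesc (fun x hx => (hcon x hx).le) x k h
    simp only [← hS] at this
    linarith
  have hSk : Continuous (S^[k]) := hScont.iterate k
  let x : X × ℝ → X := fun p => P p.1 + max p.2 0 • e
  have hx : Continuous x := by fun_prop
  let f : X × ℝ → X × ℝ := fun p => (P p.1 - P (S^[k] (x p)), max p.2 0 - ρ (S^[k] (x p)) + α)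
  have hf : Continuous f := by fun_prop
  obtain ⟨C, hC⟩ : ∃ C, ∀ z ∈ Metric.closedBall (0:X) R,
      ‖P z - P (S^[k] z)‖ + |ρ z - ρ (S^[k] z) + α| ≤ C := by
    have : Continuous (fun z => ‖P z - P (S^[k] z)‖ + |ρ z - ρ (S^[k] z) + α|) := by fun_prop
    obtain ⟨B, hB⟩ := (isCompact_closedBall (0:X) R).bddAbove_image this.continuousOn
    exact ⟨B, fun x hx => hB ⟨x, hx, rfl⟩⟩
  have hPx : ∀ p, P (x p) = P p.1 := by intro p; simp [x, hP, he]
  have hρx : ∀ p, ρ (x p) = max p.2 0 := fun p => hρe _ _ (le_max_right _ _)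
  have hfx : ∀ p, f p = (P (x p) - P (S^[k] (x p)), ρ (x p) - ρ (S^[k] (x p)) + α) := by
    intro p; simp only [f, hPx, hρx]
  obtain ⟨p, hp⟩ := exists_fixedPoint_of_bounded hf (C := max C α) (by
    intro p
    rw [hfx]
    by_cases hxR : R ≤ ‖x p‖
    · have h1 : Φ (x p) ≤ 0 := hR _ _ (le_max_right _ _) hxR
      have h2 : S^[k] (x p) = x p := iterate_gradStep_eq_self hβ h1 k
      rw [h2]
      simp [abs_of_pos hα, hα.le]
    · have := hC (x p) (by simpa using (not_le.1 hxR).le)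
      refine le_max_of_le_left ?_
      rw [Prod.norm_def]
      refine max_le ?_ ?_
      · have := abs_nonneg (ρ (x p) - ρ (S^[k] (x p)) + α); linarith
      · have := norm_nonneg (P (x p) - P (S^[k] (x p))); rw [Real.norm_eq_abs]; linarith)
  have hp1 : P p.1 - P (S^[k] (x p)) = p.1 := congrArg Prod.fst hp
  have hp2 : max p.2 0 - ρ (S^[k] (x p)) + α = p.2 := congrArg Prod.snd hp
  have hPp : P p.1 = p.1 := by
    conv_lhs => rw [← hp1]
    rw [map_sub, hP, hP, hp1]
  have hPS : P (S^[k] (x p)) = 0 := by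
    rw [hPp] at hp1
    simpa using hp1
  have hxB : Φ (x p) ≤ max B 0 := by
    by_cases hxR : R ≤ ‖x p‖
    · exact (hR _ _ (le_max_right _ _) hxR).trans (le_max_right _ _)
    · exact (hB _ (by simpa using (not_le.1 hxR).le)).trans (le_max_left _ _)
  rcases le_or_gt 0 p.2 with hs | hs
  · rw [max_eq_left hs] at hp2
    have := hΓ _ hPS (by linarith)
    exact absurd (hlow _ hxB) (not_lt.2 this)
  · rw [max_eq_right hs.le] at hp2
    have hxp : x p = P p.1 := by simp [x, max_eq_right hs.le]
    have h2 : S^[k] (x p) = x p := iterate_gradStep_eq_self hβ (by rw [hxp]; exact hneg _) k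
    have h3 : x p = 0 := by rw [h2, hPx, ← hxp] at hPS; exact hPS
    have h4 : ρ (x p) = 0 := by rw [hρx, max_eq_right hs.le]
    rw [h2, h4] at hp2
    linarith

/-- The exponential `t ↦ exp (2 π i k t)`. -/
def ek (k : ℤ) (t : ℝ) : ℂ := Complex.exp (2 * π * Complex.I * k * t)

@[simp] lemma norm_ek (k : ℤ) (t : ℝ) : ‖ek k t‖ = 1 := by
  rw [ek, show (2 * π * Complex.I * k * t : ℂ) = ((2 * π * k * t : ℝ) : ℂ) * Complex.I by
    push_cast; ring, Complex.norm_exp_ofReal_mul_I]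

lemma ek_add (k l : ℤ) (t : ℝ) : ek (k + l) t = ek k t * ek l t := by
  rw [ek, ek, ek, ← Complex.exp_add]; congr 1; push_cast; ring

@[simp] lemma ek_zero (t : ℝ) : ek 0 t = 1 := by simp [ek]

lemma conj_ek (k : ℤ) (t : ℝ) : (starRingEnd ℂ) (ek k t) = ek (-k) t := by
  rw [ek, ek, ← Complex.exp_conj]; congr 1; simp [Complex.conj_ofNat]

lemma ek_int (k l : ℤ) : ek k l = 1 := by
  rw [ek, Complex.exp_eq_one_iff]; exact ⟨k * l, by push_cast; ring⟩

lemma ek_add_one (k : ℤ) (t : ℝ) : ek k (t + 1) = ek k t := by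
  have : ek k (t + 1) = ek k t * ek k 1 := by
    rw [ek, ek, ek, ← Complex.exp_add]; congr 1; push_cast; ring
  rw [this]
  have := ek_int k 1
  rw [Int.cast_one] at this
  rw [this, mul_one]

lemma hasDerivAt_ek (k : ℤ) (t : ℝ) : HasDerivAt (ek k) (2 * π * Complex.I * k * ek k t) t := by
  have h1 : HasDerivAt (fun t : ℝ => 2 * π * Complex.I * k * (t:ℂ)) (2 * π * Complex.I * k) t := by
    simpa using (Complex.ofRealCLM.hasDerivAt (x := t)).const_mul (2 * π * Complex.I * k : ℂ)
  have := h1.cexp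
  rw [ek, mul_comm]
  exact this

@[fun_prop] lemma continuous_ek (k : ℤ) : Continuous (ek k) := by unfold ek; fun_prop

lemma integral_ek (k : ℤ) : ∫ t in (0:ℝ)..1, ek k t = if k = 0 then 1 else 0 := by
  split_ifs with h
  · subst h; simp
  · have hne : (2 * π * Complex.I * k : ℂ) ≠ 0 := by
      simp [Real.pi_ne_zero, h, Complex.I_ne_zero]
    have := intervalIntegral.integral_eq_sub_of_hasDerivAt (a := 0) (b := 1)
      (fun t _ => hasDerivAt_ek k t) ((by fun_prop : Continuous fun t => 2 * π * Complex.I * k * ek k t).intervalIntegrable _ _)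
    rw [intervalIntegral.integral_const_mul] at this
    have h0 : ek k 0 = 1 := by simpa using ek_int k 0
    have h1 : ek k 1 = 1 := by simpa using ek_int k 1
    rw [h0, h1, sub_self] at this
    exact (mul_eq_zero.1 this).resolve_left hne

section
attribute [local instance] InnerProductSpace.complexToReal
variable {V : Type*} [NormedAddCommGroup V] [InnerProductSpace ℂ V]
variable {ι : Type*} [Fintype ι]

/-- The trigonometric polynomial with frequencies `φ i` and coefficients `x i`. -/
def trigPoly (φ : ι → ℤ) (x : ι → V) (t : ℝ) : V := ∑ i, ek (φ i) t • x i

/-- Fourier coefficients on `[0, 1]`. -/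
def fcoef (F : ℝ → V) (k : ℤ) : V := ∫ t in (0:ℝ)..1, ek (-k) t • F t

@[fun_prop] lemma continuous_trigPoly (φ : ι → ℤ) (x : ι → V) : Continuous (trigPoly φ x) := by
  unfold trigPoly; fun_prop

lemma trigPoly_add_one (φ : ι → ℤ) (x : ι → V) (t : ℝ) :
    trigPoly φ x (t + 1) = trigPoly φ x t := by
  simp [trigPoly, ek_add_one]

lemma trigPoly_add (φ : ι → ℤ) (x y : ι → V) (t : ℝ) :
    trigPoly φ (x + y) t = trigPoly φ x t + trigPoly φ y t := by
  simp [trigPoly, Finset.sum_add_distrib]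

lemma hasDerivAt_trigPoly (φ : ι → ℤ) (x : ι → V) (t : ℝ) :
    HasDerivAt (trigPoly φ x)
      (trigPoly φ (fun i => (2 * π * Complex.I * φ i : ℂ) • x i) t) t := by
  unfold trigPoly
  refine HasDerivAt.fun_sum fun i _ => ?_
  have := (hasDerivAt_ek (φ i) t).smul_const (x i)
  rw [smul_smul, mul_comm (ek _ _)]
  exact this

variable [CompleteSpace V]

lemma integral_inner_trigPoly {F : ℝ → V} (hF : Continuous F) (φ : ι → ℤ) (d : ι → V) :
    ∫ t in (0:ℝ)..1, inner ℝ (F t) (trigPoly φ d t) = ∑ i, inner ℝ (fcoef F (φ i)) (d i) := by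
  have h1 : ∀ t, inner ℝ (F t) (trigPoly φ d t) = ∑ i, inner ℝ (d i) (ek (-φ i) t • F t) := by
    intro t
    rw [trigPoly, inner_sum]
    refine Finset.sum_congr rfl fun i _ => ?_
    rw [real_inner_comm, real_inner_eq_re_inner ℂ, real_inner_eq_re_inner ℂ, inner_smul_left,
      inner_smul_right, conj_ek]
  simp_rw [h1]
  rw [intervalIntegral.integral_finsetSum]
  · refine Finset.sum_congr rfl fun i _ => ?_
    rw [real_inner_comm, fcoef]
    have hInt : IntervalIntegrable (fun t => ek (-φ i) t • F t) MeasureTheory.volume 0 1 :=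
      (by fun_prop : Continuous fun t => ek (-φ i) t • F t).intervalIntegrable _ _
    exact ((innerSL ℝ (d i)).intervalIntegral_comp_comm hInt)
  · intro i _
    exact (by fun_prop : Continuous fun t => inner ℝ (d i) (ek (-φ i) t • F t)).intervalIntegrable _ _

lemma fcoef_trigPoly_eq (φ : ι → ℤ) (x : ι → V) (k : ℤ) :
    fcoef (trigPoly φ x) k = ∑ i, if φ i = k then x i else 0 := by
  unfold fcoef trigPoly
  simp_rw [Finset.smul_sum, smul_smul, ← ek_add]
  rw [intervalIntegral.integral_finsetSum]
  · refine Finset.sum_congr rfl fun i _ => ?_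
    rw [intervalIntegral.integral_smul_const, integral_ek]
    by_cases h : φ i = k
    · simp [h]
    · rw [if_neg h, if_neg (by omega), zero_smul]
  · intro i _
    exact (by fun_prop : Continuous fun t => ek (-k + φ i) t • x i).intervalIntegrable _ _

lemma fcoef_trigPoly {φ : ι → ℤ} (hφ : Function.Injective φ) (x : ι → V) (i : ι) :
    fcoef (trigPoly φ x) (φ i) = x i := by
  classical
  rw [fcoef_trigPoly_eq]
  simp [hφ.eq_iff]

lemma integral_inner_trigPoly_trigPoly {φ : ι → ℤ} (hφ : Function.Injective φ) (x y : ι → V) :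
    ∫ t in (0:ℝ)..1, inner ℝ (trigPoly φ x t) (trigPoly φ y t) = ∑ i, inner ℝ (x i) (y i) := by
  rw [integral_inner_trigPoly (continuous_trigPoly φ x)]
  simp_rw [fcoef_trigPoly hφ]

lemma integral_norm_sq_trigPoly {φ : ι → ℤ} (hφ : Function.Injective φ) (x : ι → V) :
    ∫ t in (0:ℝ)..1, ‖trigPoly φ x t‖ ^ 2 = ∑ i, ‖x i‖ ^ 2 := by
  simp_rw [← real_inner_self_eq_norm_sq]
  exact integral_inner_trigPoly_trigPoly hφ x x

lemma sum_norm_sq_fcoef_le {φ : ι → ℤ} (hφ : Function.Injective φ) {F : ℝ → V}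
    (hF : Continuous F) :
    ∑ i, ‖fcoef F (φ i)‖ ^ 2 ≤ ∫ t in (0:ℝ)..1, ‖F t‖ ^ 2 := by
  set x : ι → V := fun i => fcoef F (φ i)
  have h1 : 0 ≤ ∫ t in (0:ℝ)..1, ‖F t - trigPoly φ x t‖ ^ 2 :=
    intervalIntegral.integral_nonneg zero_le_one fun t _ => by positivity
  have h2 : ∀ t, ‖F t - trigPoly φ x t‖ ^ 2 =
      ‖F t‖ ^ 2 - 2 * inner ℝ (F t) (trigPoly φ x t) + ‖trigPoly φ x t‖ ^ 2 := fun t =>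
    norm_sub_sq_real _ _
  simp_rw [h2] at h1
  have i1 : IntervalIntegrable (fun t => ‖F t‖ ^ 2) MeasureTheory.volume 0 1 :=
    (by fun_prop : Continuous _).intervalIntegrable _ _
  have i2 : IntervalIntegrable (fun t => 2 * inner ℝ (F t) (trigPoly φ x t)) MeasureTheory.volume 0 1 :=
    (by fun_prop : Continuous _).intervalIntegrable _ _
  have i3 : IntervalIntegrable (fun t => ‖trigPoly φ x t‖ ^ 2) MeasureTheory.volume 0 1 :=
    (by fun_prop : Continuous _).intervalIntegrable _ _
  rw [intervalIntegral.integral_add (i1.sub i2) i3, intervalIntegral.integral_sub i1 i2,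
    intervalIntegral.integral_const_mul, integral_inner_trigPoly hF,
    integral_norm_sq_trigPoly hφ] at h1
  have h3 : ∑ i, inner ℝ (fcoef F (φ i)) (x i) = ∑ i, ‖x i‖ ^ 2 :=
    Finset.sum_congr rfl fun i _ => real_inner_self_eq_norm_sq _
  linarith

end

lemma sum_one_div_sq_le (s : Finset ℤ) (hs : ∀ j ∈ s, 0 < j) : ∑ j ∈ s, 1 / (j:ℝ) ^ 2 ≤ 2 := by
  obtain ⟨n, hn⟩ : ∃ n : ℕ, ∀ j ∈ s, j ≤ n := by
    obtain ⟨b, hb⟩ := s.bddAbove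
    exact ⟨b.toNat, fun j hj => (hb hj).trans (Int.self_le_toNat b)⟩
  have hsub : s ⊆ (Finset.range n).image (fun m : ℕ => (m:ℤ) + 1) := by
    intro j hj
    have h1 := hs j hj
    have h2 := hn j hj
    rw [Finset.mem_image]
    refine ⟨(j - 1).toNat, ?_, ?_⟩
    · rw [Finset.mem_range]; omega
    · omega
  refine (Finset.sum_le_sum_of_subset_of_nonneg hsub fun _ _ _ => by positivity).trans ?_
  rw [Finset.sum_image (fun a _ b _ h => by simpa using h)]
  have key : ∀ n : ℕ, ∑ m ∈ Finset.range (n + 1), 1 / (((m : ℤ) + 1 : ℤ) : ℝ) ^ 2 ≤ 2 - 1 / ((n : ℝ) + 1) := by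
    intro n
    induction n with
    | zero => norm_num
    | succ n ih =>
      rw [Finset.sum_range_succ]
      push_cast at ih ⊢
      have h1 : (1:ℝ) / (n + 1 + 1) ^ 2 ≤ 1 / ((n:ℝ) + 1) - 1 / ((n:ℝ) + 1 + 1) := by
        have h2 : 1 / ((n:ℝ) + 1) - 1 / ((n:ℝ) + 1 + 1) = 1 / ((n + 1) * (n + 1 + 1)) := by
          field_simp; ring
        rw [h2]
        gcongr
        nlinarith
      linarith
  rcases n with _ | n
  · simp
  · refine (key n).trans ?_
    have : (0:ℝ) ≤ 1 / ((n : ℝ) + 1) := by positivity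
    linarith

section
attribute [local instance] InnerProductSpace.complexToReal
variable {V : Type*} [NormedAddCommGroup V] [InnerProductSpace ℂ V]
variable {ι : Type*} [Fintype ι]

lemma norm_sq_trigPoly_eq [DecidableEq ι] (φ : ι → ℤ) (x : ι → V) (t : ℝ) :
    ((‖trigPoly φ x t‖ ^ 2 : ℝ) : ℂ) =
      ∑ m ∈ Finset.univ.image (fun p : ι × ι => φ p.2 - φ p.1), ek m t *
        ∑ p : ι × ι with φ p.2 - φ p.1 = m, inner ℂ (x p.1) (x p.2) := by
  have h1 : ((‖trigPoly φ x t‖ ^ 2 : ℝ) : ℂ) =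
      ∑ p : ι × ι, ek (φ p.2 - φ p.1) t * inner ℂ (x p.1) (x p.2) := by
    push_cast
    have := inner_self_eq_norm_sq_to_K (𝕜 := ℂ) (trigPoly φ x t)
    simp only [Complex.coe_algebraMap] at this
    rw [← this]
    rw [trigPoly, sum_inner, Fintype.sum_prod_type]
    refine Finset.sum_congr rfl fun i _ => ?_
    rw [inner_sum]
    refine Finset.sum_congr rfl fun j _ => ?_
    rw [inner_smul_left, inner_smul_right, conj_ek, sub_eq_neg_add, ek_add, mul_assoc]
  rw [h1, ← Finset.sum_fiberwise_of_maps_to (t := Finset.univ.image (fun p : ι × ι => φ p.2 - φ p.1))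
    (g := fun p : ι × ι => φ p.2 - φ p.1) (fun p _ => Finset.mem_image_of_mem _ (Finset.mem_univ p))]
  refine Finset.sum_congr rfl fun m _ => ?_
  rw [Finset.mul_sum]
  refine Finset.sum_congr rfl fun p hp => ?_
  rw [(Finset.mem_filter.1 hp).2]

lemma integral_norm_pow_four_trigPoly_le {φ : ι → ℤ} (hφ : Function.Injective φ) (x : ι → V)
    (hx : ∀ i, φ i ≤ 0 → x i = 0) :
    ∫ t in (0:ℝ)..1, ‖trigPoly φ x t‖ ^ 4 ≤
      2 * (∑ i with 0 < φ i, (φ i : ℝ) * ‖x i‖ ^ 2) ^ 2 := by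
  classical
  set T := Finset.univ.image (fun p : ι × ι => φ p.2 - φ p.1)
  set c : ℤ → ℂ := fun m => ∑ p : ι × ι with φ p.2 - φ p.1 = m, inner ℂ (x p.1) (x p.2)
  have h1 : ∀ t, ‖trigPoly φ x t‖ ^ 4 = ‖trigPoly (fun m : T => (m : ℤ)) (fun m : T => c m) t‖ ^ 2 := by
    intro t
    have := norm_sq_trigPoly_eq φ x t
    have h2 : trigPoly (fun m : T => (m : ℤ)) (fun m : T => c m) t
        = ((‖trigPoly φ x t‖ ^ 2 : ℝ) : ℂ) := by
      rw [this, trigPoly]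
      exact Finset.sum_coe_sort T (fun m => ek m t • c m)
    rw [h2, Complex.norm_real, Real.norm_of_nonneg (by positivity)]
    ring
  simp_rw [h1]
  rw [integral_norm_sq_trigPoly Subtype.val_injective]
  rw [Finset.sum_coe_sort T (fun m => ‖c m‖ ^ 2)]
  set a : ι → ℝ := fun i => if 0 < φ i then (φ i : ℝ) * ‖x i‖ ^ 2 else 0 with ha
  have ha0 : ∀ i, 0 ≤ a i := by
    intro i; simp only [ha]; split_ifs with h
    · have : (0:ℝ) < φ i := by exact_mod_cast h
      positivity
    · exact le_rfl
  have hsum : ∑ i with 0 < φ i, (φ i : ℝ) * ‖x i‖ ^ 2 = ∑ i, a i := by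
    rw [Finset.sum_filter]
  rw [hsum]
  set w : ι → ℝ := fun i => if 0 < φ i then 1 / (φ i : ℝ) ^ 2 else 0 with hw
  have hw0 : ∀ i, 0 ≤ w i := by
    intro i; simp only [hw]; split_ifs <;> positivity
  have hwsum : ∑ i, w i ≤ 2 := by
    rw [← Finset.sum_filter, ← Finset.sum_image (f := fun j : ℤ => 1 / (j:ℝ)^2) (g := φ)
      (fun _ _ _ _ h => hφ h)]
    exact sum_one_div_sq_le _ (by simp)
  have key : ∀ m, ‖c m‖ ^ 2 ≤ 2 * ∑ p : ι × ι with φ p.2 - φ p.1 = m, a p.1 * a p.2 := by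
    intro m
    set F : Finset (ι × ι) := {p : ι × ι | φ p.2 - φ p.1 = m} with hF
    set v : ι → ℝ := fun i => if 0 < φ i then 1 / (φ i : ℝ) else 0 with hv
    have hv0 : ∀ i, 0 ≤ v i := by
      intro i; simp only [hv]; split_ifs with h
      · have : (0:ℝ) < φ i := by exact_mod_cast h
        positivity
      · exact le_rfl
    have hvw : ∀ i, v i ^ 2 = w i := by
      intro i; simp only [hv, hw]; split_ifs <;> simp
    have hva : ∀ i, v i * a i = ‖x i‖ ^ 2 := by
      intro i; simp only [hv, ha]; split_ifs with h
      · have : (0:ℝ) < φ i := by exact_mod_cast h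
        field_simp
      · simp [hx i (not_lt.1 h)]
    have e1 : ‖c m‖ ≤ ∑ p ∈ F, ‖x p.1‖ * ‖x p.2‖ :=
      (norm_sum_le _ _).trans (Finset.sum_le_sum fun p _ => norm_inner_le_norm _ _)
    have e2 : (∑ p ∈ F, ‖x p.1‖ * ‖x p.2‖) ^ 2 ≤
        (∑ p ∈ F, v p.1 * v p.2) * ∑ p ∈ F, a p.1 * a p.2 := by
      refine Finset.sum_sq_le_sum_mul_sum_of_sq_le_mul F (fun p _ => mul_nonneg (hv0 _) (hv0 _))
        (fun p _ => mul_nonneg (ha0 _) (ha0 _)) (fun p _ => le_of_eq ?_)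
      rw [mul_pow, ← hva, ← hva]; ring
    have f1 : ∑ p ∈ F, w p.1 ≤ 2 := by
      rw [← Finset.sum_image (f := w) (g := Prod.fst)]
      · exact (Finset.sum_le_univ_sum_of_nonneg hw0).trans hwsum
      · intro p hp q hq h
        have hp' := (Finset.mem_filter.1 hp).2
        have hq' := (Finset.mem_filter.1 hq).2
        refine Prod.ext h (hφ ?_)
        rw [h] at hp'
        linarith
    have f2 : ∑ p ∈ F, w p.2 ≤ 2 := by
      rw [← Finset.sum_image (f := w) (g := Prod.snd)]
      · exact (Finset.sum_le_univ_sum_of_nonneg hw0).trans hwsum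
      · intro p hp q hq h
        have hp' := (Finset.mem_filter.1 hp).2
        have hq' := (Finset.mem_filter.1 hq).2
        refine Prod.ext (hφ ?_) h
        rw [h] at hp'
        linarith
    have e3 : ∑ p ∈ F, v p.1 * v p.2 ≤ 2 := by
      calc ∑ p ∈ F, v p.1 * v p.2 ≤ ∑ p ∈ F, (w p.1 + w p.2) / 2 := by
            refine Finset.sum_le_sum fun p _ => ?_
            rw [← hvw, ← hvw]
            nlinarith [sq_nonneg (v p.1 - v p.2)]
        _ = (∑ p ∈ F, w p.1 + ∑ p ∈ F, w p.2) / 2 := by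
            rw [← Finset.sum_div, Finset.sum_add_distrib]
        _ ≤ 2 := by linarith
    have e4 : 0 ≤ ∑ p ∈ F, a p.1 * a p.2 := Finset.sum_nonneg fun p _ => mul_nonneg (ha0 _) (ha0 _)
    calc ‖c m‖ ^ 2 ≤ (∑ p ∈ F, ‖x p.1‖ * ‖x p.2‖) ^ 2 := by gcongr
      _ ≤ _ := e2
      _ ≤ _ := by gcongr
  calc ∑ m ∈ T, ‖c m‖ ^ 2 ≤ ∑ m ∈ T, 2 * ∑ p : ι × ι with φ p.2 - φ p.1 = m, a p.1 * a p.2 :=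
        Finset.sum_le_sum fun m _ => key m
    _ = 2 * ∑ p : ι × ι, a p.1 * a p.2 := by
        rw [← Finset.mul_sum, Finset.sum_fiberwise_of_maps_to
          (fun p _ => Finset.mem_image_of_mem _ (Finset.mem_univ p))]
    _ = 2 * (∑ i, a i) ^ 2 := by
        rw [sq, Finset.sum_mul_sum, Fintype.sum_prod_type]

end

section
attribute [local instance] InnerProductSpace.complexToReal
variable {V : Type*} [NormedAddCommGroup V] [InnerProductSpace ℂ V]
variable {ι : Type*} [Fintype ι]

/-- The action functional restricted to trigonometric polynomials with frequencies `φ`. -/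
def galerkinAction (H : V → ℝ) (φ : ι → ℤ) (x : ι → V) : ℝ :=
  π * ∑ i, (φ i : ℝ) * ‖x i‖ ^ 2 - ∫ t in (0:ℝ)..1, H (trigPoly φ x t)

/-- The `L²` gradient of `galerkinAction`. -/
def galerkinGrad (G : V → V) (φ : ι → ℤ) (x : ι → V) (i : ι) : V :=
  (2 * π * φ i : ℝ) • x i - fcoef (fun t => G (trigPoly φ x t)) (φ i)

lemma continuous_trigPoly_uncurry (φ : ι → ℤ) :
    Continuous (fun p : (ι → V) × ℝ => trigPoly φ p.1 p.2) := by
  unfold trigPoly; fun_prop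

lemma continuous_galerkinAction {H : V → ℝ} (hH : Continuous H) (φ : ι → ℤ) :
    Continuous (galerkinAction H φ) := by
  unfold galerkinAction
  refine Continuous.sub (by fun_prop) ?_
  exact intervalIntegral.continuous_parametric_intervalIntegral_of_continuous'
    (f := fun x t => H (trigPoly φ x t)) (hH.comp (continuous_trigPoly_uncurry φ)) 0 1

lemma continuous_galerkinGrad {G : V → V} (hG : Continuous G) (φ : ι → ℤ) :
    Continuous (galerkinGrad G φ) := by
  unfold galerkinGrad fcoef
  refine continuous_pi fun i => Continuous.sub (by fun_prop) ?_
  refine intervalIntegral.continuous_parametric_intervalIntegral_of_continuous' ?_ 0 1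
  exact ((continuous_ek _).comp continuous_snd).smul (hG.comp (continuous_trigPoly_uncurry φ))

variable [CompleteSpace V]

lemma galerkinAction_add_le {H : V → ℝ} {G : V → V} {L : ℝ} (hH : Continuous H)
    (hG : Continuous G)
    (hL : ∀ z w, H z + inner ℝ (G z) w - L * ‖w‖ ^ 2 ≤ H (z + w))
    {φ : ι → ℤ} (hφ : Function.Injective φ) {N : ℝ} (hN : ∀ i, (φ i : ℝ) ≤ N) (x d : ι → V) :
    galerkinAction H φ (x + d) ≤ galerkinAction H φ x
      + ∑ i, inner ℝ (galerkinGrad G φ x i) (d i) + (π * N + L) * ∑ i, ‖d i‖ ^ 2 := by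
  have c1 : Continuous (fun t => H (trigPoly φ x t)) := by fun_prop
  have c2 : Continuous (fun t => inner ℝ (G (trigPoly φ x t)) (trigPoly φ d t)) := by fun_prop
  have c12 : Continuous (fun t => H (trigPoly φ x t) +
      inner ℝ (G (trigPoly φ x t)) (trigPoly φ d t)) := c1.add c2
  have c3 : Continuous (fun t => L * ‖trigPoly φ d t‖ ^ 2) := by fun_prop
  have c4 : Continuous (fun t => H (trigPoly φ (x + d) t)) := by fun_prop
  have h1 : (∫ t in (0:ℝ)..1, H (trigPoly φ x t)) +
      ∑ i, inner ℝ (fcoef (fun t => G (trigPoly φ x t)) (φ i)) (d i) - L * ∑ i, ‖d i‖ ^ 2 ≤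
      ∫ t in (0:ℝ)..1, H (trigPoly φ (x + d) t) := by
    rw [← integral_inner_trigPoly (F := fun t => G (trigPoly φ x t)) (by fun_prop),
      ← integral_norm_sq_trigPoly hφ, ← intervalIntegral.integral_const_mul,
      ← intervalIntegral.integral_add (c1.intervalIntegrable _ _) (c2.intervalIntegrable _ _),
      ← intervalIntegral.integral_sub (c12.intervalIntegrable _ _)
        (c3.intervalIntegrable _ _)]
    refine intervalIntegral.integral_mono_on zero_le_one
      ((c12.sub c3).intervalIntegrable _ _) (c4.intervalIntegrable _ _) fun t _ => ?_
    rw [trigPoly_add]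
    exact hL _ _
  have h2 : ∀ i, (φ i : ℝ) * ‖(x + d) i‖ ^ 2 ≤ (φ i : ℝ) * ‖x i‖ ^ 2 +
      (φ i * (2 * inner ℝ (x i) (d i)) + N * ‖d i‖ ^ 2) := by
    intro i
    rw [Pi.add_apply, norm_add_sq_real]
    have := mul_le_mul_of_nonneg_right (hN i) (sq_nonneg ‖d i‖)
    linarith
  have h3 := Finset.sum_le_sum (fun i (_ : i ∈ Finset.univ) => h2 i)
  simp only [Finset.sum_add_distrib, ← Finset.mul_sum] at h3
  have h4 : ∑ i, inner ℝ (galerkinGrad G φ x i) (d i) = π * ∑ i, φ i * (2 * inner ℝ (x i) (d i))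
      - ∑ i, inner ℝ (fcoef (fun t => G (trigPoly φ x t)) (φ i)) (d i) := by
    rw [Finset.mul_sum, ← Finset.sum_sub_distrib]
    refine Finset.sum_congr rfl fun i _ => ?_
    rw [galerkinGrad, inner_sub_left, real_inner_smul_left]
    ring
  have h5 := mul_le_mul_of_nonneg_left h3 Real.pi_pos.le
  unfold galerkinAction
  rw [h4]
  linarith

lemma galerkinAction_step {H : V → ℝ} {G : V → V} {L : ℝ} (hH : Continuous H)
    (hG : Continuous G)
    (hL : ∀ z w, H z + inner ℝ (G z) w - L * ‖w‖ ^ 2 ≤ H (z + w))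
    {φ : ι → ℤ} (hφ : Function.Injective φ) {N : ℝ} (hN : ∀ i, (φ i : ℝ) ≤ N) (x : ι → V)
    {t : ℝ} (ht : 0 ≤ t) (ht2 : t * (π * N + L) ≤ 1 / 2) :
    galerkinAction H φ (x - t • galerkinGrad G φ x) ≤ galerkinAction H φ x
      - t / 2 * ∑ i, ‖galerkinGrad G φ x i‖ ^ 2 := by
  have := galerkinAction_add_le hH hG hL hφ hN x (-(t • galerkinGrad G φ x))
  rw [← sub_eq_add_neg] at this
  refine this.trans ?_
  simp only [Pi.neg_apply, Pi.smul_apply, inner_neg_right, real_inner_smul_right, norm_neg,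
    norm_smul, real_inner_self_eq_norm_sq, mul_pow, Finset.sum_neg_distrib, ← Finset.mul_sum,
    Real.norm_eq_abs, sq_abs]
  have h0 : 0 ≤ ∑ i, ‖galerkinGrad G φ x i‖ ^ 2 := Finset.sum_nonneg fun _ _ => by positivity
  nlinarith [mul_le_mul_of_nonneg_right ht2 (mul_nonneg ht h0)]

/-- Hypotheses on a Hamiltonian `H` with gradient `G`. -/
structure AdmissibleHam (H : V → ℝ) (G : V → V) (v₁ : V) : Prop where
  continuous_ham : Continuous H
  continuous_grad : Continuous G
  exists_descent : ∃ L : ℝ, 0 ≤ L ∧ ∀ z w, H z + inner ℝ (G z) w - L * ‖w‖ ^ 2 ≤ H (z + w)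
  nonneg : ∀ z, 0 ≤ H z
  exists_quartic : ∃ C : ℝ, ∀ z, H z ≤ C * ‖z‖ ^ 4
  exists_growth : ∃ b₁ b₂ C : ℝ, 0 ≤ b₁ ∧ 0 < b₂ ∧ π < b₁ + b₂ ∧
    ∀ z, b₁ * ‖(inner ℂ v₁ z : ℂ)‖ ^ 2 + b₂ * ‖z‖ ^ 2 - C ≤ H z

end

lemma norm_sq_le_sum_norm_sq {V : Type*} [NormedAddCommGroup V] {ι : Type*} [Fintype ι] (x : ι → V) : ‖x‖ ^ 2 ≤ ∑ i, ‖x i‖ ^ 2 := by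
  have h : ‖x‖ ≤ √(∑ i, ‖x i‖ ^ 2) := by
    refine (pi_norm_le_iff_of_nonneg (by positivity)).2 fun i => Real.le_sqrt_of_sq_le ?_
    exact Finset.single_le_sum (f := fun i => ‖x i‖ ^ 2) (fun _ _ => by positivity)
      (Finset.mem_univ i)
  calc ‖x‖ ^ 2 ≤ √(∑ i, ‖x i‖ ^ 2) ^ 2 := by gcongr
    _ = _ := Real.sq_sqrt (Finset.sum_nonneg fun _ _ => by positivity)

section
variable {V : Type*} [NormedAddCommGroup V] [InnerProductSpace ℂ V] {ι : Type*}

/-- Projection onto nonpositive frequencies. -/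
def nonposProj (φ : ι → ℤ) : (ι → V) →L[ℝ] (ι → V) :=
  ContinuousLinearMap.pi fun i =>
    if φ i ≤ 0 then ContinuousLinearMap.proj i else 0

lemma nonposProj_apply (φ : ι → ℤ) (x : ι → V) (i : ι) :
    nonposProj φ x i = if φ i ≤ 0 then x i else 0 := by
  simp only [nonposProj, ContinuousLinearMap.coe_pi']
  split_ifs <;> simp

lemma sum_update_eq [Fintype ι] [DecidableEq ι] {φ : ι → ℤ} {i₁ : ι} (hi₁ : φ i₁ = 1)
    (w : ι → V) (s : ℝ) {v₁ : V} (hv₁ : ‖v₁‖ = 1) (c : ι → ℝ) :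
    ∑ i, c i * ‖(nonposProj φ w + s • (Pi.single i₁ v₁ : ι → V)) i‖ ^ 2 =
      ∑ i, c i * (if φ i ≤ 0 then ‖w i‖ ^ 2 else 0) + c i₁ * s ^ 2 := by
  have : ∀ i, c i * ‖(nonposProj φ w + s • (Pi.single i₁ v₁ : ι → V)) i‖ ^ 2 =
      c i * (if φ i ≤ 0 then ‖w i‖ ^ 2 else 0) + if i = i₁ then c i₁ * s ^ 2 else 0 := by
    intro i
    rw [Pi.add_apply, nonposProj_apply, Pi.smul_apply]
    by_cases h : i = i₁
    · subst h; simp [hi₁, norm_smul, hv₁]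
    · simp [h]; split_ifs <;> simp
  simp_rw [this, Finset.sum_add_distrib]
  simp

end

section
attribute [local instance] InnerProductSpace.complexToReal
variable {V : Type*} [NormedAddCommGroup V] [InnerProductSpace ℂ V] [FiniteDimensional ℂ V]
variable {ι : Type*} [Fintype ι]

lemma le_integral_ham {H : V → ℝ} {v₁ : V} {b₁ b₂ C : ℝ} (hH : Continuous H)
    (hb₁ : 0 ≤ b₁)
    (hgr : ∀ z, b₁ * ‖(inner ℂ v₁ z : ℂ)‖ ^ 2 + b₂ * ‖z‖ ^ 2 - C ≤ H z)
    {φ : ι → ℤ} (hφ : Function.Injective φ) (x : ι → V) (i₁ : ι) :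
    b₁ * ‖(inner ℂ v₁ (x i₁) : ℂ)‖ ^ 2 + b₂ * ∑ i, ‖x i‖ ^ 2 - C ≤
      ∫ t in (0:ℝ)..1, H (trigPoly φ x t) := by
  have : CompleteSpace V := FiniteDimensional.complete ℂ V
  have e1 : ∀ t, (inner ℂ v₁ (trigPoly φ x t) : ℂ) = trigPoly φ (fun i => (inner ℂ v₁ (x i) : ℂ)) t := by
    intro t
    simp [trigPoly, inner_sum, inner_smul_right]
  have c1 : Continuous (fun t => b₁ * ‖(inner ℂ v₁ (trigPoly φ x t) : ℂ)‖ ^ 2) := by fun_prop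
  have c2 : Continuous (fun t => b₂ * ‖trigPoly φ x t‖ ^ 2) := by fun_prop
  have c3 : Continuous (fun t => b₁ * ‖(inner ℂ v₁ (trigPoly φ x t) : ℂ)‖ ^ 2 + b₂ * ‖trigPoly φ x t‖ ^ 2 - C) := by
    fun_prop
  have c12 : Continuous (fun t => b₁ * ‖(inner ℂ v₁ (trigPoly φ x t) : ℂ)‖ ^ 2 + b₂ * ‖trigPoly φ x t‖ ^ 2) := by
    fun_prop
  have h1 := intervalIntegral.integral_mono_on (μ := MeasureTheory.volume) zero_le_one
    (c3.intervalIntegrable 0 1)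
    ((by fun_prop : Continuous (fun t => H (trigPoly φ x t))).intervalIntegrable 0 1)
    (fun t _ => hgr (trigPoly φ x t))
  rw [intervalIntegral.integral_sub (c12.intervalIntegrable _ _)
    intervalIntegrable_const, intervalIntegral.integral_add (c1.intervalIntegrable _ _)
    (c2.intervalIntegrable _ _), intervalIntegral.integral_const_mul,
    intervalIntegral.integral_const_mul, integral_norm_sq_trigPoly hφ] at h1
  simp_rw [e1] at h1
  rw [integral_norm_sq_trigPoly hφ] at h1
  have h2 : ‖(inner ℂ v₁ (x i₁) : ℂ)‖ ^ 2 ≤ ∑ i, ‖(inner ℂ v₁ (x i) : ℂ)‖ ^ 2 :=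
    Finset.single_le_sum (f := fun i => ‖(inner ℂ v₁ (x i) : ℂ)‖ ^ 2) (fun _ _ => by positivity)
      (Finset.mem_univ i₁)
  have h3 := mul_le_mul_of_nonneg_left h2 hb₁
  simp at h1
  linarith

lemma exists_galerkin_level {H : V → ℝ} {G : V → V} {v₁ : V} (hA : AdmissibleHam H G v₁) :
    ∃ α β : ℝ, 0 < α ∧ 0 < β ∧ ∀ {κ : Type} [Fintype κ] {φ : κ → ℤ}, Function.Injective φ →
      ∀ x : κ → V, nonposProj φ x = 0 →
      √(∑ i with 0 < φ i, (φ i : ℝ) * ‖x i‖ ^ 2) = α → β ≤ galerkinAction H φ x := by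
  obtain ⟨C, hC⟩ := hA.exists_quartic
  have : CompleteSpace V := FiniteDimensional.complete ℂ V
  set C' := max C 1 with hC'
  have hC'1 : 1 ≤ C' := le_max_right _ _
  have hpi := Real.pi_gt_three
  refine ⟨1 / √C', π / C' - 2 / C', by positivity, ?_, ?_⟩
  · rw [← sub_div]; apply div_pos <;> linarith
  intro κ _ φ hφ x hx hα
  have hx' : ∀ i, φ i ≤ 0 → x i = 0 := by
    intro i hi
    have := congrFun hx i
    rwa [nonposProj_apply, if_pos hi] at this
  set S := ∑ i with 0 < φ i, (φ i : ℝ) * ‖x i‖ ^ 2 with hS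
  have hS0 : 0 ≤ S := by
    refine Finset.sum_nonneg fun i hi => ?_
    have : (0:ℝ) < φ i := by exact_mod_cast (Finset.mem_filter.1 hi).2
    positivity
  have hSe : S = 1 / C' := by
    rw [← Real.sq_sqrt hS0, hα, div_pow, Real.sq_sqrt (by linarith), one_pow]
  have h1 : ∑ i, (φ i : ℝ) * ‖x i‖ ^ 2 = S := by
    rw [hS, Finset.sum_filter]
    refine Finset.sum_congr rfl fun i _ => ?_
    split_ifs with h
    · rfl
    · simp [hx' i (not_lt.1 h)]
  have h2 : ∫ t in (0:ℝ)..1, H (trigPoly φ x t) ≤ C' * (2 * S ^ 2) := by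
    calc ∫ t in (0:ℝ)..1, H (trigPoly φ x t) ≤ ∫ t in (0:ℝ)..1, C' * ‖trigPoly φ x t‖ ^ 4 := by
          have := hA.continuous_ham
          refine intervalIntegral.integral_mono_on zero_le_one
            ((by fun_prop : Continuous _).intervalIntegrable _ _)
            ((by fun_prop : Continuous _).intervalIntegrable _ _) fun t _ => ?_
          refine (hC _).trans ?_
          gcongr
          exact le_max_left _ _
      _ = C' * ∫ t in (0:ℝ)..1, ‖trigPoly φ x t‖ ^ 4 := intervalIntegral.integral_const_mul _ _
      _ ≤ _ := by gcongr; exact integral_norm_pow_four_trigPoly_le hφ x hx'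
  have h3 : C' * (2 * S ^ 2) = 2 / C' := by rw [hSe]; field_simp
  unfold galerkinAction
  rw [h1, hSe]
  rw [h3] at h2
  have : π * (1 / C') = π / C' := by ring
  linarith

/-- Almost critical points of the Galerkin action at a uniformly positive level. -/
lemma exists_galerkin_almost_critical {H : V → ℝ} {G : V → V} {v₁ : V}
    (hv₁ : ‖v₁‖ = 1) (hA : AdmissibleHam H G v₁) :
    ∃ β : ℝ, 0 < β ∧ ∀ {κ : Type} [Fintype κ] {φ : κ → ℤ}, Function.Injective φ →
      (∃ i₁, φ i₁ = 1) → ∀ ε : ℝ, 0 < ε →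
      ∃ x : κ → V, β ≤ galerkinAction H φ x ∧ ∑ i, ‖galerkinGrad G φ x i‖ ^ 2 ≤ ε := by
  classical
  obtain ⟨α, β, hα, hβ, hlevel⟩ := exists_galerkin_level hA
  have : CompleteSpace V := FiniteDimensional.complete ℂ V
  have : FiniteDimensional ℝ V := FiniteDimensional.complexToReal V
  refine ⟨β, hβ, ?_⟩
  intro κ _ φ hφ ⟨i₁, hi₁⟩ ε hε
  obtain ⟨L, hL0, hL⟩ := hA.exists_descent
  obtain ⟨b₁, b₂, C, hb₁, hb₂, hb, hgr⟩ := hA.exists_growth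
  obtain ⟨N, hN1, hN⟩ : ∃ N : ℝ, 0 < N ∧ ∀ i, (φ i : ℝ) ≤ N := by
    refine ⟨1 + ∑ i, |(φ i : ℝ)|, by positivity, fun i => ?_⟩
    have h : |(φ i : ℝ)| ≤ ∑ i, |(φ i : ℝ)| :=
      Finset.single_le_sum (f := fun i => |(φ i : ℝ)|) (fun _ _ => by positivity)
        (Finset.mem_univ i)
    linarith [le_abs_self (φ i : ℝ)]
  have hsplit : ∀ w : κ → V, ∀ s : ℝ, ∑ i, (φ i : ℝ) * ‖(nonposProj φ w + s • (Pi.single i₁ v₁ : κ → V)) i‖ ^ 2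
      ≤ s ^ 2 := by
    intro w s
    rw [sum_update_eq hi₁ w s hv₁]
    have : ∑ i, (φ i : ℝ) * (if φ i ≤ 0 then ‖w i‖ ^ 2 else 0) ≤ 0 := by
      refine Finset.sum_nonpos fun i _ => ?_
      split_ifs with h
      · have : (φ i : ℝ) ≤ 0 := by exact_mod_cast h
        exact mul_nonpos_of_nonpos_of_nonneg this (by positivity)
      · simp
    rw [hi₁]
    push_cast
    linarith
  have hbc : 0 < min b₂ (b₁ + b₂ - π) := lt_min hb₂ (by linarith)
  obtain ⟨y, hy1, hy2⟩ := exists_almost_critical_of_linking (X := κ → V)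
    (Φ := galerkinAction H φ) (D := galerkinGrad G φ)
    (ρ := fun x => √(∑ i with 0 < φ i, (φ i : ℝ) * ‖x i‖ ^ 2))
    (q := fun x => ∑ i, ‖galerkinGrad G φ x i‖ ^ 2) (α := α) (β := β)
    (continuous_galerkinAction hA.continuous_ham φ) (continuous_galerkinGrad hA.continuous_grad φ)
    (by fun_prop) (nonposProj φ) (fun x => by ext i; simp only [nonposProj_apply]; split_ifs <;> rfl)
    (e := Pi.single i₁ v₁) (by
      ext i
      rw [nonposProj_apply]
      by_cases h : i = i₁
      · subst h; simp [hi₁]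
      · simp [h])
    (fun w s hs => by
      have h1 := sum_update_eq hi₁ w s hv₁ (fun i => if 0 < φ i then (φ i : ℝ) else 0)
      have h2 : ∑ i, (if 0 < φ i then (φ i : ℝ) else 0) * (if φ i ≤ 0 then ‖w i‖ ^ 2 else 0) = 0 := by
        refine Finset.sum_eq_zero fun i _ => ?_
        by_cases h : 0 < φ i
        · simp [not_le.2 h]
        · simp [h]
      rw [h2] at h1
      simp only [ite_mul, zero_mul, hi₁] at h1
      rw [Finset.sum_filter, h1]
      simp [Real.sqrt_sq hs])
    (τ := 1 / (2 * (π * N + L))) (by positivity)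
    (fun x => Finset.sum_nonneg fun _ _ => by positivity)
    (fun x t ht0 ht => by
      refine galerkinAction_step hA.continuous_ham hA.continuous_grad hL hφ hN x ht0 ?_
      calc t * (π * N + L) ≤ 1 / (2 * (π * N + L)) * (π * N + L) := by gcongr
        _ = 1 / 2 := by have : 0 < π * N + L := by positivity
                        field_simp)
    (R := √(|C| / min b₂ (b₁ + b₂ - π)))
    (fun w s hs hR => by
      set x := nonposProj φ w + s • (Pi.single i₁ v₁ : κ → V) with hx
      have h1 := le_integral_ham hA.continuous_ham hb₁ hgr hφ x i₁
      have h2 : ‖(inner ℂ v₁ (x i₁) : ℂ)‖ ^ 2 = s ^ 2 := by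
        have : x i₁ = s • v₁ := by
          rw [hx, Pi.add_apply, nonposProj_apply]; simp [hi₁]
        rw [this, ← Complex.coe_smul, inner_smul_right, inner_self_eq_norm_sq_to_K, hv₁]
        simp
      have h3 := hsplit w s
      rw [← hx] at h3
      have h4 : |C| / min b₂ (b₁ + b₂ - π) ≤ ∑ i, ‖x i‖ ^ 2 := by
        refine le_trans ?_ (norm_sq_le_sum_norm_sq x)
        have h0 : 0 ≤ |C| / min b₂ (b₁ + b₂ - π) := by positivity
        calc |C| / min b₂ (b₁ + b₂ - π) = √(|C| / min b₂ (b₁ + b₂ - π)) ^ 2 := (Real.sq_sqrt h0).symm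
          _ ≤ _ := by gcongr
      rw [div_le_iff₀ hbc] at h4
      have h5 : s ^ 2 ≤ ∑ i, ‖x i‖ ^ 2 := by
        have := Finset.single_le_sum (f := fun i => ‖x i‖ ^ 2) (fun _ _ => by positivity)
          (Finset.mem_univ i₁)
        have h6 : x i₁ = s • v₁ := by
          rw [hx, Pi.add_apply, nonposProj_apply]; simp [hi₁]
        simp only [h6, norm_smul, hv₁, mul_one, Real.norm_eq_abs, sq_abs] at this
        exact this
      have h6 : (π - b₁) * s ^ 2 ≤ (b₂ - min b₂ (b₁ + b₂ - π)) * ∑ i, ‖x i‖ ^ 2 := by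
        have m1 : min b₂ (b₁ + b₂ - π) ≤ b₂ := min_le_left _ _
        have m2 : min b₂ (b₁ + b₂ - π) ≤ b₁ + b₂ - π := min_le_right _ _
        nlinarith [sq_nonneg s]
      unfold galerkinAction
      rw [h2] at h1
      have h7 := mul_le_mul_of_nonneg_left h3 Real.pi_pos.le
      have h8 := le_abs_self C
      linarith)
    (fun w => by
      have h3 := hsplit w 0
      simp only [zero_smul, add_zero] at h3
      have h7 := mul_le_mul_of_nonneg_left h3 Real.pi_pos.le
      have h8 : 0 ≤ ∫ t in (0:ℝ)..1, H (trigPoly φ (nonposProj φ w) t) :=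
        intervalIntegral.integral_nonneg zero_le_one fun t _ => hA.nonneg _
      unfold galerkinAction
      linarith)
    hα hβ (fun x hx hρ => hlevel hφ x hx hρ) hε
  exact ⟨y, hy1, hy2⟩

end

section

/-- A continuous function on `[0, 1]` with matching endpoints whose nonconstant Fourier
coefficients vanish is constant. -/
lemma eq_of_fcoef_eq_zero_complex {w : ℝ → ℂ} (hw : Continuous w) (h01 : w 0 = w 1)
    (h : ∀ k : ℤ, k ≠ 0 → fcoef w k = 0) {t : ℝ} (ht : t ∈ Set.Ico (0:ℝ) 1) :
    w t = fcoef w 0 := by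
  have : Fact ((0:ℝ) < 1) := ⟨one_pos⟩
  have hc : Continuous (AddCircle.liftIco 1 0 w) :=
    AddCircle.liftIco_continuous (by simpa using h01) hw.continuousOn
  set f : C(AddCircle (1:ℝ), ℂ) := ⟨_, hc⟩ with hf
  have hco : ∀ k : ℤ, fourierCoeff f k = fcoef w k := by
    intro k
    change fourierCoeff (AddCircle.liftIco 1 0 w) k = _
    rw [fourierCoeff_liftIco_eq, fourierCoeffOn_eq_integral, fcoef]
    simp only [zero_add, sub_zero, ne_eq, one_ne_zero, not_false_eq_true, div_self, one_smul]
    refine intervalIntegral.integral_congr fun x _ => ?_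
    simp only [fourier_coe_apply]
    congr 1
    simp [ek]
  have hz : ∀ k : ℤ, k ≠ 0 → fourierCoeff f k = 0 := fun k hk => (hco k).trans (h k hk)
  have hs : Summable (fourierCoeff f) :=
    summable_of_ne_finset_zero (s := {0}) fun k hk => hz k (by simpa using hk)
  have h1 := has_pointwise_sum_fourier_series_of_summable hs (t : AddCircle (1:ℝ))
  have h2 := hasSum_single (f := fun i => fourierCoeff f i • fourier i (t : AddCircle (1:ℝ))) 0
    (fun k hk => by simp [hz k hk])
  have h3 := h1.unique h2
  have h4 : f (t : AddCircle (1:ℝ)) = w t := by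
    change AddCircle.liftIco 1 0 w t = w t
    exact AddCircle.liftIco_coe_apply (by simpa using ht)
  rw [← h4, h3, ← hco]
  simp

end

section
attribute [local instance] InnerProductSpace.complexToReal
variable {V : Type*} [NormedAddCommGroup V] [InnerProductSpace ℂ V] [CompleteSpace V]

lemma eq_of_fcoef_eq_zero {w : ℝ → V} (hw : Continuous w) (h01 : w 0 = w 1)
    (h : ∀ k : ℤ, k ≠ 0 → fcoef w k = 0) {t : ℝ} (ht : t ∈ Set.Ico (0:ℝ) 1) :
    w t = w 0 := by
  refine ext_inner_left ℂ fun v => ?_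
  have hco : ∀ k, fcoef (fun t => (inner ℂ v (w t) : ℂ)) k = inner ℂ v (fcoef w k) := by
    intro k
    unfold fcoef
    have := ContinuousLinearMap.intervalIntegral_comp_comm (innerSL ℂ v)
      (μ := MeasureTheory.volume) (a := 0) (b := 1) (f := fun t => ek (-k) t • w t)
      ((by fun_prop : Continuous _).intervalIntegrable _ _)
    simpa [inner_smul_right] using this
  have hc : Continuous (fun t => (inner ℂ v (w t) : ℂ)) := by fun_prop
  have hk : ∀ k : ℤ, k ≠ 0 → fcoef (fun t => (inner ℂ v (w t) : ℂ)) k = 0 := fun k hk => by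
    rw [hco, h k hk, inner_zero_right]
  rw [eq_of_fcoef_eq_zero_complex hc (by simp [h01]) hk ht,
    ← eq_of_fcoef_eq_zero_complex hc (by simp [h01]) hk (t := 0) (by simp)]

/-- A continuous periodic function whose Fourier coefficients satisfy `2πk ĉₖ(y) = ĉₖ(g)` solves
`y' = i g`. -/
lemma hasDerivAt_of_fcoef {y g : ℝ → V} (hy : Continuous y) (hg : Continuous g)
    (hyp : ∀ t, y (t + 1) = y t) (hgp : ∀ t, g (t + 1) = g t)
    (h : ∀ k : ℤ, (2 * π * k : ℝ) • fcoef y k = fcoef g k) (t : ℝ) :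
    HasDerivAt y (Complex.I • g t) t := by
  set u : ℝ → V := fun t => ∫ s in (0:ℝ)..t, Complex.I • g s with hu
  have hIg : Continuous (fun s => Complex.I • g s) := by fun_prop
  have hud : ∀ t, HasDerivAt u (Complex.I • g t) t := fun t =>
    intervalIntegral.integral_hasDerivAt_right (hIg.intervalIntegrable _ _)
      (hIg.stronglyMeasurableAtFilter _ _) hIg.continuousAt
  have huc : Continuous u := continuous_iff_continuousAt.2 fun t => (hud t).continuousAt
  have hu0 : u 0 = 0 := by simp [hu]
  have hInt : ∫ s in (0:ℝ)..1, Complex.I • g s = 0 := by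
    have := h 0
    simp only [Int.cast_zero, mul_zero, zero_smul, fcoef, neg_zero, ek_zero, one_smul] at this
    rw [intervalIntegral.integral_smul, ← this, smul_zero]
  have hu1 : u 1 = 0 := hInt
  have hcu : ∀ k : ℤ, k ≠ 0 → fcoef u k = fcoef y k := by
    intro k hk
    have hd : ∀ t, HasDerivAt (fun t => ek (-k) t • u t)
        (ek (-k) t • (Complex.I • g t) + (2 * π * Complex.I * (-k : ℤ) * ek (-k) t) • u t) t :=
      fun t => (hasDerivAt_ek (-k) t).smul (hud t)
    have h1 := intervalIntegral.integral_eq_sub_of_hasDerivAt (a := 0) (b := 1)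
      (fun t _ => hd t) ((by fun_prop : Continuous _).intervalIntegrable _ _)
    simp only [hu0, hu1, smul_zero, sub_zero] at h1
    rw [intervalIntegral.integral_add ((by fun_prop : Continuous _).intervalIntegrable _ _)
      ((by fun_prop : Continuous _).intervalIntegrable _ _)] at h1
    have e1 : ∀ t, ek (-k) t • (Complex.I • g t) = Complex.I • (ek (-k) t • g t) :=
      fun t => smul_comm _ _ _
    simp_rw [e1, mul_smul _ (ek (-k) _)] at h1
    rw [intervalIntegral.integral_smul, intervalIntegral.integral_smul] at h1
    change Complex.I • fcoef g k + (2 * π * Complex.I * (-k : ℤ)) • fcoef u k = 0 at h1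
    rw [← h k, ← Complex.coe_smul, smul_smul] at h1
    have hne : (2 * π * Complex.I * k : ℂ) ≠ 0 := by
      have : (k : ℂ) ≠ 0 := by exact_mod_cast hk
      have : (π : ℂ) ≠ 0 := by exact_mod_cast Real.pi_ne_zero
      simp [*]
    have h2 : (2 * π * Complex.I * k : ℂ) • (fcoef y k - fcoef u k) = 0 := by
      rw [smul_sub, ← h1]
      push_cast
      module
    rcases smul_eq_zero.1 h2 with h3 | h3
    · exact absurd h3 hne
    · exact (sub_eq_zero.1 h3).symm
  set w : ℝ → V := fun t => y t - u t with hw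
  have hwp : Function.Periodic w 1 := by
    intro t
    have e : u (t + 1) = u t := by
      have hp : Function.Periodic (fun s => Complex.I • g s) 1 := fun s => by simp [hgp]
      have h1 := intervalIntegral.integral_add_adjacent_intervals (a := 0) (b := t) (c := t + 1)
        (f := fun s => Complex.I • g s) (μ := MeasureTheory.volume)
        (hIg.intervalIntegrable _ _) (hIg.intervalIntegrable _ _)
      have h2 := hp.intervalIntegral_add_eq t 0
      rw [zero_add, hInt] at h2
      rw [h2, add_zero] at h1
      exact h1.symm
    simp only [hw, hyp, e]
  have hconst : ∀ t, w t = w 0 := by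
    intro t
    have h1 : w (Int.fract t) = w t := by
      have := hwp.sub_zsmul_eq (x := t) ⌊t⌋
      rwa [zsmul_eq_mul, mul_one] at this
    rw [← h1]
    refine eq_of_fcoef_eq_zero (hy.sub huc) ?_ ?_ ⟨Int.fract_nonneg t, Int.fract_lt_one t⟩
    · have := hwp 0; rw [zero_add] at this; exact this.symm
    · intro k hk
      have : fcoef w k = fcoef y k - fcoef u k := by
        unfold fcoef
        rw [← intervalIntegral.integral_sub ((by fun_prop : Continuous _).intervalIntegrable _ _)
          ((by fun_prop : Continuous _).intervalIntegrable _ _)]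
        simp only [hw, smul_sub]
      exact this.trans (by rw [hcu k hk, sub_self])
  have hyu : y = fun t => u t + w 0 := by
    funext t
    rw [← hconst t]; simp [hw]
  rw [hyu]
  exact (hud t).add_const _

end

section
variable {V : Type*} [NormedAddCommGroup V]

/-- Arzelà–Ascoli for bounded, uniformly Hölder sequences of periodic functions. -/
lemma exists_subseq_tendsto_of_periodic [ProperSpace V] {y : ℕ → ℝ → V} {R B : ℝ}
    (hc : ∀ n, Continuous (y n)) (hp : ∀ n t, y n (t + 1) = y n t) (hR : ∀ n t, ‖y n t‖ ≤ R)
    (hB : ∀ n s t, 0 ≤ s → s ≤ t → t ≤ 1 → ‖y n t - y n s‖ ≤ B * √(t - s)) :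
    ∃ (ψ : ℕ → ℕ) (z : ℝ → V), StrictMono ψ ∧ Continuous z ∧ (∀ t, z (t + 1) = z t) ∧
      ∀ t, Filter.Tendsto (fun n => y (ψ n) t) Filter.atTop (nhds (z t)) := by
  let F : ℕ → BoundedContinuousFunction (Set.Icc (0:ℝ) 1) V := fun n =>
    BoundedContinuousFunction.mkOfCompact ⟨fun t => y n t, (hc n).comp continuous_subtype_val⟩
  have hFy : ∀ n t, F n t = y n t := fun n t => rfl
  have hcomp : IsCompact (closure (Set.range F)) := by
    refine BoundedContinuousFunction.arzela_ascoli (Metric.closedBall (0:V) R)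
      (isCompact_closedBall _ _) _ ?_ ?_
    · rintro f x ⟨n, rfl⟩
      simpa [hFy] using hR n x
    · refine Metric.equicontinuous_of_continuity_modulus (fun r => B * √r) ?_ _ ?_
      · have : Continuous fun r : ℝ => B * √r := by fun_prop
        simpa using this.tendsto 0
      · rintro ⟨s, hs⟩ ⟨t, ht⟩ ⟨_, n, rfl⟩
        simp only [hFy, Subtype.dist_eq]
        rcases le_total s t with h | h
        · rw [dist_comm, dist_eq_norm, dist_comm s t, Real.dist_eq, abs_of_nonneg (by linarith)]
          exact hB n s t hs.1 h ht.2
        · rw [dist_eq_norm, Real.dist_eq, abs_of_nonneg (by linarith)]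
          exact hB n t s ht.1 h hs.2
  obtain ⟨f, -, ψ, hψ, hlim⟩ := hcomp.tendsto_subseq (x := F)
    (fun n => subset_closure (Set.mem_range_self n))
  have hmem : ∀ t : ℝ, Int.fract t ∈ Set.Icc (0:ℝ) 1 := fun t =>
    ⟨Int.fract_nonneg t, (Int.fract_lt_one t).le⟩
  have hfr : ∀ n t, y n t = F n ⟨Int.fract t, hmem t⟩ := by
    intro n t
    rw [hFy]
    have := Function.Periodic.sub_zsmul_eq (f := y n) (c := 1) (x := t) (hp n) ⌊t⌋
    rw [zsmul_eq_mul, mul_one] at this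
    exact this.symm
  have hunif : TendstoUniformly (fun n => y (ψ n))
      (fun t => f ⟨Int.fract t, hmem t⟩) Filter.atTop := by
    rw [Metric.tendstoUniformly_iff]
    intro ε hε
    have := (Metric.tendsto_nhds.1 hlim) ε hε
    filter_upwards [this] with n hn t
    rw [hfr, dist_comm]
    exact (BoundedContinuousFunction.dist_coe_le_dist _).trans_lt hn
  refine ⟨ψ, fun t => f ⟨Int.fract t, hmem t⟩, hψ,
    hunif.continuous (Filter.Frequently.of_forall fun n => hc _), fun t => ?_,
    fun t => hunif.tendsto_at t⟩
  simp

/-- Passage to the limit under the integral sign. -/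
lemma tendsto_integral_comp [ProperSpace V] {W : Type*} [NormedAddCommGroup W] [NormedSpace ℝ W]
    {y : ℕ → ℝ → V} {z : ℝ → V} {R : ℝ} (hc : ∀ n, Continuous (y n)) (hR : ∀ n t, ‖y n t‖ ≤ R)
    (hlim : ∀ t, Filter.Tendsto (fun n => y n t) Filter.atTop (nhds (z t)))
    {F : ℝ × V → W} (hF : Continuous F) :
    Filter.Tendsto (fun n => ∫ t in (0:ℝ)..1, F (t, y n t)) Filter.atTop
      (nhds (∫ t in (0:ℝ)..1, F (t, z t))) := by
  obtain ⟨C, hC⟩ := ((isCompact_Icc (a := (0:ℝ)) (b := 1)).prod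
    (isCompact_closedBall (0:V) R)).exists_bound_of_continuousOn hF.continuousOn
  refine intervalIntegral.tendsto_integral_filter_of_dominated_convergence (fun _ => C)
    (Filter.Eventually.of_forall fun n => ?_) (Filter.Eventually.of_forall fun n => ?_)
    intervalIntegrable_const ?_
  · exact (hF.comp (continuous_id.prodMk (hc n))).aestronglyMeasurable
  · refine Filter.Eventually.of_forall fun t ht => hC _ ⟨?_, by simpa using hR n t⟩
    rw [Set.uIoc_of_le zero_le_one] at ht
    exact ⟨ht.1.le, ht.2⟩
  · refine Filter.Eventually.of_forall fun t _ => ?_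
    exact (hF.tendsto _).comp (tendsto_const_nhds.prodMk_nhds (hlim t))

end

section
attribute [local instance] InnerProductSpace.complexToReal
variable {V : Type*} [NormedAddCommGroup V] [InnerProductSpace ℂ V] [CompleteSpace V]
variable {ι : Type*} [Fintype ι]

lemma fcoef_clm_trigPoly (A : V →L[ℂ] V) {φ : ι → ℤ} (hφ : Function.Injective φ) (x : ι → V)
    (i : ι) : fcoef (fun t => A (trigPoly φ x t)) (φ i) = A (x i) := by
  have : (fun t => A (trigPoly φ x t)) = trigPoly φ (fun i => A (x i)) := by
    funext t; simp [trigPoly]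
  rw [this, fcoef_trigPoly hφ]

lemma sum_weighted_norm_sq_le {G K : V → V} {A : V →L[ℂ] V} {B c ε : ℝ}
    (hG : ∀ z, G z = A z + K z) (hK : Continuous K) (hB : ∀ z, ‖K z‖ ≤ B) (hc : 0 < c)
    (hres : ∀ (k : ℤ) (v : V), c * (1 + |(k:ℝ)|) * ‖v‖ ≤ ‖(2 * π * k : ℝ) • v - A v‖)
    {φ : ι → ℤ} (hφ : Function.Injective φ) (x : ι → V)
    (hx : ∑ i, ‖galerkinGrad G φ x i‖ ^ 2 ≤ ε) :
    ∑ i, (1 + |(φ i : ℝ)|) ^ 2 * ‖x i‖ ^ 2 ≤ 2 * (B ^ 2 + ε) / c ^ 2 := by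
  have h1 : ∀ i, c ^ 2 * ((1 + |(φ i : ℝ)|) ^ 2 * ‖x i‖ ^ 2) ≤
      2 * (‖fcoef (fun t => K (trigPoly φ x t)) (φ i)‖ ^ 2 + ‖galerkinGrad G φ x i‖ ^ 2) := by
    intro i
    have e : (2 * π * φ i : ℝ) • x i - A (x i) =
        fcoef (fun t => K (trigPoly φ x t)) (φ i) + galerkinGrad G φ x i := by
      have : fcoef (fun t => G (trigPoly φ x t)) (φ i) = A (x i) +
          fcoef (fun t => K (trigPoly φ x t)) (φ i) := by
        rw [← fcoef_clm_trigPoly A hφ x i]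
        unfold fcoef
        rw [← intervalIntegral.integral_add ((by fun_prop : Continuous _).intervalIntegrable _ _)
          ((by fun_prop : Continuous _).intervalIntegrable _ _)]
        simp only [hG, smul_add]
      rw [galerkinGrad, this]; abel
    have h2 := (hres (φ i) (x i)).trans (e ▸ norm_add_le _ _)
    have h3 : (c * (1 + |(φ i : ℝ)|) * ‖x i‖) ^ 2 ≤ _ := pow_le_pow_left₀ (by positivity) h2 2
    nlinarith [sq_nonneg (‖fcoef (fun t => K (trigPoly φ x t)) (φ i)‖ - ‖galerkinGrad G φ x i‖)]
  have h2 := Finset.sum_le_sum (fun i (_ : i ∈ Finset.univ) => h1 i)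
  rw [← Finset.mul_sum, ← Finset.mul_sum, Finset.sum_add_distrib] at h2
  have h3 := sum_norm_sq_fcoef_le hφ (F := fun t => K (trigPoly φ x t)) (by fun_prop)
  have h4 : ∫ t in (0:ℝ)..1, ‖K (trigPoly φ x t)‖ ^ 2 ≤ B ^ 2 := by
    calc ∫ t in (0:ℝ)..1, ‖K (trigPoly φ x t)‖ ^ 2 ≤ ∫ t in (0:ℝ)..1, B ^ 2 := by
          refine intervalIntegral.integral_mono_on zero_le_one
            ((by fun_prop : Continuous _).intervalIntegrable _ _) intervalIntegrable_const
            fun t _ => ?_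
          exact pow_le_pow_left₀ (norm_nonneg _) (hB _) 2
      _ = B ^ 2 := by simp
  rw [le_div_iff₀ (by positivity)]
  linarith

lemma norm_trigPoly_sub_le {φ : ι → ℤ} (hφ : Function.Injective φ) (x : ι → V) {D : ℝ}
    (hD : ∑ i, (1 + |(φ i : ℝ)|) ^ 2 * ‖x i‖ ^ 2 ≤ D) {s t : ℝ} (hs : 0 ≤ s) (hst : s ≤ t)
    (ht : t ≤ 1) :
    ‖trigPoly φ x t - trigPoly φ x s‖ ≤ (4 * π ^ 2 * D + 1 / 4) * √(t - s) := by
  rcases hst.eq_or_lt with rfl | hst'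
  · simp
  set d : ι → V := fun i => (2 * π * Complex.I * φ i : ℂ) • x i with hd
  have h1 : ∫ r in s..t, trigPoly φ d r = trigPoly φ x t - trigPoly φ x s :=
    intervalIntegral.integral_eq_sub_of_hasDerivAt (fun r _ => hasDerivAt_trigPoly φ x r)
      ((continuous_trigPoly φ d).intervalIntegrable _ _)
  have h2 : ∫ r in (0:ℝ)..1, ‖trigPoly φ d r‖ ^ 2 ≤ 4 * π ^ 2 * D := by
    rw [integral_norm_sq_trigPoly hφ]
    refine le_trans ?_ (mul_le_mul_of_nonneg_left hD (by positivity))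
    rw [Finset.mul_sum]
    refine Finset.sum_le_sum fun i _ => ?_
    have e : ‖d i‖ = 2 * π * |(φ i : ℝ)| * ‖x i‖ := by
      simp [hd, norm_smul, abs_of_pos Real.pi_pos]
    rw [e]
    have : (2 * π * |(φ i : ℝ)| * ‖x i‖) ^ 2 = 4 * π ^ 2 * (|(φ i : ℝ)| ^ 2 * ‖x i‖ ^ 2) := by ring
    rw [this]
    gcongr
    linarith
  set l := √(t - s) with hl
  have hl0 : 0 < l := Real.sqrt_pos.2 (by linarith)
  have hl2 : l ^ 2 = t - s := Real.sq_sqrt (by linarith)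
  have hc2 : Continuous (fun r => ‖trigPoly φ d r‖ ^ 2) := by fun_prop
  have h3 : ∫ r in s..t, ‖trigPoly φ d r‖ ^ 2 ≤ ∫ r in (0:ℝ)..1, ‖trigPoly φ d r‖ ^ 2 := by
    refine intervalIntegral.integral_mono_interval hs hst ht
      (Filter.Eventually.of_forall fun r => by positivity) (hc2.intervalIntegrable _ _)
  calc ‖trigPoly φ x t - trigPoly φ x s‖ = ‖∫ r in s..t, trigPoly φ d r‖ := by rw [h1]
    _ ≤ ∫ r in s..t, ‖trigPoly φ d r‖ := intervalIntegral.norm_integral_le_integral_norm hst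
    _ ≤ ∫ r in s..t, (l * ‖trigPoly φ d r‖ ^ 2 + 1 / (4 * l)) := by
        refine intervalIntegral.integral_mono_on hst
          ((by fun_prop : Continuous _).intervalIntegrable _ _)
          ((by fun_prop : Continuous _).intervalIntegrable _ _) fun r _ => ?_
        have : l * ‖trigPoly φ d r‖ ^ 2 + 1 / (4 * l) - ‖trigPoly φ d r‖ =
          (l * ‖trigPoly φ d r‖ - 1 / 2) ^ 2 / l := by field_simp; ring
        have h0 : 0 ≤ (l * ‖trigPoly φ d r‖ - 1 / 2) ^ 2 / l := by positivity
        linarith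
    _ = l * (∫ r in s..t, ‖trigPoly φ d r‖ ^ 2) + (t - s) * (1 / (4 * l)) := by
        rw [intervalIntegral.integral_add ((by fun_prop : Continuous _).intervalIntegrable _ _)
          intervalIntegrable_const, intervalIntegral.integral_const_mul]
        simp only [intervalIntegral.integral_const, smul_eq_mul]
    _ ≤ l * (4 * π ^ 2 * D) + (t - s) * (1 / (4 * l)) := by
        have := h3.trans h2
        gcongr
    _ = _ := by rw [← hl2]; field_simp

end

section
attribute [local instance] InnerProductSpace.complexToReal
variable {V : Type*} [NormedAddCommGroup V] [InnerProductSpace ℂ V] [CompleteSpace V]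
variable {ι : Type*} [Fintype ι]

lemma norm_trigPoly_le {φ : ι → ℤ} (hφ : Function.Injective φ) (x : ι → V) {D : ℝ}
    (hD : ∑ i, (1 + |(φ i : ℝ)|) ^ 2 * ‖x i‖ ^ 2 ≤ D) (t : ℝ) :
    ‖trigPoly φ x t‖ ≤ (4 * π ^ 2 * D + 1 / 4) + D + 1 := by
  have hD0 : 0 ≤ D := le_trans (Finset.sum_nonneg fun _ _ => by positivity) hD
  have hD1 : ∑ i, ‖x i‖ ^ 2 ≤ D := by
    refine le_trans (Finset.sum_le_sum fun i _ => ?_) hD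
    have : (1:ℝ) ≤ (1 + |(φ i : ℝ)|) ^ 2 := one_le_pow₀ (by linarith [abs_nonneg (φ i : ℝ)])
    nlinarith [sq_nonneg ‖x i‖]
  wlog ht : t ∈ Set.Icc (0:ℝ) 1 generalizing t with hwlog
  · have := Function.Periodic.sub_zsmul_eq (f := trigPoly φ x) (c := 1) (x := t)
      (trigPoly_add_one φ x) ⌊t⌋
    rw [zsmul_eq_mul, mul_one] at this
    rw [← this]
    exact hwlog (t - ⌊t⌋) ⟨Int.fract_nonneg t, (Int.fract_lt_one t).le⟩
  have key : ∀ s ∈ Set.Icc (0:ℝ) 1, ‖trigPoly φ x t‖ ≤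
      (4 * π ^ 2 * D + 1 / 4) + 1 + ‖trigPoly φ x s‖ ^ 2 := by
    intro s hs
    have h1 : ‖trigPoly φ x t - trigPoly φ x s‖ ≤ 4 * π ^ 2 * D + 1 / 4 := by
      have hE : 0 ≤ 4 * π ^ 2 * D + 1 / 4 := by positivity
      rcases le_total s t with h | h
      · refine (norm_trigPoly_sub_le hφ x hD hs.1 h ht.2).trans (mul_le_of_le_one_right hE ?_)
        rw [Real.sqrt_le_one]; linarith [hs.1, ht.2]
      · rw [norm_sub_rev]
        refine (norm_trigPoly_sub_le hφ x hD ht.1 h hs.2).trans (mul_le_of_le_one_right hE ?_)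
        rw [Real.sqrt_le_one]; linarith [ht.1, hs.2]
    have h2 := norm_le_norm_sub_add (trigPoly φ x t) (trigPoly φ x s)
    nlinarith [sq_nonneg (‖trigPoly φ x s‖ - 1), norm_nonneg (trigPoly φ x s)]
  have h1 := intervalIntegral.integral_mono_on (μ := MeasureTheory.volume) zero_le_one
    (intervalIntegrable_const (c := ‖trigPoly φ x t‖)) ((by fun_prop : Continuous fun s =>
      (4 * π ^ 2 * D + 1 / 4) + 1 + ‖trigPoly φ x s‖ ^ 2).intervalIntegrable 0 1) key
  rw [intervalIntegral.integral_add intervalIntegrable_const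
    ((by fun_prop : Continuous _).intervalIntegrable _ _), integral_norm_sq_trigPoly hφ] at h1
  simp only [intervalIntegral.integral_const, sub_zero, one_smul] at h1
  linarith

lemma galerkinAction_eq {H : V → ℝ} {G : V → V} (hG : Continuous G) {φ : ι → ℤ} (x : ι → V) :
    galerkinAction H φ x = 1 / 2 * (∫ t in (0:ℝ)..1, inner ℝ (G (trigPoly φ x t)) (trigPoly φ x t))
      + 1 / 2 * ∑ i, inner ℝ (galerkinGrad G φ x i) (x i)
      - ∫ t in (0:ℝ)..1, H (trigPoly φ x t) := by
  rw [integral_inner_trigPoly (F := fun t => G (trigPoly φ x t)) (by fun_prop)]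
  unfold galerkinAction galerkinGrad
  congr 1
  rw [← mul_add, ← Finset.sum_add_distrib, Finset.mul_sum, Finset.mul_sum]
  refine Finset.sum_congr rfl fun i _ => ?_
  rw [inner_sub_left, real_inner_smul_left, real_inner_self_eq_norm_sq]
  ring

lemma sum_inner_galerkinGrad_le {G : V → V} {φ : ι → ℤ} (x : ι → V) {D N : ℝ} (hN : 0 < N)
    (hD : ∑ i, (1 + |(φ i : ℝ)|) ^ 2 * ‖x i‖ ^ 2 ≤ D)
    (hr : ∑ i, ‖galerkinGrad G φ x i‖ ^ 2 ≤ 1 / N ^ 2) :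
    ∑ i, inner ℝ (galerkinGrad G φ x i) (x i) ≤ (1 + D) / N := by
  have h1 : ∀ i, inner ℝ (galerkinGrad G φ x i) (x i) ≤
      N * ‖galerkinGrad G φ x i‖ ^ 2 + 1 / N * ((1 + |(φ i : ℝ)|) ^ 2 * ‖x i‖ ^ 2) := by
    intro i
    refine (real_inner_le_norm _ _).trans ?_
    set a := ‖galerkinGrad G φ x i‖
    have h2 : ‖x i‖ ^ 2 ≤ (1 + |(φ i : ℝ)|) ^ 2 * ‖x i‖ ^ 2 := by
      have : (1:ℝ) ≤ (1 + |(φ i : ℝ)|) ^ 2 := one_le_pow₀ (by linarith [abs_nonneg (φ i : ℝ)])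
      nlinarith [sq_nonneg ‖x i‖]
    have h3 : a * ‖x i‖ ≤ N * a ^ 2 + 1 / N * ‖x i‖ ^ 2 := by
      have h4 : 1 / N * ‖x i‖ ^ 2 = N * (‖x i‖ / N) ^ 2 := by field_simp
      have h5 : a * ‖x i‖ = N * (a * (‖x i‖ / N)) := by field_simp
      rw [h4, h5, ← mul_add]
      gcongr
      nlinarith [sq_nonneg (a - ‖x i‖ / N), sq_nonneg a, sq_nonneg (‖x i‖ / N)]
    refine h3.trans ?_
    gcongr
  refine (Finset.sum_le_sum fun i _ => h1 i).trans ?_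
  rw [Finset.sum_add_distrib, ← Finset.mul_sum, ← Finset.mul_sum]
  calc _ ≤ N * (1 / N ^ 2) + 1 / N * D := by gcongr
    _ = _ := by field_simp

end

section
attribute [local instance] InnerProductSpace.complexToReal
variable {V : Type*} [NormedAddCommGroup V] [InnerProductSpace ℂ V] [FiniteDimensional ℂ V]

/-- Existence of a `1`-periodic orbit of positive action. -/
theorem exists_periodic_orbit_of_admissible {H : V → ℝ} {G K : V → V} {v₁ : V} {A : V →L[ℂ] V}
    {B c : ℝ} (hv₁ : ‖v₁‖ = 1) (hA : AdmissibleHam H G v₁)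
    (hG : ∀ z, G z = A z + K z) (hB : ∀ z, ‖K z‖ ≤ B) (hc : 0 < c)
    (hres : ∀ (k : ℤ) (v : V), c * (1 + |(k:ℝ)|) * ‖v‖ ≤ ‖(2 * π * k : ℝ) • v - A v‖) :
    ∃ y : ℝ → V, (∀ t, y (t + 1) = y t) ∧ (∀ t, HasDerivAt y (Complex.I • G (y t)) t) ∧
      0 < 1 / 2 * (∫ t in (0:ℝ)..1, inner ℝ (G (y t)) (y t)) - ∫ t in (0:ℝ)..1, H (y t) := by
  have : CompleteSpace V := FiniteDimensional.complete ℂ V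
  have : ProperSpace V := FiniteDimensional.proper ℂ V
  have hGc := hA.continuous_grad
  have hHc := hA.continuous_ham
  have hK : Continuous K := by
    have : K = fun z => G z - A z := by funext z; simp [hG]
    rw [this]; fun_prop
  obtain ⟨β, hβ, hcrit⟩ := exists_galerkin_almost_critical hv₁ hA
  let φ : (n : ℕ) → ↥(Finset.Icc (-(n + 1 : ℤ)) (n + 1)) → ℤ := fun n i => i.1
  have hφ : ∀ n, Function.Injective (φ n) := fun n => Subtype.val_injective
  have hex : ∀ n : ℕ, ∃ x : ↥(Finset.Icc (-(n + 1 : ℤ)) (n + 1)) → V,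
      β ≤ galerkinAction H (φ n) x ∧ ∑ i, ‖galerkinGrad G (φ n) x i‖ ^ 2 ≤ 1 / ((n:ℝ) + 1) ^ 2 :=
    fun n => hcrit (hφ n) ⟨⟨1, Finset.mem_Icc.2 (by constructor <;> omega)⟩, rfl⟩ _ (by positivity)
  choose x hx1 hx2 using hex
  set D := 2 * (B ^ 2 + 1) / c ^ 2 with hDdef
  have hD : ∀ n, ∑ i, (1 + |(φ n i : ℝ)|) ^ 2 * ‖x n i‖ ^ 2 ≤ D := fun n => by
    refine sum_weighted_norm_sq_le hG hK hB hc hres (hφ n) (x n) ((hx2 n).trans ?_)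
    rw [div_le_one (by positivity)]
    exact one_le_pow₀ (by linarith [(Nat.cast_nonneg n : (0:ℝ) ≤ n)])
  set y : ℕ → ℝ → V := fun n => trigPoly (φ n) (x n) with hy
  have hyc : ∀ n, Continuous (y n) := fun n => continuous_trigPoly _ _
  have hyR := fun n => norm_trigPoly_le (hφ n) (x n) (hD n)
  obtain ⟨ψ, z, hψ, hzc, hzp, hlim⟩ := exists_subseq_tendsto_of_periodic hyc
    (fun n t => trigPoly_add_one _ _ t) hyR
    (fun n s t hs hst ht => norm_trigPoly_sub_le (hφ n) (x n) (hD n) hs hst ht)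
  have hlimI : ∀ {W : Type _} [NormedAddCommGroup W] [NormedSpace ℝ W] {F : ℝ × V → W},
      Continuous F → Filter.Tendsto (fun n => ∫ t in (0:ℝ)..1, F (t, y (ψ n) t)) Filter.atTop
        (nhds (∫ t in (0:ℝ)..1, F (t, z t))) := fun hF =>
    tendsto_integral_comp (fun n => hyc (ψ n)) (fun n => hyR (ψ n)) hlim hF
  have hlimR : ∀ {F : ℝ × V → ℝ},
      Continuous F → Filter.Tendsto (fun n => ∫ t in (0:ℝ)..1, F (t, y (ψ n) t)) Filter.atTop
        (nhds (∫ t in (0:ℝ)..1, F (t, z t))) := fun hF =>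
    tendsto_integral_comp (fun n => hyc (ψ n)) (fun n => hyR (ψ n)) hlim hF
  have hψn : ∀ n, n ≤ ψ n := hψ.id_le
  have hto : Filter.Tendsto (fun n => (1:ℝ) / ((ψ n : ℝ) + 1)) Filter.atTop (nhds 0) :=
    (tendsto_one_div_add_atTop_nhds_zero_nat (𝕜 := ℝ)).comp hψ.tendsto_atTop
  refine ⟨z, hzp, ?_, ?_⟩
  · refine hasDerivAt_of_fcoef hzc (hGc.comp hzc) hzp (fun t => by simp [hzp]) fun k => ?_
    have l1 : Filter.Tendsto (fun n => (2 * π * k : ℝ) • fcoef (y (ψ n)) k -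
        fcoef (fun t => G (y (ψ n) t)) k) Filter.atTop (nhds ((2 * π * k : ℝ) • fcoef z k -
        fcoef (fun t => G (z t)) k)) := by
      refine (Filter.Tendsto.const_smul ?_ _).sub ?_
      · exact hlimI (F := fun p => ek (-k) p.1 • p.2) (by fun_prop)
      · exact hlimI (F := fun p => ek (-k) p.1 • G p.2) (by fun_prop)
    have l2 : Filter.Tendsto (fun n => (2 * π * k : ℝ) • fcoef (y (ψ n)) k -
        fcoef (fun t => G (y (ψ n) t)) k) Filter.atTop (nhds 0) := by
      refine squeeze_zero_norm' ?_ hto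
      filter_upwards [Filter.eventually_ge_atTop k.natAbs] with n hn
      have hn' := hn.trans (hψn n)
      let i : ↥(Finset.Icc (-(ψ n + 1 : ℤ)) (ψ n + 1)) := ⟨k, Finset.mem_Icc.2 (by constructor <;> omega)⟩
      have e : (2 * π * k : ℝ) • fcoef (y (ψ n)) k - fcoef (fun t => G (y (ψ n) t)) k =
          galerkinGrad G (φ (ψ n)) (x (ψ n)) i := by
        rw [galerkinGrad]
        have : fcoef (y (ψ n)) k = x (ψ n) i := fcoef_trigPoly (hφ (ψ n)) (x (ψ n)) i
        rw [this]
      rw [e]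
      have h3 : ‖galerkinGrad G (φ (ψ n)) (x (ψ n)) i‖ ^ 2 ≤ (1 / ((ψ n : ℝ) + 1)) ^ 2 := by
        rw [div_pow, one_pow]
        refine le_trans ?_ (hx2 (ψ n))
        exact Finset.single_le_sum (f := fun i => ‖galerkinGrad G (φ (ψ n)) (x (ψ n)) i‖ ^ 2)
          (fun _ _ => by positivity) (Finset.mem_univ i)
      exact (pow_le_pow_iff_left₀ (norm_nonneg _) (by positivity) two_ne_zero).1 h3
    exact sub_eq_zero.1 (tendsto_nhds_unique l1 l2)
  · refine hβ.trans_le ?_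
    have l1 : Filter.Tendsto (fun n =>
        1 / 2 * (∫ t in (0:ℝ)..1, inner ℝ (G (y (ψ n) t)) (y (ψ n) t)) -
          (∫ t in (0:ℝ)..1, H (y (ψ n) t)) + 1 / 2 * ((1 + D) * (1 / ((ψ n : ℝ) + 1))))
        Filter.atTop (nhds (1 / 2 * (∫ t in (0:ℝ)..1, inner ℝ (G (z t)) (z t)) -
          (∫ t in (0:ℝ)..1, H (z t)) + 1 / 2 * ((1 + D) * 0))) := by
      refine (((hlimR (F := fun p => inner ℝ (G p.2) p.2) (by fun_prop)).const_mul _).sub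
        (hlimR (F := fun p => H p.2) (by fun_prop))).add ((hto.const_mul _).const_mul _)
    rw [mul_zero, mul_zero, add_zero] at l1
    refine ge_of_tendsto' l1 fun n => ?_
    have h1 := hx1 (ψ n)
    rw [galerkinAction_eq hGc] at h1
    have h2 := sum_inner_galerkinGrad_le (x (ψ n)) (by positivity : (0:ℝ) < (ψ n : ℝ) + 1)
      (hD _) (hx2 (ψ n))
    have h3 : (1 + D) / ((ψ n : ℝ) + 1) = (1 + D) * (1 / ((ψ n : ℝ) + 1)) := by ring
    rw [h3] at h2
    change β ≤ 1 / 2 * (∫ t in (0:ℝ)..1, inner ℝ (G (y (ψ n) t)) (y (ψ n) t)) + _ -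
      (∫ t in (0:ℝ)..1, H (y (ψ n) t)) at h1
    linarith

end

/-- `ℂ²` with its Hermitian inner product. -/
def C2 : Type := EuclideanSpace ℂ (Fin 2)

instance : NormedAddCommGroup C2 := inferInstanceAs (NormedAddCommGroup (EuclideanSpace ℂ (Fin 2)))
instance : InnerProductSpace ℂ C2 :=
  inferInstanceAs (InnerProductSpace ℂ (EuclideanSpace ℂ (Fin 2)))
instance : FiniteDimensional ℂ C2 :=
  inferInstanceAs (FiniteDimensional ℂ (EuclideanSpace ℂ (Fin 2)))

/-- The point of `ℂ²` with given coordinates. -/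
def C2.mk (a b : ℂ) : C2 := WithLp.toLp 2 ![a, b]

/-- Coordinates on `ℂ²`. -/
def C2.coord (i : Fin 2) : C2 →L[ℂ] ℂ := EuclideanSpace.proj (𝕜 := ℂ) i

lemma C2.ext {z w : C2} (h0 : C2.coord 0 z = C2.coord 0 w) (h1 : C2.coord 1 z = C2.coord 1 w) :
    z = w := by
  refine PiLp.ext fun i => ?_
  fin_cases i
  · exact h0
  · exact h1

@[simp] lemma C2.coord_zero_mk (a b : ℂ) : C2.coord 0 (C2.mk a b) = a := rfl
@[simp] lemma C2.coord_one_mk (a b : ℂ) : C2.coord 1 (C2.mk a b) = b := rfl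

lemma C2.inner_eq (z w : C2) : (inner ℂ z w : ℂ) =
    C2.coord 0 w * (starRingEnd ℂ) (C2.coord 0 z) +
      C2.coord 1 w * (starRingEnd ℂ) (C2.coord 1 z) := by
  have := PiLp.inner_apply (𝕜 := ℂ) (f := fun _ : Fin 2 => ℂ) z w
  rw [Fin.sum_univ_two] at this
  exact this

/-- Multiplication by `i` under the identification `ℝ⁴ = ℂ²`. -/
def rotJ : R4 →L[ℝ] R4 := LinearMap.toContinuousLinearMap
  { toFun := fun x => !₂[-x 1, x 0, -x 3, x 2]
    map_add' := fun x y => by ext i; fin_cases i <;> simp <;> ring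
    map_smul' := fun c x => by ext i; fin_cases i <;> simp }

@[simp] lemma rotJ_zero (x : R4) : rotJ x 0 = -x 1 := rfl
@[simp] lemma rotJ_one (x : R4) : rotJ x 1 = x 0 := rfl
@[simp] lemma rotJ_two (x : R4) : rotJ x 2 = -x 3 := rfl
@[simp] lemma rotJ_three (x : R4) : rotJ x 3 = x 2 := rfl

lemma R4.inner_eq (x y : R4) : inner ℝ x y = x 0 * y 0 + x 1 * y 1 + x 2 * y 2 + x 3 * y 3 := by
  rw [PiLp.inner_apply, Fin.sum_univ_four]
  simp [mul_comm]

lemma R4.norm_sq_eq (x : R4) : ‖x‖ ^ 2 = x 0 ^ 2 + x 1 ^ 2 + x 2 ^ 2 + x 3 ^ 2 := by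
  rw [← real_inner_self_eq_norm_sq, R4.inner_eq]; ring

lemma omegaSt_rotJ (u v : R4) : omegaSt (rotJ u) v = -inner ℝ u v := by
  simp [omegaSt, R4.inner_eq]; ring

section
attribute [local instance] InnerProductSpace.complexToReal

lemma C2.inner_real_eq (z w : C2) : inner ℝ z w =
    (C2.coord 0 z).re * (C2.coord 0 w).re + (C2.coord 0 z).im * (C2.coord 0 w).im +
    ((C2.coord 1 z).re * (C2.coord 1 w).re + (C2.coord 1 z).im * (C2.coord 1 w).im) := by
  rw [real_inner_eq_re_inner ℂ, C2.inner_eq]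
  simp; ring

lemma C2.norm_sq_eq (z : C2) : ‖z‖ ^ 2 =
    (C2.coord 0 z).re ^ 2 + (C2.coord 0 z).im ^ 2 +
    ((C2.coord 1 z).re ^ 2 + (C2.coord 1 z).im ^ 2) := by
  rw [← real_inner_self_eq_norm_sq, C2.inner_real_eq]; ring

lemma C2.coord_smul (i : Fin 2) (c : ℝ) (z : C2) : C2.coord i (c • z) = c * C2.coord i z := by
  rw [← Complex.coe_smul, map_smul, smul_eq_mul]

/-- The identification `ℝ⁴ ≃ ℂ²`. -/
def toC2 : R4 ≃ₗᵢ[ℝ] C2 :=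
  { toFun := fun x => C2.mk ⟨x 0, x 1⟩ ⟨x 2, x 3⟩
    invFun := fun z => !₂[(C2.coord 0 z).re, (C2.coord 0 z).im,
      (C2.coord 1 z).re, (C2.coord 1 z).im]
    left_inv := fun x => by ext i; fin_cases i <;> simp
    right_inv := fun z => by apply C2.ext <;> simp
    map_add' := fun x y => by
      apply C2.ext <;> simp only [map_add, C2.coord_zero_mk, C2.coord_one_mk] <;>
        apply Complex.ext <;> simp
    map_smul' := fun c x => by
      apply C2.ext <;> simp only [C2.coord_smul, C2.coord_zero_mk, C2.coord_one_mk] <;>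
        apply Complex.ext <;> simp
    norm_map' := fun x => by
      have h : ‖C2.mk ⟨x 0, x 1⟩ ⟨x 2, x 3⟩‖ ^ 2 = ‖x‖ ^ 2 := by
        rw [C2.norm_sq_eq, R4.norm_sq_eq]; simp; ring
      exact (pow_left_inj₀ (norm_nonneg _) (norm_nonneg _) two_ne_zero).1 h }

lemma toC2_apply (x : R4) : toC2 x = C2.mk ⟨x 0, x 1⟩ ⟨x 2, x 3⟩ := rfl

lemma toC2_rotJ (x : R4) : toC2 (rotJ x) = Complex.I • toC2 x := by
  apply C2.ext <;> simp only [toC2_apply, map_smul, C2.coord_zero_mk, C2.coord_one_mk] <;>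
    apply Complex.ext <;> simp

lemma toC2_inner (x y : R4) : inner ℝ (toC2 x) (toC2 y) = inner ℝ x y :=
  toC2.inner_map_map x y

end

section
variable {E : Type*} [NormedAddCommGroup E] [InnerProductSpace ℝ E] [CompleteSpace E]

lemma abs_sub_inner_le_of_lipschitz_gradient {H : E → ℝ} {gH : E → E} {L : NNReal}
    (hH : ∀ x, HasGradientAt H (gH x) x) (hL : LipschitzWith L gH) (z w : E) :
    |H (z + w) - H z - inner ℝ (gH z) w| ≤ L * ‖w‖ ^ 2 := by
  have hd : ∀ v ∈ Metric.closedBall (0:E) ‖w‖, HasFDerivWithinAt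
      (fun v => H (z + v) - inner ℝ (gH z) v)
      (InnerProductSpace.toDual ℝ E (gH (z + v)) - innerSL ℝ (gH z))
      (Metric.closedBall (0:E) ‖w‖) v := by
    intro v _
    refine HasFDerivAt.hasFDerivWithinAt (HasFDerivAt.sub ?_ (innerSL ℝ (gH z)).hasFDerivAt)
    have h1 := (hH (z + v)).hasFDerivAt
    have h2 : HasFDerivAt (fun v : E => z + v) (ContinuousLinearMap.id ℝ E) v :=
      (hasFDerivAt_id v).const_add z
    have h3 := h1.comp v h2
    rw [ContinuousLinearMap.comp_id] at h3
    exact h3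
  have hb : ∀ v ∈ Metric.closedBall (0:E) ‖w‖,
      ‖InnerProductSpace.toDual ℝ E (gH (z + v)) - innerSL ℝ (gH z)‖ ≤ L * ‖w‖ := by
    intro v hv
    have e : InnerProductSpace.toDual ℝ E (gH (z + v)) - innerSL ℝ (gH z) =
        InnerProductSpace.toDual ℝ E (gH (z + v) - gH z) := by
      rw [map_sub]; rfl
    rw [e, LinearIsometryEquiv.norm_map]
    have h1 := hL.norm_sub_le (z + v) z
    rw [add_sub_cancel_left] at h1
    refine h1.trans ?_
    gcongr
    simpa using hv
  have h := (convex_closedBall (0:E) ‖w‖).norm_image_sub_le_of_norm_hasFDerivWithin_le hd hb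
    (x := 0) (y := w) (by simp) (by simp)
  simp only [add_zero, inner_zero_right, sub_zero, Real.norm_eq_abs] at h
  calc |H (z + w) - H z - inner ℝ (gH z) w| = |H (z + w) - inner ℝ (gH z) w - H z| := by ring_nf
    _ ≤ L * ‖w‖ * ‖w‖ := h
    _ = L * ‖w‖ ^ 2 := by ring

end

lemma exists_pos_le_abs_two_pi_sub {a : ℝ} (h : ∀ k : ℤ, (2 * π * k : ℝ) ≠ a) (ha0 : 0 < a) :
    ∃ c : ℝ, 0 < c ∧ ∀ k : ℤ, c * (1 + |(k:ℝ)|) ≤ |2 * π * k - a| := by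
  obtain ⟨n, hn⟩ := exists_nat_gt a
  have hpi := Real.pi_gt_three
  set s : Finset ℤ := Finset.Icc (-n) n with hs
  have hne : s.Nonempty := ⟨0, by simp [hs]⟩
  obtain ⟨k₀, hk₀, hmin⟩ := s.exists_min_image (fun k : ℤ => |2 * π * k - a| / (1 + |(k:ℝ)|)) hne
  have hpos : 0 < |2 * π * k₀ - a| / (1 + |(k₀:ℝ)|) := by
    have := abs_pos.2 (sub_ne_zero.2 (h k₀))
    positivity
  refine ⟨min 1 (|2 * π * k₀ - a| / (1 + |(k₀:ℝ)|)), lt_min one_pos hpos, fun k => ?_⟩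
  by_cases hk : k ∈ s
  · have h1 := hmin k hk
    rw [le_div_iff₀ (by positivity)] at h1
    refine le_trans ?_ h1
    gcongr
    exact min_le_right _ _
  · have hk' : (n:ℝ) + 1 ≤ |(k:ℝ)| := by
      have h1 : ¬ (|k| ≤ (n:ℤ)) := fun hh => hk (by rw [hs, Finset.mem_Icc]; exact abs_le.1 hh)
      have h2 : (n:ℤ) + 1 ≤ |k| := by omega
      exact_mod_cast h2
    have h3 : 2 * π * |(k:ℝ)| - a ≤ |2 * π * k - a| := by
      have := abs_sub_abs_le_abs_sub (2 * π * k : ℝ) a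
      rw [abs_mul, abs_mul, abs_of_pos Real.pi_pos, abs_of_pos ha0] at this
      simpa using this
    have h4 : min 1 (|2 * π * k₀ - a| / (1 + |(k₀:ℝ)|)) ≤ 1 := min_le_left _ _
    have h5 : min 1 (|2 * π * k₀ - a| / (1 + |(k₀:ℝ)|)) * (1 + |(k:ℝ)|) ≤ 1 * (1 + |(k:ℝ)|) := by
      gcongr
    have : (0:ℝ) ≤ n := Nat.cast_nonneg n
    nlinarith

section
attribute [local instance] InnerProductSpace.complexToReal

/-- The diagonal map `diag(α, β)` of `ℂ²`. -/
def C2.diag (α β : ℝ) : C2 →L[ℂ] C2 := LinearMap.toContinuousLinearMap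
  { toFun := fun z => C2.mk (α * C2.coord 0 z) (β * C2.coord 1 z)
    map_add' := fun z w => by
      apply C2.ext <;> simp only [map_add, C2.coord_zero_mk, C2.coord_one_mk] <;> ring
    map_smul' := fun c z => by
      apply C2.ext <;> simp only [map_smul, C2.coord_zero_mk, C2.coord_one_mk, smul_eq_mul,
        RingHom.id_apply] <;> ring }

@[simp] lemma C2.coord_zero_diag (α β : ℝ) (z : C2) :
    C2.coord 0 (C2.diag α β z) = α * C2.coord 0 z := rfl
@[simp] lemma C2.coord_one_diag (α β : ℝ) (z : C2) :
    C2.coord 1 (C2.diag α β z) = β * C2.coord 1 z := rfl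

lemma C2.norm_sq_eq_norm (z : C2) : ‖z‖ ^ 2 = ‖C2.coord 0 z‖ ^ 2 + ‖C2.coord 1 z‖ ^ 2 := by
  rw [C2.norm_sq_eq, ← Complex.normSq_eq_norm_sq, ← Complex.normSq_eq_norm_sq,
    Complex.normSq_apply, Complex.normSq_apply]
  ring

lemma C2.exists_resonance_bound {α β : ℝ} (hα0 : 0 < α) (hβ0 : 0 < β)
    (hα : ∀ k : ℤ, (2 * π * k : ℝ) ≠ α) (hβ : ∀ k : ℤ, (2 * π * k : ℝ) ≠ β) :
    ∃ c : ℝ, 0 < c ∧ ∀ (k : ℤ) (v : C2),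
      c * (1 + |(k:ℝ)|) * ‖v‖ ≤ ‖(2 * π * k : ℝ) • v - C2.diag α β v‖ := by
  obtain ⟨c₁, hc₁, h₁⟩ := exists_pos_le_abs_two_pi_sub hα hα0
  obtain ⟨c₂, hc₂, h₂⟩ := exists_pos_le_abs_two_pi_sub hβ hβ0
  refine ⟨min c₁ c₂, lt_min hc₁ hc₂, fun k v => ?_⟩
  refine (pow_le_pow_iff_left₀ (by positivity) (norm_nonneg _) two_ne_zero).1 ?_
  rw [mul_pow, C2.norm_sq_eq_norm v, C2.norm_sq_eq_norm (_ - _)]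
  have e0 : C2.coord 0 ((2 * π * k : ℝ) • v - C2.diag α β v) =
      ((2 * π * k - α : ℝ) : ℂ) * C2.coord 0 v := by
    rw [map_sub, C2.coord_smul, C2.coord_zero_diag]; push_cast; ring
  have e1 : C2.coord 1 ((2 * π * k : ℝ) • v - C2.diag α β v) =
      ((2 * π * k - β : ℝ) : ℂ) * C2.coord 1 v := by
    rw [map_sub, C2.coord_smul, C2.coord_one_diag]; push_cast; ring
  rw [e0, e1, norm_mul, norm_mul, Complex.norm_real, Complex.norm_real,
    Real.norm_eq_abs, Real.norm_eq_abs, mul_pow |2 * π * k - α|, mul_pow |2 * π * k - β|, mul_add]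
  have a1 : min c₁ c₂ * (1 + |(k:ℝ)|) ≤ |2 * π * k - α| := le_trans (by gcongr; exact min_le_left _ _) (h₁ k)
  have a2 : min c₁ c₂ * (1 + |(k:ℝ)|) ≤ |2 * π * k - β| := le_trans (by gcongr; exact min_le_right _ _) (h₂ k)
  have hm : 0 ≤ min c₁ c₂ * (1 + |(k:ℝ)|) := by positivity
  exact add_le_add (mul_le_mul_of_nonneg_right (pow_le_pow_left₀ hm a1 2) (by positivity))
    (mul_le_mul_of_nonneg_right (pow_le_pow_left₀ hm a2 2) (by positivity))

lemma toC2_symm_zero (z : C2) : (toC2.symm z) 0 = (C2.coord 0 z).re := rfl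
lemma toC2_symm_one (z : C2) : (toC2.symm z) 1 = (C2.coord 0 z).im := rfl
lemma toC2_symm_two (z : C2) : (toC2.symm z) 2 = (C2.coord 1 z).re := rfl
lemma toC2_symm_three (z : C2) : (toC2.symm z) 3 = (C2.coord 1 z).im := rfl

lemma C2.diag_eq_toC2 (α β : ℝ) (z : C2) : C2.diag α β z =
    toC2 !₂[α * (toC2.symm z) 0, α * (toC2.symm z) 1, β * (toC2.symm z) 2,
      β * (toC2.symm z) 3] := by
  rw [toC2_symm_zero, toC2_symm_one, toC2_symm_two, toC2_symm_three]
  apply C2.ext <;> apply Complex.ext <;> simp [toC2_apply]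

/-- Existence of a `1`-periodic orbit of positive action in `ℝ⁴`. -/
theorem exists_periodic_orbit_R4 {H : R4 → ℝ} {gH : R4 → R4} {L : NNReal}
    (hH : ∀ x, HasGradientAt H (gH x) x) (hL : LipschitzWith L gH) (hnn : ∀ x, 0 ≤ H x)
    (hzero : ∀ᶠ x in nhds (0 : R4), H x = 0)
    {α β : ℝ} (hα0 : 0 < α) (hβ0 : 0 < β)
    (hα : ∀ k : ℤ, (2 * π * k : ℝ) ≠ α) (hβ : ∀ k : ℤ, (2 * π * k : ℝ) ≠ β)
    {B : ℝ} (hB : ∀ x, ‖gH x - !₂[α * x 0, α * x 1, β * x 2, β * x 3]‖ ≤ B)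
    {b₁ b₂ C : ℝ} (hb₁ : 0 ≤ b₁) (hb₂ : 0 < b₂) (hb : π < b₁ + b₂)
    (hgr : ∀ x, b₁ * (x 0 ^ 2 + x 1 ^ 2) + b₂ * ‖x‖ ^ 2 - C ≤ H x) :
    ∃ y : ℝ → R4, (∀ t, y (t + 1) = y t) ∧ (∀ t, HasDerivAt y (rotJ (gH (y t))) t) ∧
      0 < 1 / 2 * (∫ t in (0:ℝ)..1, inner ℝ (gH (y t)) (y t)) - ∫ t in (0:ℝ)..1, H (y t) := by
  obtain ⟨c, hc, hres⟩ := C2.exists_resonance_bound hα0 hβ0 hα hβ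
  have hHc : Continuous H := continuous_iff_continuousAt.2 fun x => (hH x).continuousAt
  have hgc : Continuous gH := hL.continuous
  have hdes := abs_sub_inner_le_of_lipschitz_gradient hH hL
  have hH0 : H 0 = 0 := hzero.self_of_nhds
  have hg0 : gH 0 = 0 := by
    have h1 : HasGradientAt H 0 0 := by
      have : HasFDerivAt (fun _ : R4 => (0:ℝ)) (0 : R4 →L[ℝ] ℝ) 0 := hasFDerivAt_const _ _
      have := this.congr_of_eventuallyEq hzero
      rw [hasGradientAt_iff_hasFDerivAt]
      simpa using this
    exact (hH 0).unique h1
  have hadm : AdmissibleHam (fun z : C2 => H (toC2.symm z))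
      (fun z => toC2 (gH (toC2.symm z))) (C2.mk 1 0) := by
    refine ⟨hHc.comp toC2.symm.continuous,
      toC2.continuous.comp (hgc.comp toC2.symm.continuous), ⟨L, L.2, fun z w => ?_⟩,
      fun z => hnn _, ?_, ⟨b₁, b₂, C, hb₁, hb₂, hb, fun z => ?_⟩⟩
    · have h1 := (abs_le.1 (hdes (toC2.symm z) (toC2.symm w))).1
      have h2 : inner ℝ (toC2 (gH (toC2.symm z))) w = inner ℝ (gH (toC2.symm z)) (toC2.symm w) := by
        rw [← toC2_inner, LinearIsometryEquiv.apply_symm_apply]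
      rw [LinearIsometryEquiv.norm_map] at h1
      rw [h2, map_add]
      linarith
    · obtain ⟨r, hr, hball⟩ := Metric.eventually_nhds_iff.1 hzero
      refine ⟨L / r ^ 2, fun z => ?_⟩
      by_cases hz : ‖z‖ < r
      · have : H (toC2.symm z) = 0 := hball (by simpa using hz)
        rw [this]; positivity
      · have h1 := (abs_le.1 (hdes 0 (toC2.symm z))).2
        rw [hH0, hg0, zero_add, inner_zero_left, sub_zero, sub_zero,
          LinearIsometryEquiv.norm_map] at h1
        refine h1.trans ?_
        have h2 : r ^ 2 ≤ ‖z‖ ^ 2 := by gcongr; exact not_lt.1 hz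
        calc (L:ℝ) * ‖z‖ ^ 2 = L / r ^ 2 * (r ^ 2 * ‖z‖ ^ 2) := by field_simp
          _ ≤ L / r ^ 2 * (‖z‖ ^ 2 * ‖z‖ ^ 2) := by gcongr
          _ = _ := by ring
    · have h1 := hgr (toC2.symm z)
      rw [LinearIsometryEquiv.norm_map] at h1
      have h2 : ‖(inner ℂ (C2.mk 1 0) z : ℂ)‖ ^ 2 = (toC2.symm z) 0 ^ 2 + (toC2.symm z) 1 ^ 2 := by
        rw [C2.inner_eq, ← Complex.normSq_eq_norm_sq, Complex.normSq_apply]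
        rw [toC2_symm_zero, toC2_symm_one]
        simp [sq]
      rw [h2]
      exact h1
  have hv₁ : ‖C2.mk 1 0‖ = 1 := by
    have : ‖C2.mk 1 0‖ ^ 2 = 1 := by rw [C2.norm_sq_eq_norm]; simp
    exact (pow_eq_one_iff_of_nonneg (norm_nonneg _) two_ne_zero).1 this
  obtain ⟨y, hy1, hy2, hy3⟩ := exists_periodic_orbit_of_admissible
    (K := fun z => toC2 (gH (toC2.symm z)) - C2.diag α β z) (A := C2.diag α β) (B := B) hv₁ hadm
    (fun z => by abel) (fun z => by
      have h1 := hB (toC2.symm z)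
      rw [← LinearIsometryEquiv.norm_map toC2, map_sub] at h1
      rw [C2.diag_eq_toC2]
      exact h1) hc hres
  refine ⟨fun t => toC2.symm (y t), fun t => by simp only [hy1], fun t => ?_, ?_⟩
  · have h1 := (toC2.symm : C2 ≃ₗᵢ[ℝ] R4).toContinuousLinearEquiv.hasFDerivAt.comp_hasDerivAt t (hy2 t)
    have h2 : (toC2.symm : C2 ≃ₗᵢ[ℝ] R4) (Complex.I • toC2 (gH (toC2.symm (y t)))) =
        rotJ (gH (toC2.symm (y t))) := by
      rw [← toC2_rotJ, LinearIsometryEquiv.symm_apply_apply]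
    rw [← h2]
    exact h1
  · have h2 : ∀ t, inner ℝ (gH (toC2.symm (y t))) (toC2.symm (y t)) =
        inner ℝ (toC2 (gH (toC2.symm (y t)))) (y t) := fun t => by
      rw [← toC2_inner, LinearIsometryEquiv.apply_symm_apply]
    simp_rw [h2]
    exact hy3

end

/-- A smooth convex profile which vanishes on `(-∞, 1]` and has slope one on `[1 + η, ∞)`. -/
lemma exists_ramp {η : ℝ} (hη : 0 < η) : ∃ f f' : ℝ → ℝ, (∀ s, HasDerivAt f (f' s) s) ∧
    ContDiff ℝ ∞ f' ∧ (∀ s, 0 ≤ f' s) ∧ (∀ s, f' s ≤ 1) ∧ (∀ s ≤ 1, f' s = 0) ∧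
    (∀ s, 1 + η ≤ s → f' s = 1) ∧ (∀ s ≤ 1, f s = 0) ∧ (∀ s, 0 ≤ f s) ∧
    ∀ s, s - 1 - η ≤ f s := by
  set g : ℝ → ℝ := fun t => Real.smoothTransition ((t - 1) / η) with hg
  have hgc : ContDiff ℝ ∞ g := Real.smoothTransition.contDiff.comp (by fun_prop)
  have hg0 : ∀ t, 0 ≤ g t := fun t => Real.smoothTransition.nonneg _
  have hg1 : ∀ s ≤ 1, g s = 0 := fun s hs => Real.smoothTransition.zero_of_nonpos
    (div_nonpos_of_nonpos_of_nonneg (by linarith) hη.le)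
  have hg2 : ∀ s, 1 + η ≤ s → g s = 1 := fun s hs => Real.smoothTransition.one_of_one_le
    ((one_le_div hη).2 (by linarith))
  have hInt : ∀ a b, IntervalIntegrable g MeasureTheory.volume a b :=
    fun a b => hgc.continuous.intervalIntegrable a b
  have hf0 : ∀ s ≤ 1, ∫ t in (1:ℝ)..s, g t = 0 := by
    intro s hs
    rw [intervalIntegral.integral_congr (g := fun _ => (0:ℝ))]
    · simp
    · intro t ht
      rw [Set.uIcc_of_ge hs] at ht
      exact hg1 t ht.2
  have hfn : ∀ s, 0 ≤ ∫ t in (1:ℝ)..s, g t := by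
    intro s
    rcases le_total s 1 with h | h
    · exact (hf0 s h).ge
    · exact intervalIntegral.integral_nonneg h fun t _ => hg0 t
  refine ⟨fun s => ∫ t in (1:ℝ)..s, g t, g, fun s => ?_, hgc, hg0,
    fun s => Real.smoothTransition.le_one _, hg1, hg2, hf0, hfn, fun s => ?_⟩
  · exact intervalIntegral.integral_hasDerivAt_right (hInt _ _)
      hgc.continuous.aestronglyMeasurable.stronglyMeasurableAtFilter hgc.continuous.continuousAt
  · rcases le_total s (1 + η) with h | h
    · linarith [hfn s]
    · have h1 := intervalIntegral.integral_add_adjacent_intervals (hInt 1 (1 + η)) (hInt (1 + η) s)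
      have h2 : ∫ t in (1 + η)..s, g t = s - 1 - η := by
        rw [intervalIntegral.integral_congr (g := fun _ => (1:ℝ))]
        · simp; ring
        · intro t ht
          rw [Set.uIcc_of_le h] at ht
          exact hg2 t ht.1
      have h3 := hfn (1 + η)
      linarith

/-- The gradient of `x₀² + x₁² + κ (x₂² + x₃²)`. -/
def cylGrad (κ : ℝ) : R4 →L[ℝ] R4 := LinearMap.toContinuousLinearMap
  { toFun := fun x => !₂[2 * x 0, 2 * x 1, 2 * κ * x 2, 2 * κ * x 3]
    map_add' := fun x y => by ext i; fin_cases i <;> simp <;> ring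
    map_smul' := fun c x => by ext i; fin_cases i <;> simp <;> ring }

@[simp] lemma cylGrad_zero (κ : ℝ) (x : R4) : cylGrad κ x 0 = 2 * x 0 := rfl
@[simp] lemma cylGrad_one (κ : ℝ) (x : R4) : cylGrad κ x 1 = 2 * x 1 := rfl
@[simp] lemma cylGrad_two (κ : ℝ) (x : R4) : cylGrad κ x 2 = 2 * κ * x 2 := rfl
@[simp] lemma cylGrad_three (κ : ℝ) (x : R4) : cylGrad κ x 3 = 2 * κ * x 3 := rfl

/-- The quadratic form `x₀² + x₁² + κ (x₂² + x₃²)`. -/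
def cylQuad (κ : ℝ) (x : R4) : ℝ := x 0 ^ 2 + x 1 ^ 2 + κ * (x 2 ^ 2 + x 3 ^ 2)

lemma inner_cylGrad_self (κ : ℝ) (x : R4) : inner ℝ (cylGrad κ x) x = 2 * cylQuad κ x := by
  rw [R4.inner_eq]; simp [cylQuad]; ring

lemma hasGradientAt_cylQuad (κ : ℝ) (x : R4) : HasGradientAt (cylQuad κ) (cylGrad κ x) x := by
  have h1 : cylQuad κ = fun x => (1/2 : ℝ) * inner ℝ (cylGrad κ x) x := by
    ext x; rw [inner_cylGrad_self]; ring
  rw [hasGradientAt_iff_hasFDerivAt, h1]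
  have h2 := (((cylGrad κ).hasFDerivAt (x := x)).inner ℝ (hasFDerivAt_id x)).const_mul (1/2 : ℝ)
  refine h2.congr_fderiv ?_
  ext v
  simp [R4.inner_eq]
  ring

lemma contDiff_cylQuad (κ : ℝ) : ContDiff ℝ ∞ (cylQuad κ) := by
  have h1 : cylQuad κ = fun x => (1/2 : ℝ) * inner ℝ (cylGrad κ x) x := by
    ext x; rw [inner_cylGrad_self]; ring
  rw [h1]
  exact contDiff_const.mul ((cylGrad κ).contDiff.inner ℝ contDiff_id)

lemma inner_rotJ_self (x : R4) : inner ℝ x (rotJ x) = 0 := by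
  rw [R4.inner_eq]; simp; ring

lemma rotJ_rotJ (x : R4) : rotJ (rotJ x) = -x := by
  ext i; fin_cases i <;> simp

lemma HasGradientAt.add' {E : Type*} [NormedAddCommGroup E] [InnerProductSpace ℝ E]
    [CompleteSpace E] {f g : E → ℝ} {f' g' x : E} (hf : HasGradientAt f f' x)
    (hg : HasGradientAt g g' x) : HasGradientAt (fun x => f x + g x) (f' + g') x := by
  rw [hasGradientAt_iff_hasFDerivAt] at *
  rw [map_add]
  exact hf.add hg

lemma HasGradientAt.scomp_deriv {E : Type*} [NormedAddCommGroup E] [InnerProductSpace ℝ E]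
    [CompleteSpace E] {f : ℝ → ℝ} {q : E → ℝ} {f' : ℝ} {q' x : E} (hf : HasDerivAt f f' (q x))
    (hq : HasGradientAt q q' x) : HasGradientAt (fun x => f (q x)) (f' • q') x := by
  rw [hasGradientAt_iff_hasFDerivAt] at *
  have := hf.comp_hasFDerivAt x hq
  rw [map_smul]
  exact this

lemma HasGradientAt.comp_add_right {E : Type*} [NormedAddCommGroup E] [InnerProductSpace ℝ E]
    [CompleteSpace E] {f : E → ℝ} {f' x p : E} (hf : HasGradientAt f f' (x + p)) :
    HasGradientAt (fun x => f (x + p)) f' x := by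
  rw [hasGradientAt_iff_hasFDerivAt] at *
  have h2 : HasFDerivAt (fun v : E => v + p) (ContinuousLinearMap.id ℝ E) x :=
    (hasFDerivAt_id x).add_const p
  have h3 := HasFDerivAt.comp x hf h2
  rw [ContinuousLinearMap.comp_id] at h3
  exact h3

lemma HasGradientAt.hasDerivAt_comp {E : Type*} [NormedAddCommGroup E] [InnerProductSpace ℝ E]
    [CompleteSpace E] {f : E → ℝ} {f' : E} {y : ℝ → E} {y' : E} {t : ℝ}
    (hf : HasGradientAt f f' (y t)) (hy : HasDerivAt y y' t) :
    HasDerivAt (fun t => f (y t)) (inner ℝ f' y') t := by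
  rw [hasGradientAt_iff_hasFDerivAt] at hf
  exact hf.comp_hasDerivAt t hy

lemma HasGradientAt.eq_zero_of_isLocalExtr {E : Type*} [NormedAddCommGroup E]
    [InnerProductSpace ℝ E] [CompleteSpace E] {f : E → ℝ} {f' x : E} (hf : HasGradientAt f f' x)
    (h : IsLocalExtr f x) : f' = 0 := by
  rw [hasGradientAt_iff_hasFDerivAt] at hf
  have := h.hasFDerivAt_eq_zero hf
  simpa using this

lemma exists_lipschitzWith_norm_le_of_contDiff {E F : Type*} [NormedAddCommGroup E]
    [NormedSpace ℝ E] [FiniteDimensional ℝ E] [NormedAddCommGroup F] [NormedSpace ℝ F]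
    {f : E → F} (hf : ContDiff ℝ ∞ f) {R : ℝ} (hR : ∀ x, f x ≠ 0 → ‖x‖ ≤ R) :
    ∃ (C : NNReal), LipschitzWith C f ∧ ∀ x, ‖f x‖ ≤ C := by
  have hc : HasCompactSupport f := by
    refine HasCompactSupport.of_support_subset_isCompact (isCompact_closedBall (0 : E) R) ?_
    intro x hx
    simpa using hR x hx
  obtain ⟨C₁, h₁⟩ := ContDiff.lipschitzWith_of_hasCompactSupport hc hf (by simp)
  obtain ⟨C₂, h₂⟩ := hf.continuous.bounded_above_of_compact_support hc
  refine ⟨max C₁ C₂.toNNReal, h₁.weaken (le_max_left _ _), fun x => ?_⟩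
  refine (h₂ x).trans ((Real.le_coe_toNNReal _).trans ?_)
  exact_mod_cast le_max_right C₁ C₂.toNNReal

/-- A Hamiltonian which is constant, equal to `m > π`, outside a compact subset of the open unit
cylinder, and which vanishes near some point, has a nonconstant `1`-periodic orbit. -/
theorem exists_orbit_of_cylindrical_ham {h : R4 → ℝ} {gh : R4 → R4} {L : NNReal} {m r R : ℝ}
    {p : R4} (hh : ∀ x, HasGradientAt h (gh x) x) (hL : LipschitzWith L gh)
    (h0 : ∀ x, 0 ≤ h x) (hm : ∀ x, h x ≤ m) (hπ : π < m) (hr : r < 1) (hR : 0 ≤ R)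
    (hsupp : ∀ x, h x ≠ m → x 0 ^ 2 + x 1 ^ 2 ≤ r ∧ x 2 ^ 2 + x 3 ^ 2 ≤ R)
    (hp : ∀ᶠ x in nhds p, h x = 0) :
    ∃ y : ℝ → R4, (∀ t, y (t + 1) = y t) ∧ (∀ t, HasDerivAt y (rotJ (gh (y t))) t) ∧
      ∀ t, gh (y t) ≠ 0 := by
  have hpi := Real.pi_pos
  -- parameters
  obtain ⟨κ, hκ0, hκ1, hκ⟩ : ∃ κ : ℝ, 0 < κ ∧ κ < 1 / 2 ∧ r + κ * R < 1 := by
    refine ⟨min (1/4) ((1 - r) / (2 * (1 + R))), ?_, ?_, ?_⟩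
    · have : 0 < 1 - r := by linarith
      positivity
    · exact (min_le_left _ _).trans_lt (by norm_num)
    · have h1 : min (1/4) ((1 - r) / (2 * (1 + R))) * R ≤ ((1 - r) / (2 * (1 + R))) * R := by
        gcongr; exact min_le_right _ _
      have h2 : ((1 - r) / (2 * (1 + R))) * R < 1 - r := by
        rw [div_mul_eq_mul_div, div_lt_iff₀ (by positivity)]
        nlinarith
      linarith
  obtain ⟨b, hb1, hb2, hb3⟩ : ∃ b : ℝ, π < b ∧ b < m ∧ b < 2 * π := by
    obtain ⟨b, h1, h2⟩ := exists_between (lt_min hπ (by linarith : π < 2 * π))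
    exact ⟨b, h1, h2.trans_le (min_le_left _ _), h2.trans_le (min_le_right _ _)⟩
  have hb0 : 0 < b := hpi.trans hb1
  set η : ℝ := (m - b) / b with hηd
  have hη : 0 < η := div_pos (by linarith) hb0
  have hbη : b * (1 + η) = m := by rw [hηd]; field_simp; ring
  obtain ⟨f, f', hf, hf'c, hf'0, hf'1, hf'z, hf'o, hfz, hfn, hfl⟩ := exists_ramp hη
  have hq1 : ∀ x, h x ≠ m → cylQuad κ x < 1 := by
    intro x hx
    obtain ⟨h1, h2⟩ := hsupp x hx
    have : κ * (x 2 ^ 2 + x 3 ^ 2) ≤ κ * R := by gcongr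
    unfold cylQuad
    linarith
  have hqn : ∀ x, κ * ‖x‖ ^ 2 ≤ cylQuad κ x := by
    intro x
    rw [R4.norm_sq_eq]
    unfold cylQuad
    nlinarith [sq_nonneg (x 0), sq_nonneg (x 1)]
  have hgh0 : ∀ x, h x = m → gh x = 0 := by
    intro x hx
    refine (hh x).eq_zero_of_isLocalExtr (Or.inr ?_)
    exact Filter.Eventually.of_forall fun y => (hm y).trans hx.ge
  -- bounds
  have hlarge : ∀ x, cylQuad κ x < 1 + η → ‖x‖ ≤ Real.sqrt ((1 + η) / κ) := by
    intro x hx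
    refine Real.le_sqrt_of_sq_le ?_
    rw [le_div_iff₀ hκ0]
    linarith [hqn x]
  obtain ⟨B₁, hB₁⟩ : ∃ B₁ : ℝ, ∀ x, ‖gh x‖ ≤ B₁ := by
    obtain ⟨C, hC⟩ := (isCompact_closedBall (0 : R4) (Real.sqrt ((1 + η) / κ))).exists_bound_of_continuousOn
      hL.continuous.continuousOn
    refine ⟨max C 0, fun x => ?_⟩
    by_cases hx : h x = m
    · rw [hgh0 x hx, norm_zero]; exact le_max_right _ _
    · refine (hC x ?_).trans (le_max_left _ _)
      simpa using hlarge x (by linarith [hq1 x hx])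
  obtain ⟨C₂, hC₂, hB₂⟩ := exists_lipschitzWith_norm_le_of_contDiff
    (f := fun x => (b * (f' (cylQuad κ x) - 1)) • cylGrad κ x) (R := Real.sqrt ((1 + η) / κ))
    ((contDiff_const.mul ((hf'c.comp (contDiff_cylQuad κ)).sub contDiff_const)).smul
      (cylGrad κ).contDiff) (fun x hx => hlarge x (by
        by_contra! hc
        rw [hf'o _ hc] at hx
        simp at hx))
  -- the modified Hamiltonian
  set H : R4 → ℝ := fun z => h (z + p) + b * f (cylQuad κ (z + p)) with hHd
  set gt : R4 → R4 := fun x => gh x + (b * f' (cylQuad κ x)) • cylGrad κ x with hgt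
  have hgteq : ∀ x, gt x = gh x + ((b * (f' (cylQuad κ x) - 1)) • cylGrad κ x +
      b • cylGrad κ x) := by
    intro x
    simp only [hgt]
    congr 1
    rw [← add_smul]; congr 1; ring
  have hHg : ∀ z, HasGradientAt H (gt (z + p)) z := by
    intro z
    refine HasGradientAt.comp_add_right (f := fun x => h x + b * f (cylQuad κ x)) ?_
    refine (hh _).add' ?_
    exact HasGradientAt.scomp_deriv (f := fun s => b * f s) ((hf _).const_mul b) (hasGradientAt_cylQuad κ _)
  have hgtL : LipschitzWith (L + (C₂ + ‖b • cylGrad κ‖₊)) gt := by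
    have : gt = fun x => gh x + ((b * (f' (cylQuad κ x) - 1)) • cylGrad κ x +
      (b • cylGrad κ) x) := funext hgteq
    rw [this]
    exact hL.add (hC₂.add (b • cylGrad κ).lipschitz)
  have hgtL' : LipschitzWith (L + (C₂ + ‖b • cylGrad κ‖₊)) (fun z => gt (z + p)) := by
    intro x y
    have := hgtL (x + p) (y + p)
    rwa [edist_add_right] at this
  have hHn : ∀ z, 0 ≤ H z := fun z => add_nonneg (h0 _) (mul_nonneg hb0.le (hfn _))
  have hHz : ∀ᶠ z in nhds (0 : R4), H z = 0 := by
    have ht : Filter.Tendsto (fun z : R4 => z + p) (nhds 0) (nhds p) := by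
      have : Continuous fun z : R4 => z + p := by fun_prop
      simpa using this.tendsto 0
    filter_upwards [ht.eventually hp] with z hz
    have h1 := hq1 (z + p) (by rw [hz]; linarith)
    simp only [hHd, hz, hfz _ h1.le]
    simp
  have hα : ∀ k : ℤ, (2 * π * k : ℝ) ≠ 2 * b := by
    intro k hk
    rcases le_or_gt k 1 with hk1 | hk1
    · have : (k:ℝ) ≤ 1 := by exact_mod_cast hk1
      nlinarith
    · have : (2:ℝ) ≤ k := by exact_mod_cast hk1
      nlinarith
  have hβ : ∀ k : ℤ, (2 * π * k : ℝ) ≠ 2 * b * κ := by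
    intro k hk
    have h1 : 0 < 2 * b * κ := by positivity
    have h2 : 2 * b * κ < 2 * π := by nlinarith
    rcases le_or_gt k 0 with hk1 | hk1
    · have : (k:ℝ) ≤ 0 := by exact_mod_cast hk1
      nlinarith
    · have : (1:ℝ) ≤ k := by exact_mod_cast hk1
      nlinarith
  have hB : ∀ z, ‖gt (z + p) - !₂[2 * b * z 0, 2 * b * z 1, 2 * b * κ * z 2, 2 * b * κ * z 3]‖ ≤
      B₁ + (C₂ + ‖b • cylGrad κ p‖) := by
    intro z
    have e : gt (z + p) - !₂[2 * b * z 0, 2 * b * z 1, 2 * b * κ * z 2, 2 * b * κ * z 3] =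
        gh (z + p) + ((b * (f' (cylQuad κ (z + p)) - 1)) • cylGrad κ (z + p) +
          b • cylGrad κ p) := by
      have e2 : !₂[2 * b * z 0, 2 * b * z 1, 2 * b * κ * z 2, 2 * b * κ * z 3] =
          b • cylGrad κ z := by
        ext i; fin_cases i <;> simp <;> ring
      rw [e2, hgteq, map_add (cylGrad κ), smul_add b]
      abel
    rw [e]
    exact (norm_add_le _ _).trans (add_le_add (hB₁ _) ((norm_add_le _ _).trans
      (add_le_add (hB₂ _) le_rfl)))
  set b' : ℝ := (b + π) / 2 with hb'
  have hb'1 : π < b' := by rw [hb']; linarith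
  have hb'2 : b' < b := by rw [hb']; linarith
  have hquad : ∀ u v : ℝ, b' * u ^ 2 ≤ b * (u + v) ^ 2 + b ^ 2 / (b - b') * v ^ 2 := by
    intro u v
    have hd : 0 < b - b' := by linarith
    have e : b * (u + v) ^ 2 + b ^ 2 / (b - b') * v ^ 2 - b' * u ^ 2 =
        ((b - b') * u + b * v) ^ 2 / (b - b') + b * v ^ 2 := by
      field_simp; ring
    have : 0 ≤ ((b - b') * u + b * v) ^ 2 / (b - b') + b * v ^ 2 := by positivity
    linarith
  have hgr : ∀ z : R4, b' * (1 - κ) * (z 0 ^ 2 + z 1 ^ 2) + b' * κ * ‖z‖ ^ 2 -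
      (b ^ 2 / (b - b') * cylQuad κ p + b * (1 + η)) ≤ H z := by
    intro z
    have h1 : b * (cylQuad κ (z + p) - 1 - η) ≤ b * f (cylQuad κ (z + p)) :=
      mul_le_mul_of_nonneg_left (hfl _) hb0.le
    have h2 : b * (cylQuad κ (z + p) - 1 - η) ≤ H z := by
      simp only [hHd]; linarith [h0 (z + p)]
    refine le_trans ?_ h2
    rw [R4.norm_sq_eq]
    simp only [cylQuad, PiLp.add_apply]
    have k0 := hquad (z 0) (p 0)
    have k1 := hquad (z 1) (p 1)
    have k2 := mul_le_mul_of_nonneg_left (hquad (z 2) (p 2)) hκ0.le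
    have k3 := mul_le_mul_of_nonneg_left (hquad (z 3) (p 3)) hκ0.le
    linarith
  obtain ⟨y, hy1, hyd, hpos⟩ := exists_periodic_orbit_R4 hHg hgtL' hHn hHz
    (by positivity) (by positivity) hα hβ hB (b₁ := b' * (1 - κ)) (b₂ := b' * κ)
    (mul_nonneg (by linarith) (by linarith)) (mul_pos (by linarith) hκ0) (by linarith) hgr
  -- translate back
  set Y : ℝ → R4 := fun t => y t + p with hY
  have hYd : ∀ t, HasDerivAt Y (rotJ (gt (Y t))) t := fun t => (hyd t).add_const p
  have hYc : Continuous Y := continuous_iff_continuousAt.2 fun t => (hYd t).continuousAt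
  have hgtc : Continuous fun t => gt (Y t) := hgtL.continuous.comp hYc
  have hmean : ∫ t in (0:ℝ)..1, gt (Y t) = 0 := by
    have h1 : ∫ t in (0:ℝ)..1, rotJ (gt (Y t)) = 0 := by
      rw [intervalIntegral.integral_eq_sub_of_hasDerivAt (fun t _ => hYd t)
        ((rotJ.continuous.comp hgtc).intervalIntegrable _ _)]
      have := hy1 0
      rw [zero_add] at this
      simp [hY, this]
    rw [ContinuousLinearMap.intervalIntegral_comp_comm rotJ (hgtc.intervalIntegrable _ _)] at h1
    have h2 := congrArg rotJ h1
    rw [rotJ_rotJ, map_zero, neg_eq_zero] at h2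
    exact h2
  have hact : 0 < ∫ t in (0:ℝ)..1, (1 / 2 * inner ℝ (gt (Y t)) (Y t) -
      (h (Y t) + b * f (cylQuad κ (Y t)))) := by
    have hhc : Continuous h := continuous_iff_continuousAt.2 fun x => (hh x).continuousAt
    have hfc : Continuous f := continuous_iff_continuousAt.2 fun x => (hf x).continuousAt
    have i1 : Continuous fun t => inner ℝ (gt (Y t)) (Y t) := hgtc.inner hYc
    have i2 : Continuous fun t => h (Y t) + b * f (cylQuad κ (Y t)) :=
      (hhc.comp hYc).add (continuous_const.mul
        (hfc.comp ((contDiff_cylQuad κ).continuous.comp hYc)))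
    have i3 : Continuous fun t => 1 / 2 * inner ℝ (gt (Y t)) (Y t) := continuous_const.mul i1
    rw [intervalIntegral.integral_sub (i3.intervalIntegrable _ _)
      (i2.intervalIntegrable _ _), intervalIntegral.integral_const_mul]
    have h3 : ∫ t in (0:ℝ)..1, inner ℝ (gt (Y t)) (Y t) =
        ∫ t in (0:ℝ)..1, inner ℝ (gt (y t + p)) (y t) := by
      have hyc : Continuous y := continuous_iff_continuousAt.2 fun t => (hyd t).continuousAt
      have e : ∀ t, inner ℝ (gt (Y t)) (Y t) = inner ℝ (gt (Y t)) (y t) + inner ℝ p (gt (Y t)) := by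
        intro t
        rw [real_inner_comm _ p, ← inner_add_right]
      simp_rw [e]
      rw [intervalIntegral.integral_add ((hgtc.inner hyc).intervalIntegrable _ _)
        ((continuous_const.inner hgtc).intervalIntegrable _ _)]
      have := ContinuousLinearMap.intervalIntegral_comp_comm (innerSL ℝ p)
        (hgtc.intervalIntegrable (μ := MeasureTheory.volume) 0 1)
      simp only [innerSL_apply_apply, hmean, inner_zero_right] at this
      rw [this, add_zero]
    rw [h3]
    exact hpos
  -- conservation of the profile
  have horth : ∀ x, (f' (cylQuad κ x)) • gh x = 0 := by
    intro x
    by_cases hx : h x = m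
    · rw [hgh0 x hx, smul_zero]
    · rw [hf'z _ (hq1 x hx).le, zero_smul]
  have hconst : ∀ t, f (cylQuad κ (Y t)) = f (cylQuad κ (Y 0)) := by
    intro t
    have hd : ∀ t, HasDerivAt (fun t => f (cylQuad κ (Y t))) 0 t := by
      intro t
      have h1 := (HasGradientAt.scomp_deriv (hf _) (hasGradientAt_cylQuad κ (Y t))).hasDerivAt_comp
        (hYd t)
      convert h1 using 1
      rw [hgt]
      simp only [map_add, map_smul, inner_add_right, inner_smul_right, inner_smul_left,
        inner_rotJ_self]
      have h2 := congrArg (fun v => inner ℝ (cylGrad κ (Y t)) (rotJ v)) (horth (Y t))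
      simp only [map_smul, inner_smul_right, map_zero, inner_zero_right] at h2
      simp [h2]
    exact is_const_of_deriv_eq_zero (fun t => (hd t).differentiableAt) (fun t => (hd t).deriv) t 0
  have hf'le : ∀ s, 0 ≤ s → f' s * s - f s ≤ 1 + η := by
    intro s hs
    rcases le_total s (1 + η) with h1 | h1
    · have := hfn s
      have := hf'1 s
      have := hf'0 s
      nlinarith
    · rw [hf'o s h1]
      linarith [hfl s]
  have hc0 : f (cylQuad κ (Y 0)) = 0 := by
    by_contra hne
    refine absurd hact (not_lt.2 ?_)
    have : ∀ t, 1 / 2 * inner ℝ (gt (Y t)) (Y t) - (h (Y t) + b * f (cylQuad κ (Y t))) ≤ 0 := by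
      intro t
      have h1 : 1 < cylQuad κ (Y t) := by
        by_contra! hc
        exact hne ((hconst t).symm.trans (hfz _ hc))
      have h2 : h (Y t) = m := by
        by_contra hc
        linarith [hq1 _ hc]
      have h3 := hf'le _ (zero_le_one.trans h1.le)
      simp only [hgt, hgh0 _ h2, zero_add, h2, inner_smul_left, inner_cylGrad_self]
      simp only [conj_trivial]
      nlinarith
    have h4 := intervalIntegral.integral_nonneg (μ := MeasureTheory.volume) (zero_le_one' ℝ)
      (f := fun t => -(1 / 2 * inner ℝ (gt (Y t)) (Y t) - (h (Y t) + b * f (cylQuad κ (Y t)))))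
      fun t _ => neg_nonneg.2 (this t)
    rw [intervalIntegral.integral_neg] at h4
    linarith
  have hf'Y : ∀ t, f' (cylQuad κ (Y t)) = 0 := by
    intro t
    have h1 : f (cylQuad κ (Y t)) = 0 := (hconst t).trans hc0
    have h2 : IsLocalMin f (cylQuad κ (Y t)) :=
      Filter.Eventually.of_forall fun s => h1.le.trans (hfn s)
    exact h2.hasDerivAt_eq_zero (hf _)
  have hgtY : ∀ t, gt (Y t) = gh (Y t) := fun t => by simp [hgt, hf'Y t]
  have hYd' : ∀ t, HasDerivAt Y (rotJ (gh (Y t))) t := fun t => by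
    have := hYd t
    rwa [hgtY] at this
  refine ⟨Y, fun t => by simp only [hY, hy1], hYd', ?_⟩
  by_contra! hex
  obtain ⟨t₀, ht₀⟩ := hex
  have hYconst : Y = fun _ => Y t₀ := by
    refine ODE_solution_unique_univ (v := fun _ x => rotJ (gh x)) (s := fun _ => Set.univ)
      (K := ‖rotJ‖₊ * L) (t₀ := t₀) (fun t => (rotJ.lipschitz.comp hL).lipschitzOnWith)
      (fun t => ⟨hYd' t, Set.mem_univ _⟩) (fun t => ⟨?_, Set.mem_univ _⟩) rfl
    rw [ht₀, map_zero]
    exact hasDerivAt_const _ _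
  refine absurd hact (not_lt.2 ?_)
  have h4 : ∀ t, 1 / 2 * inner ℝ (gt (Y t)) (Y t) - (h (Y t) + b * f (cylQuad κ (Y t))) ≤ 0 := by
    intro t
    have e : Y t = Y t₀ := congrFun hYconst t
    rw [hgtY, e, ht₀, inner_zero_left, mul_zero]
    have := h0 (Y t₀)
    have := mul_nonneg hb0.le (hfn (cylQuad κ (Y t₀)))
    linarith
  have h5 := intervalIntegral.integral_nonneg (μ := MeasureTheory.volume) (zero_le_one' ℝ)
    (f := fun t => -(1 / 2 * inner ℝ (gt (Y t)) (Y t) - (h (Y t) + b * f (cylQuad κ (Y t)))))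
    fun t _ => neg_nonneg.2 (h4 t)
  rw [intervalIntegral.integral_neg] at h5
  linarith

section
variable {E : Type*} [NormedAddCommGroup E] [NormedSpace ℝ E]

/-- A bounded Lipschitz time-dependent vector field has global integral curves. -/
lemma exists_solution_of_bounded_lipschitz [CompleteSpace E] {v : ℝ → E → E} {K C : NNReal}
    (hc : ∀ x, Continuous fun t => v t x) (hL : ∀ t, LipschitzWith K (v t))
    (hb : ∀ t x, ‖v t x‖ ≤ C) (t₀ : ℝ) (x₀ : E) :
    ∃ γ : ℝ → E, γ t₀ = x₀ ∧ ∀ t, HasDerivAt γ (v t (γ t)) t := by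
  have hex : ∀ n : ℕ, ∃ α : ℝ → E, α t₀ = x₀ ∧
      ∀ t ∈ Set.Icc (t₀ - (n + 1)) (t₀ + (n + 1)),
        HasDerivWithinAt α (v t (α t)) (Set.Icc (t₀ - (n + 1)) (t₀ + (n + 1))) t := by
    intro n
    have hn : (0:ℝ) ≤ n := Nat.cast_nonneg n
    have hpl : IsPicardLindelof v (tmin := t₀ - (n + 1)) (tmax := t₀ + (n + 1))
        ⟨t₀, by constructor <;> linarith⟩ x₀ (C * (n + 1)) 0 C K :=
      { lipschitzOnWith := fun t _ => (hL t).lipschitzOnWith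
        continuousOn := fun x _ => (hc x).continuousOn
        norm_le := fun t _ x _ => hb t x
        mul_max_le := by simp }
    exact hpl.exists_eq_forall_mem_Icc_hasDerivWithinAt₀
  choose α hα0 hα using hex
  have hα' : ∀ n : ℕ, ∀ t ∈ Set.Ioo (t₀ - (n + 1)) (t₀ + (n + 1)), HasDerivAt (α n) (v t (α n t)) t :=
    fun n t ht => (hα n t (Set.Ioo_subset_Icc_self ht)).hasDerivAt (Icc_mem_nhds ht.1 ht.2)
  have hcons : ∀ n m : ℕ, n ≤ m → Set.EqOn (α n) (α m) (Set.Icc (t₀ - (n + 1)) (t₀ + (n + 1))) := by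
    intro n m hnm
    have hn : (0:ℝ) ≤ n := Nat.cast_nonneg n
    have hnm' : (n:ℝ) ≤ m := Nat.cast_le.2 hnm
    have hsub : Set.Icc (t₀ - (n + 1)) (t₀ + (n + 1)) ⊆ Set.Icc (t₀ - (m + 1)) (t₀ + (m + 1) : ℝ) :=
      Set.Icc_subset_Icc (by linarith) (by linarith)
    refine ODE_solution_unique_of_mem_Icc (v := v) (s := fun _ => Set.univ) (K := K) (t₀ := t₀)
      (fun t _ => (hL t).lipschitzOnWith) ⟨by linarith, by linarith⟩
      (fun t ht => (hα n t ht).continuousWithinAt) (fun t ht => hα' n t ht)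
      (fun _ _ => Set.mem_univ _)
      (fun t ht => (hα m t (hsub ht)).continuousWithinAt.mono hsub)
      (fun t ht => hα' m t ⟨by linarith [ht.1], by linarith [ht.2]⟩)
      (fun _ _ => Set.mem_univ _) (by rw [hα0, hα0])
  refine ⟨fun t => α ⌈|t - t₀|⌉₊ t, by simp [hα0], fun t => ?_⟩
  set N : ℕ := ⌈|t - t₀|⌉₊ with hN
  have hlt : |t - t₀| < N + 1 := lt_of_le_of_lt (Nat.le_ceil _) (by linarith)
  have heq : ∀ s, |s - t₀| < N + 1 → α ⌈|s - t₀|⌉₊ s = α (N + 1) s := by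
    intro s hs
    refine hcons _ _ (Nat.ceil_le.2 (by push_cast; linarith)) ?_
    have := Nat.le_ceil |s - t₀|
    have h2 := abs_le.1 this
    constructor <;> linarith [h2.1, h2.2]
  have hev : (fun t => α ⌈|t - t₀|⌉₊ t) =ᶠ[nhds t] α (N + 1) := by
    have : Continuous fun s : ℝ => |s - t₀| := by fun_prop
    filter_upwards [this.continuousAt.eventually_lt continuousAt_const hlt] with s hs
    exact heq s hs
  have h1 := hα' (N + 1) t (by
    have := abs_lt.1 hlt
    push_cast
    constructor <;> linarith [this.1, this.2])
  have h2 := h1.congr_of_eventuallyEq hev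
  rwa [← heq t hlt] at h2

/-- The radial retraction onto the ball of radius `R`. -/
def radialRetraction (R : ℝ) (x : E) : E := (R / max R ‖x‖) • x

lemma radialRetraction_eq_self {R : ℝ} (hR : 0 < R) {x : E} (hx : ‖x‖ ≤ R) :
    radialRetraction R x = x := by
  rw [radialRetraction, max_eq_left hx, div_self hR.ne', one_smul]

lemma norm_radialRetraction_le {R : ℝ} (hR : 0 < R) (x : E) : ‖radialRetraction R x‖ ≤ R := by
  have hm : 0 < max R ‖x‖ := lt_max_of_lt_left hR
  rw [radialRetraction, norm_smul, Real.norm_of_nonneg (by positivity), div_mul_eq_mul_div,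
    div_le_iff₀ hm]
  gcongr
  exact le_max_right _ _

lemma norm_radialRetraction_le_norm {R : ℝ} (hR : 0 < R) (x : E) :
    ‖radialRetraction R x‖ ≤ ‖x‖ := by
  have hm : 0 < max R ‖x‖ := lt_max_of_lt_left hR
  rw [radialRetraction, norm_smul, Real.norm_of_nonneg (by positivity)]
  refine mul_le_of_le_one_left (norm_nonneg _) ?_
  rw [div_le_one hm]
  exact le_max_left _ _

lemma lipschitzWith_radialRetraction {R : ℝ} (hR : 0 < R) :
    LipschitzWith 2 (radialRetraction R : E → E) := by
  refine LipschitzWith.of_dist_le_mul fun x y => ?_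
  rw [dist_eq_norm, dist_eq_norm]
  have hx : 0 < max R ‖x‖ := lt_max_of_lt_left hR
  have hy : 0 < max R ‖y‖ := lt_max_of_lt_left hR
  have e : radialRetraction R x - radialRetraction R y =
      (R / max R ‖x‖) • (x - y) + (R * (max R ‖y‖ - max R ‖x‖) / (max R ‖x‖ * max R ‖y‖)) • y := by
    rw [smul_sub, sub_add, ← sub_smul, radialRetraction, radialRetraction]
    congr 2
    field_simp
    ring
  rw [e]
  have h1 : ‖(R / max R ‖x‖) • (x - y)‖ ≤ ‖x - y‖ := by
    rw [norm_smul, Real.norm_of_nonneg (by positivity)]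
    refine mul_le_of_le_one_left (norm_nonneg _) ?_
    rw [div_le_one hx]
    exact le_max_left _ _
  have h2 : ‖(R * (max R ‖y‖ - max R ‖x‖) / (max R ‖x‖ * max R ‖y‖)) • y‖ ≤ ‖x - y‖ := by
    rw [norm_smul, Real.norm_eq_abs, abs_div, abs_mul, abs_of_pos hR, abs_of_pos (mul_pos hx hy),
      div_mul_eq_mul_div, div_le_iff₀ (mul_pos hx hy)]
    have h3 : |max R ‖y‖ - max R ‖x‖| ≤ ‖x - y‖ := by
      refine (abs_max_sub_max_le_max _ _ _ _).trans ?_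
      rw [sub_self, abs_zero, max_eq_right (abs_nonneg _), norm_sub_rev]
      exact abs_norm_sub_norm_le _ _
    calc R * |max R ‖y‖ - max R ‖x‖| * ‖y‖ ≤ max R ‖x‖ * ‖x - y‖ * max R ‖y‖ := by
          gcongr
          · exact le_max_left _ _
          · exact le_max_right _ _
      _ = _ := by ring
  calc _ ≤ ‖x - y‖ + ‖x - y‖ := (norm_add_le _ _).trans (add_le_add h1 h2)
    _ = _ := by push_cast; ring

lemma norm_le_mul_exp_of_deriv_le {f f' : ℝ → E} {K ε : ℝ} (hK : 1 ≤ K) (hε : 0 ≤ ε)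
    (hf : ∀ t ∈ Set.Icc (0:ℝ) 1, HasDerivAt f (f' t) t) (h0 : f 0 = 0)
    (hb : ∀ t ∈ Set.Icc (0:ℝ) 1, ‖f' t‖ ≤ K * ‖f t‖ + ε) :
    ∀ t ∈ Set.Icc (0:ℝ) 1, ‖f t‖ ≤ ε * Real.exp K := by
  intro t ht
  have h := norm_le_gronwallBound_of_norm_deriv_right_le (δ := 0) (a := 0) (b := 1)
    (fun s hs => (hf s hs).continuousAt.continuousWithinAt)
    (fun s hs => (hf s (Set.Ico_subset_Icc_self hs)).hasDerivWithinAt) (by simp [h0])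
    (fun s hs => hb s (Set.Ico_subset_Icc_self hs)) t ht
  refine h.trans ?_
  rw [gronwallBound_of_K_ne_0 (by linarith)]
  simp only [zero_mul, zero_add, sub_zero]
  have h1 : Real.exp (K * t) ≤ Real.exp K := Real.exp_le_exp.2 (by nlinarith [ht.1, ht.2])
  have h2 : 0 ≤ Real.exp (K * t) - 1 := by
    have : 0 ≤ K * t := mul_nonneg (by linarith) ht.1
    linarith [Real.one_le_exp this]
  have h3 : ε / K ≤ ε := div_le_self hε hK
  calc ε / K * (Real.exp (K * t) - 1) ≤ ε * (Real.exp K) := by gcongr; linarith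
    _ = _ := rfl

/-- The time-one flow of a `C^{1,1}` time-dependent vector field, together with the linearised
flow. -/
theorem exists_flow [CompleteSpace E] {v : ℝ → E → E} {Dv : ℝ → E → E →L[ℝ] E} {K C C₂ : NNReal}
    (hK1 : 1 ≤ K) (hv : ∀ t x, HasFDerivAt (v t) (Dv t x) x) (hc : ∀ x, Continuous fun t => v t x)
    (hDc : Continuous fun p : ℝ × E => Dv p.1 p.2) (hb : ∀ t x, ‖v t x‖ ≤ C)
    (hK : ∀ t x, ‖Dv t x‖ ≤ K) (hD : ∀ t, LipschitzWith C₂ (Dv t)) :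
    ∃ (Φ : ℝ → E → E) (A : ℝ → E → E →L[ℝ] E), (∀ x, Φ 0 x = x) ∧
      (∀ t x, HasDerivAt (fun t => Φ t x) (v t (Φ t x)) t) ∧
      (∀ x, A 0 x = ContinuousLinearMap.id ℝ E) ∧
      (∀ t ∈ Set.Icc (0:ℝ) 1, ∀ x,
        HasDerivAt (fun t => A t x) ((Dv t (Φ t x)).comp (A t x)) t) ∧
      (∀ x, HasFDerivAt (Φ 1) (A 1 x) x) ∧ (∃ L, LipschitzWith L (A 1)) ∧
      (∀ x, ‖A 1 x‖ ≤ Real.exp K) ∧ Function.Surjective (Φ 1) := by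
  have hvL : ∀ t, LipschitzWith K (v t) := fun t =>
    lipschitzWith_of_nnnorm_fderiv_le (fun x => (hv t x).differentiableAt) fun x => by
      rw [(hv t x).fderiv]; exact_mod_cast hK t x
  have hsol := fun t₀ x₀ => exists_solution_of_bounded_lipschitz hc hvL hb t₀ x₀
  have hK1' : (1:ℝ) ≤ K := by exact_mod_cast hK1
  choose Φ hΦ0 hΦ using hsol 0
  set R : ℝ := Real.exp K with hR
  have hR0 : 0 < R := Real.exp_pos _
  have hRN : (R.toNNReal : ℝ) = R := Real.coe_toNNReal _ hR0.le
  have hexA : ∀ x, ∃ A : ℝ → E →L[ℝ] E, A 0 = ContinuousLinearMap.id ℝ E ∧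
      ∀ t, HasDerivAt A ((Dv t (Φ x t)).comp (radialRetraction R (A t))) t := by
    intro x
    have hΦc : Continuous (Φ x) := continuous_iff_continuousAt.2 fun t => (hΦ x t).continuousAt
    refine exists_solution_of_bounded_lipschitz (K := K * 2) (C := K * R.toNNReal)
      (v := fun t A => (Dv t (Φ x t)).comp (radialRetraction R A)) (fun A => ?_) (fun t => ?_)
      (fun t A => ?_) 0 (ContinuousLinearMap.id ℝ E)
    · have : Continuous fun t => Dv t (Φ x t) := hDc.comp (continuous_id.prodMk hΦc)
      exact this.clm_comp continuous_const
    · refine LipschitzWith.of_dist_le_mul fun A B => ?_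
      rw [dist_eq_norm, ← ContinuousLinearMap.comp_sub]
      refine (ContinuousLinearMap.opNorm_comp_le _ _).trans ?_
      have h1 := (lipschitzWith_radialRetraction hR0).dist_le_mul A B
      rw [dist_eq_norm] at h1
      have := hK t (Φ x t)
      push_cast
      rw [mul_assoc]
      exact mul_le_mul this h1 (norm_nonneg _) K.2
    · refine (ContinuousLinearMap.opNorm_comp_le _ _).trans ?_
      rw [NNReal.coe_mul, hRN]
      exact mul_le_mul (hK _ _) (norm_radialRetraction_le hR0 _) (norm_nonneg _) K.2
  choose A hA0 hA using hexA
  have hAn : ∀ x, ∀ t ∈ Set.Icc (0:ℝ) 1, ‖A x t‖ ≤ R := by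
    intro x t ht
    have h := norm_le_gronwallBound_of_norm_deriv_right_le (δ := 1) (a := 0) (b := 1) (K := K)
      (ε := 0) (f := A x) (f' := fun t => (Dv t (Φ x t)).comp (radialRetraction R (A x t)))
      (fun s hs => (hA x s).continuousAt.continuousWithinAt)
      (fun s hs => (hA x s).hasDerivWithinAt) (by
        rw [hA0]; exact ContinuousLinearMap.norm_id_le)
      (fun s hs => by
        rw [add_zero]
        refine (ContinuousLinearMap.opNorm_comp_le _ _).trans ?_
        exact mul_le_mul (hK _ _) (norm_radialRetraction_le_norm hR0 _) (norm_nonneg _) K.2) t ht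
    refine h.trans ?_
    rw [gronwallBound_ε0, one_mul, sub_zero, hR]
    exact Real.exp_le_exp.2 (by nlinarith [ht.1, ht.2])
  have hA' : ∀ x, ∀ t ∈ Set.Icc (0:ℝ) 1, HasDerivAt (A x) ((Dv t (Φ x t)).comp (A x t)) t := by
    intro x t ht
    have := hA x t
    rwa [radialRetraction_eq_self hR0 (hAn x t ht)] at this
  have hΦL : ∀ x y, ∀ t ∈ Set.Icc (0:ℝ) 1, ‖Φ x t - Φ y t‖ ≤ ‖x - y‖ * R := by
    intro x y t ht
    have h := dist_le_of_trajectories_ODE (v := v) (K := K) (a := 0) (b := 1) (δ := ‖x - y‖)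
      hvL (fun s _ => (hΦ x s).continuousAt.continuousWithinAt)
      (fun s _ => (hΦ x s).hasDerivWithinAt)
      (fun s _ => (hΦ y s).continuousAt.continuousWithinAt)
      (fun s _ => (hΦ y s).hasDerivWithinAt) (by rw [hΦ0, hΦ0, dist_eq_norm]) t ht
    rw [dist_eq_norm, sub_zero] at h
    refine h.trans (mul_le_mul_of_nonneg_left ?_ (norm_nonneg _))
    exact Real.exp_le_exp.2 (by nlinarith [ht.1, ht.2])
  have hAL : ∀ x y, ∀ t ∈ Set.Icc (0:ℝ) 1, ‖A x t - A y t‖ ≤ C₂ * (‖x - y‖ * R) * R * R := by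
    intro x y
    refine norm_le_mul_exp_of_deriv_le (f := fun t => A x t - A y t) hK1' (by positivity)
      (fun t ht => (hA' x t ht).sub (hA' y t ht)) (by simp [hA0]) fun t ht => ?_
    have e : (Dv t (Φ x t)).comp (A x t) - (Dv t (Φ y t)).comp (A y t) =
        (Dv t (Φ x t)).comp (A x t - A y t) + (Dv t (Φ x t) - Dv t (Φ y t)).comp (A y t) := by
      rw [ContinuousLinearMap.comp_sub, ContinuousLinearMap.sub_comp]; abel
    rw [e]
    refine (norm_add_le _ _).trans (add_le_add ?_ ?_)
    · refine (ContinuousLinearMap.opNorm_comp_le _ _).trans ?_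
      gcongr
      exact hK _ _
    · refine (ContinuousLinearMap.opNorm_comp_le _ _).trans ?_
      have h1 := (hD t).norm_sub_le (Φ x t) (Φ y t)
      have h2 := hΦL x y t ht
      have h3 := hAn y t ht
      have h4 : ‖Dv t (Φ x t) - Dv t (Φ y t)‖ ≤ C₂ * (‖x - y‖ * R) := h1.trans (by gcongr)
      gcongr
  refine ⟨fun t x => Φ x t, fun t x => A x t, hΦ0, fun t x => hΦ x t, hA0,
    fun t ht x => hA' x t ht, fun x => ?_, ?_, fun x => hAn x 1 (by simp), fun z => ?_⟩
  · have key : ∀ y, ‖Φ y 1 - Φ x 1 - A x 1 (y - x)‖ ≤ C₂ * (‖y - x‖ * R) ^ 2 * R := by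
      intro y
      refine norm_le_mul_exp_of_deriv_le (f := fun t => Φ y t - Φ x t - A x t (y - x))
        (f' := fun t => v t (Φ y t) - v t (Φ x t) - (Dv t (Φ x t)) (A x t (y - x)))
        hK1' (by positivity)
        (fun t ht => ?_) (by simp [hA0, hΦ0]) (fun t ht => ?_) 1 (by simp)
      · refine ((hΦ y t).sub (hΦ x t)).sub ?_
        have := (hA' x t ht).clm_apply (hasDerivAt_const t (y - x))
        simpa using this
      · have e : v t (Φ y t) - v t (Φ x t) - (Dv t (Φ x t)) (A x t (y - x)) =
            (Dv t (Φ x t)) (Φ y t - Φ x t - A x t (y - x)) +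
            (v t (Φ y t) - v t (Φ x t) - (Dv t (Φ x t)) (Φ y t - Φ x t)) := by
          rw [map_sub (Dv t (Φ x t)) (Φ y t - Φ x t)]; abel
        rw [e]
        refine (norm_add_le _ _).trans (add_le_add ?_ ?_)
        · exact ((Dv t (Φ x t)).le_opNorm _).trans (by gcongr; exact hK _ _)
        · have h1 := (convex_closedBall (Φ x t) ‖Φ y t - Φ x t‖).norm_image_sub_le_of_norm_hasFDerivWithin_le'
            (f := v t) (f' := Dv t) (φ := Dv t (Φ x t)) (C := C₂ * ‖Φ y t - Φ x t‖)
            (fun z _ => (hv t z).hasFDerivWithinAt) (fun z hz => by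
              have := (hD t).norm_sub_le z (Φ x t)
              refine this.trans ?_
              gcongr
              rw [← dist_eq_norm]; exact hz) (x := Φ x t) (y := Φ y t) (by simp)
              (by rw [Metric.mem_closedBall, dist_eq_norm])
          refine h1.trans ?_
          have h2 := hΦL y x t ht
          calc (C₂:ℝ) * ‖Φ y t - Φ x t‖ * ‖Φ y t - Φ x t‖ = C₂ * ‖Φ y t - Φ x t‖ ^ 2 := by ring
            _ ≤ _ := by gcongr
    rw [hasFDerivAt_iff_isLittleO]
    refine Asymptotics.IsBigO.trans_isLittleO (g := fun y => ‖y - x‖ ^ 2) ?_ ?_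
    · refine Asymptotics.IsBigO.of_bound (C₂ * R ^ 2 * R) (Filter.Eventually.of_forall fun y => ?_)
      refine (key y).trans (le_of_eq ?_)
      rw [Real.norm_of_nonneg (by positivity)]; ring
    · have h1 := Asymptotics.isLittleO_pow_sub_sub x (m := 2) (by norm_num)
      exact h1
  · refine ⟨C₂ * (R.toNNReal * R.toNNReal * R.toNNReal), LipschitzWith.of_dist_le_mul fun x y => ?_⟩
    rw [dist_eq_norm, dist_eq_norm]
    refine (hAL x y 1 (by simp)).trans (le_of_eq ?_)
    simp only [NNReal.coe_mul, hRN]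
    ring
  · obtain ⟨γ, hγ1, hγ⟩ := hsol 1 z
    refine ⟨γ 0, ?_⟩
    have : Φ (γ 0) = γ := ODE_solution_unique_univ (v := v) (s := fun _ => Set.univ) (K := K)
      (t₀ := 0) (fun t => (hvL t).lipschitzOnWith) (fun t => ⟨hΦ _ t, Set.mem_univ _⟩)
      (fun t => ⟨hγ t, Set.mem_univ _⟩) (hΦ0 _)
    exact (congrFun this 1).trans hγ1

end

section TranslateIntegral

lemma hasFDerivAt_integral_translate {X G : Type*} [NormedAddCommGroup X] [NormedSpace ℝ X]
    [FiniteDimensional ℝ X] [NormedAddCommGroup G] [NormedSpace ℝ G] [CompleteSpace G]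
    {F : X → G} (hF : ContDiff ℝ ∞ F) (hc : HasCompactSupport F) (N : ℝ) (e x : X) :
    HasFDerivAt (fun x => ∫ s in (0:ℝ)..N, F (x - s • e))
      (∫ s in (0:ℝ)..N, fderiv ℝ F (x - s • e)) x := by
  have hF' : Continuous (fderiv ℝ F) := hF.continuous_fderiv (by simp)
  obtain ⟨C, hC⟩ := (hc.fderiv (𝕜 := ℝ)).exists_bound_of_continuous hF'
  have hcF : ∀ x : X, Continuous fun s : ℝ => F (x - s • e) := fun x =>
    hF.continuous.comp (by fun_prop)
  have hcF' : ∀ x : X, Continuous fun s : ℝ => fderiv ℝ F (x - s • e) := fun x =>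
    hF'.comp (by fun_prop)
  refine intervalIntegral.hasFDerivAt_integral_of_dominated_of_fderiv_le (bound := fun _ => C)
    (F' := fun x s => fderiv ℝ F (x - s • e))
    (s := Set.univ) Filter.univ_mem (Filter.Eventually.of_forall fun x => ?_) ?_ ?_ ?_ ?_ ?_
  · exact (hcF x).aestronglyMeasurable
  · exact (hcF x).intervalIntegrable _ _
  · exact (hcF' x).aestronglyMeasurable
  · exact Filter.Eventually.of_forall fun s _ x _ => hC _
  · exact intervalIntegrable_const
  · refine Filter.Eventually.of_forall fun s _ x _ => ?_
    have h1 : HasFDerivAt F (fderiv ℝ F (x - s • e)) (x - s • e) :=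
      (hF.differentiable (by simp)).differentiableAt.hasFDerivAt
    have h2 : HasFDerivAt (fun x : X => x - s • e) (ContinuousLinearMap.id ℝ X) x :=
      (hasFDerivAt_id x).sub_const _
    exact HasFDerivAt.comp x h1 h2

lemma contDiff_integral_translate {X G : Type} [NormedAddCommGroup X] [NormedSpace ℝ X]
    [FiniteDimensional ℝ X] [NormedAddCommGroup G] [NormedSpace ℝ G] [CompleteSpace G]
    {F : X → G} (hF : ContDiff ℝ ∞ F) (hc : HasCompactSupport F) (N : ℝ) (e : X) :
    ContDiff ℝ ∞ (fun x => ∫ s in (0:ℝ)..N, F (x - s • e)) := by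
  rw [contDiff_infty]
  intro n
  induction n generalizing G with
  | zero =>
    exact contDiff_zero.2 (continuous_iff_continuousAt.2 fun x =>
      (hasFDerivAt_integral_translate hF hc N e x).continuousAt)
  | succ n ih =>
    have h := ih (F := fderiv ℝ F) (hF.fderiv_right (by simp)) (hc.fderiv (𝕜 := ℝ))
    exact contDiff_succ_iff_hasFDerivAt.2
      ⟨_, h, fun x => hasFDerivAt_integral_translate hF hc N e x⟩

end TranslateIntegral

lemma hasDerivAt_pullback {X : Type*} [NormedAddCommGroup X] [NormedSpace ℝ X]
    {om : X →L[ℝ] X →L[ℝ] ℝ} {Ef : X → X →L[ℝ] X →L[ℝ] ℝ} {E' : X →L[ℝ] X →L[ℝ] X →L[ℝ] ℝ}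
    {σ : X → X →L[ℝ] ℝ} {σ' : X →L[ℝ] X →L[ℝ] ℝ} {v : X → X} {Dv : X →L[ℝ] X}
    {γ : ℝ → X} {A : ℝ → X →L[ℝ] X} {τ : ℝ → ℝ} {τ' t : ℝ}
    (hom : ∀ u w, om u w = -om w u) (hEs : ∀ x u w, Ef x u w = -Ef x w u)
    (hE : HasFDerivAt Ef E' (γ t)) (hcl : ∀ u w z, E' u w z + E' w z u + E' z u w = 0)
    (hσ : HasFDerivAt σ σ' (γ t)) (hσE : ∀ u w, σ' u w - σ' w u = Ef (γ t) u w)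
    (hv : HasFDerivAt v Dv (γ t))
    (hvσ : ∀ᶠ x in nhds (γ t), ∀ w, om (v x) w + τ t * Ef x (v x) w = -τ' * σ x w)
    (hγ : HasDerivAt γ (v (γ t)) t) (hA : HasDerivAt A (Dv.comp (A t)) t)
    (hτ : HasDerivAt τ τ' t) (u w : X) :
    HasDerivAt (fun s => om (A s u) (A s w) + τ s * Ef (γ s) (A s u) (A s w)) 0 t := by
  have hAu : ∀ u, HasDerivAt (fun s => A s u) (Dv (A t u)) t := fun u => by
    have := hA.clm_apply (hasDerivAt_const t u)
    simpa using this
  have hEγ : HasDerivAt (fun s => Ef (γ s)) (E' (v (γ t))) t := by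
    have := HasFDerivAt.comp_hasDerivAt (E := X →L[ℝ] X →L[ℝ] ℝ) (l := Ef) (l' := E') t hE hγ
    exact this
  have h1 : HasDerivAt (fun s => om (A s u) (A s w))
      (om (Dv (A t u)) (A t w) + om (A t u) (Dv (A t w))) t := by
    have := (om.hasFDerivAt.comp_hasDerivAt t (hAu u)).clm_apply (hAu w)
    exact this
  have h2 : HasDerivAt (fun s => Ef (γ s) (A s u) (A s w))
      ((E' (v (γ t)) (A t u) + Ef (γ t) (Dv (A t u))) (A t w) + Ef (γ t) (A t u) (Dv (A t w))) t :=
    (hEγ.clm_apply (hAu u)).clm_apply (hAu w)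
  have h3 := h1.add (hτ.mul h2)
  refine h3.congr_deriv ?_
  -- differentiate the defining equation of `v`
  have hkey : ∀ a b : X, om (Dv a) b + τ t * (E' a (v (γ t)) b + Ef (γ t) (Dv a) b) =
      -τ' * σ' a b := by
    intro a b
    have e1 : HasFDerivAt (fun x => om (v x) b) ((om.flip b).comp Dv) (γ t) :=
      (om.flip b).hasFDerivAt.comp (γ t) hv
    have e2 := (hE.clm_apply hv).clm_apply (hasFDerivAt_const b (γ t))
    have e3 := e1.add (e2.const_mul (τ t))
    have e4 := (hσ.clm_apply (hasFDerivAt_const b (γ t))).const_mul (-τ')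
    have e5 := (e4.congr_of_eventuallyEq (hvσ.mono fun x hx => hx b)).unique e3
    have e6 := congrArg (fun L => L a) e5
    simp at e6
    linarith
  have hE's : ∀ a b c : X, E' a b c = -E' a c b := by
    intro a b c
    have e1 := (hE.clm_apply (hasFDerivAt_const b (γ t))).clm_apply (hasFDerivAt_const c (γ t))
    have e2 := (hE.clm_apply (hasFDerivAt_const c (γ t))).clm_apply (hasFDerivAt_const b (γ t))
    have e3 := (e2.neg.congr_of_eventuallyEq
      (Filter.Eventually.of_forall fun x => hEs x b c)).unique e1
    have e4 := congrArg (fun L => L a) e3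
    simp at e4
    exact e4.symm
  have k1 := hkey (A t u) (A t w)
  have k2 := hkey (A t w) (A t u)
  have k3 := hσE (A t u) (A t w)
  have k4 := hom (Dv (A t w)) (A t u)
  have k5 := hE's (A t u) (v (γ t)) (A t w)
  have k6 := hcl (v (γ t)) (A t u) (A t w)
  have k7 := hEs (γ t) (Dv (A t w)) (A t u)
  simp only [add_apply]
  linear_combination k1 - k2 - τ' * k3 + k4 - τ t * k5 + τ t * k6 + τ t * k7

lemma exists_flow_of_contDiff {E : Type*} [NormedAddCommGroup E] [NormedSpace ℝ E]
    [FiniteDimensional ℝ E] {v : ℝ × E → E} (hv : ContDiff ℝ ∞ v) {ρ C : ℝ}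
    (hρ : ∀ p, v p ≠ 0 → ‖p‖ ≤ ρ) (hC : ∀ p, ‖v p‖ ≤ C) :
    ∃ (Φ : ℝ → E → E) (A : ℝ → E → E →L[ℝ] E) (Dv : ℝ → E → E →L[ℝ] E),
      (∀ t x, HasFDerivAt (fun x => v (t, x)) (Dv t x) x) ∧ (∀ x, Φ 0 x = x) ∧
      (∀ t x, HasDerivAt (fun t => Φ t x) (v (t, Φ t x)) t) ∧
      (∀ x, A 0 x = ContinuousLinearMap.id ℝ E) ∧
      (∀ t ∈ Set.Icc (0:ℝ) 1, ∀ x,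
        HasDerivAt (fun t => A t x) ((Dv t (Φ t x)).comp (A t x)) t) ∧
      (∀ x, HasFDerivAt (Φ 1) (A 1 x) x) ∧ (∃ L, LipschitzWith L (A 1)) ∧
      (∃ K, ∀ x, ‖A 1 x‖ ≤ K) ∧ Function.Surjective (Φ 1) ∧
      (∀ t s x, ‖Φ t x - Φ s x‖ ≤ C * |t - s|) ∧
      (∀ x, (∀ t, v (t, x) = 0) → ∀ t, Φ t x = x) := by
  have hC0 : 0 ≤ C := (norm_nonneg _).trans (hC 0)
  have hv' : ContDiff ℝ ∞ (fderiv ℝ v) := hv.fderiv_right (by simp)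
  have hsupp : HasCompactSupport v :=
    HasCompactSupport.of_support_subset_isCompact (isCompact_closedBall (0 : ℝ × E) ρ)
      fun p hp => by simpa using hρ p hp
  have hρ' : ∀ p, fderiv ℝ v p ≠ 0 → ‖p‖ ≤ ρ := by
    intro p hp
    have h1 : p ∈ tsupport v := support_fderiv_subset ℝ hp
    have h2 : tsupport v ⊆ Metric.closedBall 0 ρ :=
      closure_minimal (fun p hp => by simpa using hρ p hp) Metric.isClosed_closedBall
    simpa using h2 h1
  obtain ⟨C₁, hL₁, hb₁⟩ := exists_lipschitzWith_norm_le_of_contDiff hv' hρ'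
  set J : E →L[ℝ] ℝ × E := ContinuousLinearMap.inr ℝ ℝ E with hJ
  set K : NNReal := max 1 (C₁ * ‖J‖₊) with hK
  set Dv : ℝ → E → E →L[ℝ] E := fun t x => (fderiv ℝ v (t, x)).comp J with hDv
  have hD : ∀ t x, HasFDerivAt (fun x => v (t, x)) (Dv t x) x := fun t x =>
    HasFDerivAt.comp x (hv.differentiable (by simp)).differentiableAt.hasFDerivAt
      (hasFDerivAt_prodMk_right t x)
  have hcb : ∀ t x y, Dv t x - Dv t y = (fderiv ℝ v (t, x) - fderiv ℝ v (t, y)).comp J := by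
    intro t x y; ext u; simp [hDv]
  have hDK : ∀ t x, ‖Dv t x‖ ≤ K := fun t x =>
    (ContinuousLinearMap.opNorm_comp_le _ _).trans (le_trans
      (mul_le_mul_of_nonneg_right (hb₁ _) (norm_nonneg _)) (by
        rw [hK]; push_cast; exact le_max_right _ _))
  have hDL : ∀ t, LipschitzWith (C₁ * ‖J‖₊) (Dv t) := fun t =>
    LipschitzWith.of_dist_le_mul fun x y => by
      rw [dist_eq_norm, hcb]
      refine (ContinuousLinearMap.opNorm_comp_le _ _).trans ?_
      have h1 := hL₁.dist_le_mul (t, x) (t, y)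
      rw [dist_eq_norm] at h1
      have h2 : dist (t, x) (t, y) = dist x y := by simp [Prod.dist_eq]
      rw [h2] at h1
      push_cast
      nlinarith [norm_nonneg J, coe_nnnorm J]
  have hcont : ∀ x, Continuous fun t => v (t, x) := fun x => hv.continuous.comp (by fun_prop)
  obtain ⟨Φ, A, h0, hΦ, hA0, hA, hΦ1, hAL, hAK, hsur⟩ := exists_flow (v := fun t x => v (t, x))
    (Dv := Dv) (K := K) (C := ⟨C, hC0⟩) (C₂ := C₁ * ‖J‖₊) (le_max_left _ _) hD hcont
    (hv'.continuous.clm_comp continuous_const) (fun t x => hC _) hDK hDL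
  refine ⟨Φ, A, Dv, hD, h0, hΦ, hA0, hA, hΦ1, hAL, ⟨_, hAK⟩, hsur, ?_, ?_⟩
  · intro t s x
    have := Convex.norm_image_sub_le_of_norm_hasDerivWithin_le (s := Set.univ) (x := s) (y := t)
      (fun t _ => (hΦ t x).hasDerivWithinAt) (fun t _ => hC (t, Φ t x)) convex_univ trivial trivial
    simpa using this
  · intro x hx
    have hvL : ∀ t, LipschitzWith K (fun x => v (t, x)) := fun t =>
      lipschitzWith_of_nnnorm_fderiv_le (fun x => (hD t x).differentiableAt) fun x => by
        rw [(hD t x).fderiv]; exact_mod_cast hDK t x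
    have := ODE_solution_unique_univ (v := fun t x => v (t, x)) (s := fun _ => Set.univ) (K := K)
      (f := fun t => Φ t x) (g := fun _ => x) (t₀ := 0)
      (fun t => (hvL t).lipschitzOnWith) (fun t => ⟨hΦ t x, trivial⟩)
      (fun t => ⟨by rw [hx]; exact hasDerivAt_const t x, trivial⟩) (h0 x)
    exact fun t => congrFun this t

/-- The standard symplectic form as a continuous bilinear map. -/
def omegaBil : R4 →L[ℝ] R4 →L[ℝ] ℝ := (innerSL ℝ).comp rotJ

lemma omegaBil_apply (u v : R4) : omegaBil u v = omegaSt u v := by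
  have : omegaBil u v = inner ℝ (rotJ u) v := rfl
  rw [this, R4.inner_eq]; simp [omegaSt]; ring

lemma omegaBil_swap (u v : R4) : omegaBil u v = -omegaBil v u := by
  simp only [omegaBil_apply, omegaSt]; ring

lemma omegaBil_self (u : R4) : omegaBil u u = 0 := by
  simp only [omegaBil_apply, omegaSt]; ring

lemma eq_of_omegaBil_eq {u v : R4} (h : ∀ w, omegaBil u w = omegaBil v w) : u = v := by
  have h1 : rotJ u = rotJ v := ext_inner_right ℝ h
  have h2 := congrArg rotJ h1
  rw [rotJ_rotJ, rotJ_rotJ] at h2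
  exact neg_injective h2

/-- The vector dual to a linear form with respect to the symplectic form. -/
def sharp : (R4 →L[ℝ] ℝ) →L[ℝ] R4 :=
  LinearMap.toContinuousLinearMap
    { toFun := fun l => -rotJ ((InnerProductSpace.toDual ℝ R4).symm l)
      map_add' := fun l l' => by simp only [map_add, neg_add]
      map_smul' := fun c l => by simp }

lemma omegaBil_sharp (l : R4 →L[ℝ] ℝ) (w : R4) : omegaBil (sharp l) w = l w := by
  have h : sharp l = -rotJ ((InnerProductSpace.toDual ℝ R4).symm l) := rfl
  rw [h, map_neg, neg_apply, omegaBil_apply, omegaSt_rotJ, neg_neg,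
    InnerProductSpace.toDual_symm_apply]

/-- The two-form `(S - 1) ω + dS ∧ ω(Y, ·)`, i.e. the differential of `(S - 1) ω(Y, ·)` when
`Y` is a Liouville field. -/
def conf2 (S : R4 → ℝ) (Y : R4 → R4) (x : R4) : R4 →L[ℝ] R4 →L[ℝ] ℝ :=
  (S x - 1) • omegaBil + (fderiv ℝ S x).smulRight (omegaBil (Y x)) -
    (omegaBil (Y x)).smulRight (fderiv ℝ S x)

lemma conf2_apply (S : R4 → ℝ) (Y : R4 → R4) (x u w : R4) : conf2 S Y x u w =
    (S x - 1) * omegaBil u w + fderiv ℝ S x u * omegaBil (Y x) w -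
      omegaBil (Y x) u * fderiv ℝ S x w := by
  simp [conf2]

lemma conf2_swap (S : R4 → ℝ) (Y : R4 → R4) (x u w : R4) :
    conf2 S Y x u w = -conf2 S Y x w u := by
  rw [conf2_apply, conf2_apply, omegaBil_swap u w]; ring

lemma contDiff_conf2 {S : R4 → ℝ} {Y : R4 → R4} (hS : ContDiff ℝ ∞ S) (hY : ContDiff ℝ ∞ Y) :
    ContDiff ℝ ∞ (conf2 S Y) := by
  have h1 : ContDiff ℝ ∞ (fderiv ℝ S) := hS.fderiv_right (by simp)
  have h2 : ContDiff ℝ ∞ fun x => omegaBil (Y x) := omegaBil.contDiff.comp hY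
  exact (((hS.sub contDiff_const).smul contDiff_const).add (h1.smulRight h2)).sub
    (h2.smulRight h1)

lemma fderiv_eq_zero_of_eq_one {S : R4 → ℝ} (h1 : ∀ x, S x ≤ 1) {x : R4} (hx : S x = 1) :
    fderiv ℝ S x = 0 :=
  IsLocalMax.fderiv_eq_zero (Filter.Eventually.of_forall fun y => by simpa [hx] using h1 y)

lemma conf2_eq_zero {S : R4 → ℝ} (Y : R4 → R4) (h1 : ∀ x, S x ≤ 1) {x : R4} (hx : S x = 1) :
    conf2 S Y x = 0 := by
  ext u w
  rw [conf2_apply, fderiv_eq_zero_of_eq_one h1 hx, hx]; simp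

lemma fderiv_conf2_apply {S : R4 → ℝ} {Y : R4 → R4} (hS : ContDiff ℝ ∞ S) (hY : ContDiff ℝ ∞ Y)
    (x u w z : R4) : fderiv ℝ (conf2 S Y) x u w z = fderiv ℝ S x u * omegaBil w z +
      (fderiv ℝ (fderiv ℝ S) x u w * omegaBil (Y x) z +
        fderiv ℝ S x w * omegaBil (fderiv ℝ Y x u) z) -
      (omegaBil (Y x) w * fderiv ℝ (fderiv ℝ S) x u z +
        omegaBil (fderiv ℝ Y x u) w * fderiv ℝ S x z) := by
  have hE : HasFDerivAt (conf2 S Y) (fderiv ℝ (conf2 S Y) x) x :=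
    ((contDiff_conf2 hS hY).differentiable (by simp)).differentiableAt.hasFDerivAt
  have hS1 : HasFDerivAt S (fderiv ℝ S x) x :=
    (hS.differentiable (by simp)).differentiableAt.hasFDerivAt
  have hS2 : HasFDerivAt (fderiv ℝ S) (fderiv ℝ (fderiv ℝ S) x) x :=
    ((hS.fderiv_right (m := ∞) (by simp)).differentiable (by simp)).differentiableAt.hasFDerivAt
  have hY1 : HasFDerivAt Y (fderiv ℝ Y x) x :=
    (hY.differentiable (by simp)).differentiableAt.hasFDerivAt
  have e1 := (hE.clm_apply (hasFDerivAt_const w x)).clm_apply (hasFDerivAt_const z x)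
  have hS2' : ∀ a : R4, HasFDerivAt (fun y => fderiv ℝ S y a)
      ((fderiv ℝ (fderiv ℝ S) x).flip a) x := fun a =>
    (hS2.clm_apply (hasFDerivAt_const a x)).congr_fderiv (by ext; simp)
  have hoY : ∀ a : R4, HasFDerivAt (fun y => omegaBil (Y y) a)
      ((omegaBil.flip a).comp (fderiv ℝ Y x)) x := fun a =>
    HasFDerivAt.comp x (omegaBil.flip a).hasFDerivAt hY1
  have e2 := (((hS1.sub_const 1).mul_const (omegaBil w z)).add ((hS2' w).mul (hoY z))).sub
    ((hoY w).mul (hS2' z))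
  have e3 := (e1.congr_of_eventuallyEq (Filter.Eventually.of_forall
    fun y => (conf2_apply S Y y w z).symm)).unique e2
  have e4 := congrArg (fun L => L u) e3
  simp at e4
  rw [e4]; ring

lemma conf2_closed {S : R4 → ℝ} {Y : R4 → R4} (hS : ContDiff ℝ ∞ S) (hY : ContDiff ℝ ∞ Y) {x : R4}
    (hL : fderiv ℝ S x ≠ 0 → ∀ u v : R4,
      omegaBil (fderiv ℝ Y x u) v + omegaBil u (fderiv ℝ Y x v) = omegaBil u v) (u w z : R4) :
    fderiv ℝ (conf2 S Y) x u w z + fderiv ℝ (conf2 S Y) x w z u +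
      fderiv ℝ (conf2 S Y) x z u w = 0 := by
  have hsym : ∀ a b, fderiv ℝ (fderiv ℝ S) x a b = fderiv ℝ (fderiv ℝ S) x b a := fun a b =>
    (hS.contDiffAt.isSymmSndFDerivAt (by
      rw [minSmoothness_of_isRCLikeNormedField]
      exact WithTop.coe_le_coe.2 le_top)).eq a b
  simp only [fderiv_conf2_apply hS hY]
  rw [hsym w u, hsym z u, hsym z w]
  by_cases h : fderiv ℝ S x = 0
  · simp only [h, zero_apply]; ring
  · have k1 := hL h u w
    have k2 := hL h w z
    have k3 := hL h u z
    have s1 := omegaBil_swap u (fderiv ℝ Y x w)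
    have s2 := omegaBil_swap w (fderiv ℝ Y x z)
    have s3 := omegaBil_swap u (fderiv ℝ Y x z)
    have s4 := omegaBil_swap z u
    linear_combination (-fderiv ℝ S x z) * (k1 - s1) - fderiv ℝ S x u * (k2 - s2) +
      fderiv ℝ S x w * (k3 - s3 + s4)

/-- The unit vector in the last coordinate direction. -/
def e3 : R4 := EuclideanSpace.single 3 1

@[simp] lemma e3_zero : e3 0 = 0 := by simp [e3]
@[simp] lemma e3_one : e3 1 = 0 := by simp [e3]
@[simp] lemma e3_two : e3 2 = 0 := by simp [e3]
@[simp] lemma e3_three : e3 3 = 1 := by simp [e3]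

/-- The contraction of `conf2 S Y` with `e3`, as a vector field. -/
def shiftField (S : R4 → ℝ) (Y : R4 → R4) (x : R4) : R4 :=
  (S x - 1) • e3 + fderiv ℝ S x e3 • Y x - omegaBil (Y x) e3 • sharp (fderiv ℝ S x)

lemma omegaBil_shiftField (S : R4 → ℝ) (Y : R4 → R4) (x w : R4) :
    omegaBil (shiftField S Y x) w = conf2 S Y x e3 w := by
  rw [conf2_apply, shiftField]
  simp [omegaBil_sharp]

lemma contDiff_shiftField {S : R4 → ℝ} {Y : R4 → R4} (hS : ContDiff ℝ ∞ S)
    (hY : ContDiff ℝ ∞ Y) : ContDiff ℝ ∞ (shiftField S Y) := by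
  have h1 : ContDiff ℝ ∞ (fderiv ℝ S) := hS.fderiv_right (by simp)
  have h2 : ContDiff ℝ ∞ fun x => omegaBil (Y x) e3 :=
    (omegaBil.contDiff.comp hY).clm_apply contDiff_const
  exact (((hS.sub contDiff_const).smul contDiff_const).add
    ((h1.clm_apply contDiff_const).smul hY)).sub (h2.smul (sharp.contDiff.comp h1))

lemma shiftField_eq_zero {S : R4 → ℝ} (Y : R4 → R4) (h1 : ∀ x, S x ≤ 1) {x : R4} (hx : S x = 1) :
    shiftField S Y x = 0 := by
  rw [shiftField, fderiv_eq_zero_of_eq_one h1 hx, hx]; simp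

lemma norm_integral_translate_le {F : R4 → R4} {C a N : ℝ} (ha : 0 ≤ a)
    (hN : 0 ≤ N) (hC : ∀ x, ‖F x‖ ≤ C) (hsupp : ∀ x, F x ≠ 0 → |x 3| ≤ a) (x : R4) :
    ‖∫ s in (0:ℝ)..N, F (x - s • e3)‖ ≤ C * (2 * a) := by
  have hC0 : 0 ≤ C := (norm_nonneg _).trans (hC 0)
  rw [intervalIntegral.integral_of_le hN]
  have h1 : ∫ s in Set.Ioc 0 N, F (x - s • e3) =
      ∫ s in Set.Ioc 0 N ∩ Set.Icc (x 3 - a) (x 3 + a), F (x - s • e3) := by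
    refine MeasureTheory.setIntegral_eq_of_subset_of_forall_sdiff_eq_zero measurableSet_Ioc
      Set.inter_subset_left fun s hs => ?_
    by_contra h
    have := abs_le.1 (hsupp _ h)
    simp at this
    exact hs.2 ⟨hs.1, by constructor <;> linarith⟩
  rw [h1]
  have hvol : MeasureTheory.volume (Set.Icc (x 3 - a) (x 3 + a)) < ⊤ := by simp
  have hvol' := (MeasureTheory.measure_mono (μ := MeasureTheory.volume)
    (Set.inter_subset_right (s := Set.Ioc 0 N) (t := Set.Icc (x 3 - a) (x 3 + a))))
  refine (MeasureTheory.norm_setIntegral_le_of_norm_le_const (hvol'.trans_lt hvol)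
    fun s _ => hC _).trans ?_
  refine mul_le_mul_of_nonneg_left ?_ hC0
  refine (ENNReal.toReal_mono hvol.ne hvol').trans ?_
  rw [Real.volume_Icc, ENNReal.toReal_ofReal (by linarith)]
  linarith

theorem exists_primitive_conf2 {S : R4 → ℝ} {Y : R4 → R4} {r R : ℝ} (hS : ContDiff ℝ ∞ S)
    (hY : ContDiff ℝ ∞ Y) (h1 : ∀ x, S x ≤ 1)
    (hsupp : ∀ x, S x ≠ 1 → x 0 ^ 2 + x 1 ^ 2 ≤ r ∧ x 2 ^ 2 + x 3 ^ 2 ≤ R)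
    (hL : ∀ x, fderiv ℝ S x ≠ 0 → ∀ u v : R4,
      omegaBil (fderiv ℝ Y x u) v + omegaBil u (fderiv ℝ Y x v) = omegaBil u v) :
    ∃ C : ℝ, 0 ≤ C ∧ ∀ N, 0 ≤ N → ∃ W : R4 → R4, ContDiff ℝ ∞ W ∧ (∀ x, ‖W x‖ ≤ C) ∧
      (∀ x, r < x 0 ^ 2 + x 1 ^ 2 → W x = 0) ∧
      ∀ x, R < (x 3 - N) ^ 2 → ∀ u w,
        omegaBil (fderiv ℝ W x u) w - omegaBil (fderiv ℝ W x w) u = conf2 S Y x u w := by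
  have hFs : ∀ x, shiftField S Y x ≠ 0 → S x ≠ 1 := fun x hx h =>
    hx (shiftField_eq_zero Y h1 h)
  have hF := contDiff_shiftField hS hY
  have hFn : ∀ x, shiftField S Y x ≠ 0 → ‖x‖ ≤ √(r + R) := by
    intro x hx
    have := hsupp x (hFs x hx)
    refine Real.le_sqrt_of_sq_le ?_
    rw [R4.norm_sq_eq]; linarith
  have hFc : HasCompactSupport (shiftField S Y) :=
    HasCompactSupport.of_support_subset_isCompact (isCompact_closedBall (0 : R4) √(r + R))
      fun p hp => by simpa using hFn p hp
  obtain ⟨C, -, hC⟩ := exists_lipschitzWith_norm_le_of_contDiff hF hFn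
  refine ⟨C * (2 * √R), by positivity, fun N hN =>
    ⟨fun x => ∫ s in (0:ℝ)..N, shiftField S Y (x - s • e3),
      contDiff_integral_translate hF hFc N e3, fun x => ?_, fun x hx => ?_, fun x hx u w => ?_⟩⟩
  · refine norm_integral_translate_le (Real.sqrt_nonneg R) hN hC (fun x hx => ?_) x
    have := hsupp x (hFs x hx)
    exact Real.abs_le_sqrt (by nlinarith [sq_nonneg (x 2)])
  · have : ∀ s : ℝ, shiftField S Y (x - s • e3) = 0 := by
      intro s
      by_contra h
      have := (hsupp _ (hFs _ h)).1
      simp at this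
      linarith
    simp [this]
  · have hF' : Continuous (fderiv ℝ (shiftField S Y)) := hF.continuous_fderiv (by simp)
    have hline : Continuous fun s : ℝ => x - s • e3 := by fun_prop
    have hInt : IntervalIntegrable (fun s : ℝ => fderiv ℝ (shiftField S Y) (x - s • e3))
        MeasureTheory.volume 0 N := (hF'.comp hline).intervalIntegrable _ _
    have hpair : ∀ u w : R4, omegaBil ((∫ s in (0:ℝ)..N,
        fderiv ℝ (shiftField S Y) (x - s • e3)) u) w =
        ∫ s in (0:ℝ)..N, omegaBil (fderiv ℝ (shiftField S Y) (x - s • e3) u) w := by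
      intro u w
      exact (ContinuousLinearMap.intervalIntegral_comp_comm
        ((omegaBil.flip w).comp (ContinuousLinearMap.apply ℝ R4 u)) hInt).symm
    have hpi : ∀ u w : R4, IntervalIntegrable (fun s : ℝ =>
        omegaBil (fderiv ℝ (shiftField S Y) (x - s • e3) u) w) MeasureTheory.volume 0 N := by
      intro u w
      refine Continuous.intervalIntegrable ?_ _ _
      exact ((omegaBil.flip w).comp (ContinuousLinearMap.apply ℝ R4 u)).continuous.comp
        (hF'.comp hline)
    rw [(hasFDerivAt_integral_translate hF hFc N e3 x).fderiv, hpair, hpair,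
      ← intervalIntegral.integral_sub (hpi _ _) (hpi _ _)]
    have hE := contDiff_conf2 hS hY
    have hE1 : ∀ y, HasFDerivAt (conf2 S Y) (fderiv ℝ (conf2 S Y) y) y := fun y =>
      (hE.differentiable (by simp)).differentiableAt.hasFDerivAt
    have hFd : ∀ y a b, omegaBil (fderiv ℝ (shiftField S Y) y a) b =
        fderiv ℝ (conf2 S Y) y a e3 b := by
      intro y a b
      have e1 := ((hE1 y).clm_apply (hasFDerivAt_const e3 y)).clm_apply (hasFDerivAt_const b y)
      have e2 : HasFDerivAt (fun z => omegaBil (shiftField S Y z) b)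
          ((omegaBil.flip b).comp (fderiv ℝ (shiftField S Y) y)) y :=
        HasFDerivAt.comp y (omegaBil.flip b).hasFDerivAt
          (hF.differentiable (by simp)).differentiableAt.hasFDerivAt
      have e3 := (e1.congr_of_eventuallyEq (Filter.Eventually.of_forall
        fun z => omegaBil_shiftField S Y z b)).unique e2
      have e4 := congrArg (fun L => L a) e3
      simp at e4
      exact e4.symm
    have hsw : ∀ y a b c, fderiv ℝ (conf2 S Y) y a b c = -fderiv ℝ (conf2 S Y) y a c b := by
      intro y a b c
      simp only [fderiv_conf2_apply hS hY]
      rw [omegaBil_swap b c]; ring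
    have hder : ∀ s : ℝ, HasDerivAt (fun s : ℝ => -conf2 S Y (x - s • e3) u w)
        (omegaBil (fderiv ℝ (shiftField S Y) (x - s • e3) u) w -
          omegaBil (fderiv ℝ (shiftField S Y) (x - s • e3) w) u) s := by
      intro s
      have l1 : HasDerivAt (fun s : ℝ => x - s • e3) (-e3) s := by
        have := ((hasDerivAt_id s).smul_const e3).const_sub x
        simpa using this
      have l2 := HasFDerivAt.comp_hasDerivAt (E := R4 →L[ℝ] R4 →L[ℝ] ℝ) (l := conf2 S Y) s
        (hE1 _) l1
      have l3 := ((l2.clm_apply (hasDerivAt_const s u)).clm_apply (hasDerivAt_const s w)).neg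
      refine l3.congr_deriv ?_
      rw [hFd, hFd]
      have c1 := conf2_closed hS hY (hL (x - s • e3)) e3 u w
      have c2 := hsw (x - s • e3) u w e3
      simp
      linear_combination c1 - c2
    rw [intervalIntegral.integral_eq_sub_of_hasDerivAt (fun s _ => hder s)
      ((hpi _ _).sub (hpi _ _))]
    have hz : conf2 S Y (x - N • e3) = 0 := by
      refine conf2_eq_zero Y h1 ?_
      by_contra h
      have := (hsupp _ h).2
      simp at this
      nlinarith [sq_nonneg (x 2)]
    simp [hz]

/-- The solution `V` of `(ω + τ E)(V, ·) = -ω(W, ·)` with `E = conf2 S Y`. -/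
def moserField (S : R4 → ℝ) (Y W : R4 → R4) (τ : ℝ) (x : R4) : R4 :=
  (1 - τ * (1 - S x))⁻¹ • (-W x +
    (τ * fderiv ℝ S x (W x) * (1 - τ * (1 - S x) + τ * fderiv ℝ S x (Y x))⁻¹) • Y x -
    (τ * omegaBil (Y x) (W x) * (1 - τ * (1 - S x) + τ * fderiv ℝ S x (Y x))⁻¹) •
      sharp (fderiv ℝ S x))

lemma omegaBil_moserField {S : R4 → ℝ} {Y W : R4 → R4} {τ : ℝ} {x : R4}
    (h1 : 1 - τ * (1 - S x) ≠ 0) (h2 : 1 - τ * (1 - S x) + τ * fderiv ℝ S x (Y x) ≠ 0) (w : R4) :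
    omegaBil (moserField S Y W τ x) w + τ * conf2 S Y x (moserField S Y W τ x) w =
      -omegaBil (W x) w := by
  have e1 : fderiv ℝ S x (sharp (fderiv ℝ S x)) = 0 := by
    rw [← omegaBil_sharp, omegaBil_self]
  have e2 : omegaBil (Y x) (sharp (fderiv ℝ S x)) = -fderiv ℝ S x (Y x) := by
    rw [omegaBil_swap, omegaBil_sharp]
  rw [conf2_apply, moserField]
  simp only [map_smul, map_sub, map_add, map_neg, smul_apply, sub_apply, add_apply, neg_apply,
    smul_eq_mul, e1, e2, omegaBil_sharp, omegaBil_self]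
  set ψ := 1 - τ * (1 - S x) with hψ
  set g := fderiv ℝ S x (Y x)
  have hS : τ * (S x - 1) = ψ - 1 := by rw [hψ]; ring
  field_simp
  linear_combination (fderiv ℝ S x (W x) * τ * omegaBil (Y x) w - omegaBil (W x) w * (ψ + τ * g)
    - omegaBil (Y x) (W x) * τ * fderiv ℝ S x w) * hS

lemma norm_moserField_le {S : R4 → ℝ} {Y W : R4 → R4} {τ c CS CY : ℝ} {x : R4} (hc : 0 < c)
    (hτ0 : 0 ≤ τ) (hτ1 : τ ≤ 1) (h1 : c ≤ 1 - τ * (1 - S x)) (hg : 0 ≤ fderiv ℝ S x (Y x))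
    (hCS : ‖fderiv ℝ S x‖ ≤ CS) (hCY : ‖Y x‖ ≤ CY) :
    ‖moserField S Y W τ x‖ ≤
      c⁻¹ * (1 + CS * c⁻¹ * CY + ‖omegaBil‖ * CY * c⁻¹ * (‖sharp‖ * CS)) * ‖W x‖ := by
  have hCS0 : 0 ≤ CS := (norm_nonneg _).trans hCS
  have hCY0 : 0 ≤ CY := (norm_nonneg _).trans hCY
  have h2 : c ≤ 1 - τ * (1 - S x) + τ * fderiv ℝ S x (Y x) := by nlinarith
  rw [moserField, norm_smul]
  have i1 : ‖(1 - τ * (1 - S x))⁻¹‖ ≤ c⁻¹ := by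
    rw [norm_inv, Real.norm_of_nonneg (hc.le.trans h1)]; exact inv_anti₀ hc h1
  have i2 : ‖(1 - τ * (1 - S x) + τ * fderiv ℝ S x (Y x))⁻¹‖ ≤ c⁻¹ := by
    rw [norm_inv, Real.norm_of_nonneg (hc.le.trans h2)]; exact inv_anti₀ hc h2
  have i3 : ‖τ‖ ≤ 1 := by rwa [Real.norm_of_nonneg hτ0]
  have i4 : ‖fderiv ℝ S x (W x)‖ ≤ CS * ‖W x‖ := (fderiv ℝ S x).le_of_opNorm_le hCS _
  have i5 : ‖omegaBil (Y x) (W x)‖ ≤ ‖omegaBil‖ * CY * ‖W x‖ :=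
    (omegaBil.le_opNorm₂ _ _).trans (by gcongr)
  have i6 : ‖sharp (fderiv ℝ S x)‖ ≤ ‖sharp‖ * CS := (sharp.le_opNorm _).trans (by gcongr)
  rw [mul_assoc c⁻¹]
  refine mul_le_mul i1 ?_ (norm_nonneg _) (by positivity)
  refine (norm_sub_le _ _).trans ?_
  refine (add_le_add_left (norm_add_le _ _) _).trans ?_
  simp only [norm_neg, norm_smul, norm_mul]
  have j1 : ‖τ‖ * ‖fderiv ℝ S x (W x)‖ *
      ‖(1 - τ * (1 - S x) + τ * fderiv ℝ S x (Y x))⁻¹‖ * ‖Y x‖ ≤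
      1 * (CS * ‖W x‖) * c⁻¹ * CY := by gcongr
  have j2 : ‖τ‖ * ‖omegaBil (Y x) (W x)‖ *
      ‖(1 - τ * (1 - S x) + τ * fderiv ℝ S x (Y x))⁻¹‖ * ‖sharp (fderiv ℝ S x)‖ ≤
      1 * (‖omegaBil‖ * CY * ‖W x‖) * c⁻¹ * (‖sharp‖ * CS) := by gcongr
  exact (add_le_add (add_le_add le_rfl j1) j2).trans (le_of_eq (by ring))

lemma contDiff_moserField {S : R4 → ℝ} {Y W : R4 → R4} {τ : ℝ → ℝ} (hS : ContDiff ℝ ∞ S)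
    (hY : ContDiff ℝ ∞ Y) (hW : ContDiff ℝ ∞ W) (hτ : ContDiff ℝ ∞ τ)
    (h1 : ∀ t x, 1 - τ t * (1 - S x) ≠ 0)
    (h2 : ∀ t x, 1 - τ t * (1 - S x) + τ t * fderiv ℝ S x (Y x) ≠ 0) :
    ContDiff ℝ ∞ fun p : ℝ × R4 => moserField S Y W (τ p.1) p.2 := by
  have hS' : ContDiff ℝ ∞ fun p : ℝ × R4 => S p.2 := hS.comp contDiff_snd
  have hdS : ContDiff ℝ ∞ fun p : ℝ × R4 => fderiv ℝ S p.2 :=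
    (hS.fderiv_right (m := ∞) (by simp)).comp contDiff_snd
  have hY' : ContDiff ℝ ∞ fun p : ℝ × R4 => Y p.2 := hY.comp contDiff_snd
  have hW' : ContDiff ℝ ∞ fun p : ℝ × R4 => W p.2 := hW.comp contDiff_snd
  have hτ' : ContDiff ℝ ∞ fun p : ℝ × R4 => τ p.1 := hτ.comp contDiff_fst
  have a1 : ContDiff ℝ ∞ fun p : ℝ × R4 => 1 - τ p.1 * (1 - S p.2) :=
    contDiff_const.sub (hτ'.mul (contDiff_const.sub hS'))
  have a2 : ContDiff ℝ ∞ fun p : ℝ × R4 =>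
      (1 - τ p.1 * (1 - S p.2) + τ p.1 * fderiv ℝ S p.2 (Y p.2))⁻¹ :=
    (a1.add (hτ'.mul (hdS.clm_apply hY'))).inv fun p => h2 p.1 p.2
  have a3 : ContDiff ℝ ∞ fun p : ℝ × R4 => omegaBil (Y p.2) (W p.2) :=
    (omegaBil.contDiff.comp hY').clm_apply hW'
  exact (a1.inv fun p => h1 p.1 p.2).smul ((hW'.neg.add
    (((hτ'.mul (hdS.clm_apply hW')).mul a2).smul hY')).sub
    (((hτ'.mul a3).mul a2).smul (sharp.contDiff.comp hdS)))

theorem exists_moser_map {S : R4 → ℝ} {Y : R4 → R4} {r R τ₁ CY : ℝ} (hS : ContDiff ℝ ∞ S)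
    (hY : ContDiff ℝ ∞ Y) (h0 : ∀ x, 0 ≤ S x) (h1 : ∀ x, S x ≤ 1)
    (hsupp : ∀ x, S x ≠ 1 → x 0 ^ 2 + x 1 ^ 2 ≤ r ∧ x 2 ^ 2 + x 3 ^ 2 ≤ R)
    (hL : ∀ x, fderiv ℝ S x ≠ 0 → ∀ u v : R4,
      omegaBil (fderiv ℝ Y x u) v + omegaBil u (fderiv ℝ Y x v) = omegaBil u v)
    (hg : ∀ x, 0 ≤ fderiv ℝ S x (Y x)) (hCY : ∀ x, ‖Y x‖ ≤ CY) (hτ0 : 0 < τ₁) (hτ1 : τ₁ < 1) :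
    ∃ (Φ : R4 → R4) (A : R4 → R4 →L[ℝ] R4) (C : ℝ), (∀ x, HasFDerivAt Φ (A x) x) ∧
      (∃ L, LipschitzWith L A) ∧ (∃ K, ∀ x, ‖A x‖ ≤ K) ∧ Function.Surjective Φ ∧
      (∀ x, ‖Φ x - x‖ ≤ C) ∧ (∀ x, r < x 0 ^ 2 + x 1 ^ 2 → Φ x = x) ∧
      ∀ x, S (Φ x) ≠ 1 → ∀ u w, omegaBil (A x u) (A x w) +
        τ₁ * conf2 S Y (Φ x) (A x u) (A x w) = omegaBil u w := by
  obtain ⟨Cw, hCw0, hW⟩ := exists_primitive_conf2 hS hY h1 hsupp hL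
  have hSn : ∀ x, S x ≠ 1 → ‖x‖ ≤ √(r + R) := by
    intro x hx
    have := hsupp x hx
    refine Real.le_sqrt_of_sq_le ?_
    rw [R4.norm_sq_eq]; linarith
  -- bound on the derivative of `S`
  obtain ⟨CS, hCS⟩ : ∃ CS : ℝ, ∀ x, ‖fderiv ℝ S x‖ ≤ CS := by
    obtain ⟨C, -, hC⟩ := exists_lipschitzWith_norm_le_of_contDiff (f := fderiv ℝ S)
      (R := √(r + R)) (hS.fderiv_right (by simp))
      (fun x hx => hSn x fun h => hx (fderiv_eq_zero_of_eq_one h1 h))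
    exact ⟨C, hC⟩
  -- the time reparametrisation
  set τ : ℝ → ℝ := fun t => τ₁ * Real.smoothTransition t with hτ
  have hτc : ContDiff ℝ ∞ τ := contDiff_const.mul Real.smoothTransition.contDiff
  have hτn : ∀ t, 0 ≤ τ t := fun t => mul_nonneg hτ0.le (Real.smoothTransition.nonneg t)
  have hτl : ∀ t, τ t ≤ τ₁ := fun t =>
    mul_le_of_le_one_right hτ0.le (Real.smoothTransition.le_one t)
  have hτd : ContDiff ℝ ∞ (deriv τ) := (contDiff_infty_iff_deriv.1 hτc).2
  have hτs : ∀ t, deriv τ t ≠ 0 → |t| ≤ 1 := by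
    intro t ht
    rw [abs_le]
    constructor <;> by_contra! h
    · refine ht ?_
      have : τ =ᶠ[nhds t] fun _ => 0 := by
        filter_upwards [eventually_lt_nhds (show t < 0 by linarith)] with s hs
        simp [hτ, Real.smoothTransition.zero_of_nonpos hs.le]
      rw [this.deriv_eq]; simp
    · refine ht ?_
      have : τ =ᶠ[nhds t] fun _ => τ₁ := by
        filter_upwards [eventually_gt_nhds h] with s hs
        simp [hτ, Real.smoothTransition.one_of_one_le hs.le]
      rw [this.deriv_eq]; simp
  obtain ⟨Cτ, -, hCτ⟩ := exists_lipschitzWith_norm_le_of_contDiff hτd hτs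
  have hc : 0 < 1 - τ₁ := by linarith
  have hψ : ∀ t x, 1 - τ₁ ≤ 1 - τ t * (1 - S x) := by
    intro t x
    nlinarith [hτn t, hτl t, h0 x, h1 x]
  have hψg : ∀ t x, 1 - τ₁ ≤ 1 - τ t * (1 - S x) + τ t * fderiv ℝ S x (Y x) := by
    intro t x
    have := mul_nonneg (hτn t) (hg x)
    linarith [hψ t x]
  set k : ℝ := (1 - τ₁)⁻¹ * (1 + CS * (1 - τ₁)⁻¹ * CY +
    ‖omegaBil‖ * CY * (1 - τ₁)⁻¹ * (‖sharp‖ * CS)) with hk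
  have hCS0 : 0 ≤ CS := (norm_nonneg _).trans (hCS 0)
  have hCY0 : 0 ≤ CY := (norm_nonneg _).trans (hCY 0)
  have hk0 : 0 ≤ k := by positivity
  set C : ℝ := Cτ * (k * Cw) with hC
  have hC0 : 0 ≤ C := by positivity
  set ρ : ℝ := √(r + R) + C + 1 with hρ
  have hρ0 : 0 < ρ := by positivity
  obtain ⟨W, hWc, hWb, hW0, hWE⟩ := hW (ρ + √R + 1) (by positivity)
  have hVb : ∀ t x, ‖moserField S Y W (τ t) x‖ ≤ k * Cw := fun t x =>
    (norm_moserField_le hc (hτn t) ((hτl t).trans hτ1.le) (hψ t x) (hg x) (hCS x) (hCY x)).trans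
      (mul_le_mul_of_nonneg_left (hWb x) hk0)
  let χ : ContDiffBump (0 : R4) := ⟨ρ, ρ + 1, hρ0, by linarith⟩
  set v : ℝ × R4 → R4 := fun p => (deriv τ p.1 * χ p.2) • moserField S Y W (τ p.1) p.2 with hv
  have hvc : ContDiff ℝ ∞ v := ((hτd.comp contDiff_fst).mul (χ.contDiff.comp contDiff_snd)).smul
    (contDiff_moserField hS hY hWc hτc (fun t x => (hc.trans_le (hψ t x)).ne')
      (fun t x => (hc.trans_le (hψg t x)).ne'))
  have hvs : ∀ p, v p ≠ 0 → ‖p‖ ≤ max 1 (ρ + 1) := by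
    rintro ⟨t, x⟩ hp
    have e1 : deriv τ t ≠ 0 := fun h => hp (by simp [hv, h])
    have e2 : ‖x‖ ≤ ρ + 1 := by
      by_contra! h
      refine hp ?_
      have : χ x = 0 := χ.zero_of_le_dist (by simpa [χ] using h.le)
      simp [hv, this]
    rw [Prod.norm_def]
    exact max_le_max (hτs t e1) e2
  have hvb : ∀ p, ‖v p‖ ≤ C := by
    intro p
    rw [hv, norm_smul, norm_mul, Real.norm_of_nonneg (χ.nonneg (x := p.2)), hC]
    refine mul_le_mul ?_ (hVb _ _) (norm_nonneg _) (by positivity)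
    exact (mul_le_of_le_one_right (norm_nonneg _) χ.le_one).trans (hCτ _)
  obtain ⟨Φ, A, Dv, hDv, hΦ0, hΦ, hA0, hA, hΦ1, hAL, hAK, hsur, hdist, hfix⟩ :=
    exists_flow_of_contDiff hvc hvs hvb
  refine ⟨Φ 1, A 1, C, hΦ1, hAL, hAK, hsur, fun x => ?_, fun x hx => hfix x (fun t => ?_) 1,
    fun x hx u w => ?_⟩
  · have := hdist 1 0 x
    rw [hΦ0] at this
    simpa using this
  · simp [hv, moserField, hW0 x hx]
  · have hball : ∀ t ∈ Set.Icc (0:ℝ) 1, ‖Φ t x‖ < ρ := by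
      intro t ht
      have e1 := hdist t 1 x
      have e2 := hSn _ hx
      have e3 : Φ t x = (Φ t x - Φ 1 x) + Φ 1 x := by abel
      have e4 : |t - 1| ≤ 1 := by rw [abs_le]; constructor <;> linarith [ht.1, ht.2]
      rw [e3]
      refine (norm_add_le _ _).trans_lt ?_
      have := mul_le_of_le_one_right hC0 e4
      linarith
    have hder : ∀ t ∈ Set.Icc (0:ℝ) 1, HasDerivAt (fun s => omegaBil (A s x u) (A s x w) +
        τ s * conf2 S Y (Φ s x) (A s x u) (A s x w)) 0 t := by
      intro t ht
      refine hasDerivAt_pullback (σ := fun y => omegaBil (W y)) (Ef := conf2 S Y)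
        (E' := fderiv ℝ (conf2 S Y) (Φ t x)) (τ' := deriv τ t)
        (σ' := omegaBil.comp (fderiv ℝ W (Φ t x))) (γ := fun t => Φ t x) (A := fun t => A t x)
        omegaBil_swap (conf2_swap S Y)
        ((contDiff_conf2 hS hY).differentiable (by simp)).differentiableAt.hasFDerivAt
        (fun u w z => conf2_closed hS hY (hL _) u w z)
        (HasFDerivAt.comp _ omegaBil.hasFDerivAt
          (hWc.differentiable (by simp)).differentiableAt.hasFDerivAt) ?_ (hDv t _) ?_ (hΦ t x)
        (hA t ht x) (hτc.differentiable (by simp)).differentiableAt.hasDerivAt u w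
      · intro a b
        refine hWE _ ?_ a b
        have e1 : |(Φ t x) 3| ≤ ‖Φ t x‖ := by
          simpa using PiLp.norm_apply_le (Φ t x) (3 : Fin 4)
        have e2 := hball t ht
        have e3 : √R < (ρ + √R + 1) - (Φ t x) 3 := by linarith [le_abs_self ((Φ t x) 3)]
        have e4 := Real.lt_sq_of_sqrt_lt e3
        rw [← neg_sub, neg_sq]; exact e4
      · have : ∀ᶠ y in nhds (Φ t x), ‖y‖ < ρ := continuous_norm.continuousAt.eventually_lt
          continuousAt_const (hball t ht)
        filter_upwards [this] with y hy w
        have hχ : χ y = 1 := χ.one_of_mem_closedBall (by simpa [χ] using hy.le)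
        have e1 := omegaBil_moserField (W := W) (hc.trans_le (hψ t y)).ne'
          (hc.trans_le (hψg t y)).ne' w
        simp only [hv, hχ, mul_one, map_smul, smul_apply, smul_eq_mul]
        linear_combination (deriv τ t) * e1
    have := constant_of_has_deriv_right_zero (a := 0) (b := 1)
      (fun t ht => (hder t ht).continuousAt.continuousWithinAt)
      (fun t ht => (hder t (Set.Ico_subset_Icc_self ht)).hasDerivWithinAt) 1 (by simp)
    have hτ_0 : τ 0 = 0 := by simp [hτ, Real.smoothTransition.zero_of_nonpos le_rfl]
    have hτ_1 : τ 1 = τ₁ := by simp [hτ, Real.smoothTransition.one_of_one_le le_rfl]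
    simpa [hτ_0, hτ_1, hA0] using this

lemma exists_lipschitzWith_clm_comp {E F G H : Type*} [NormedAddCommGroup E] [NormedAddCommGroup F]
    [NormedSpace ℝ F] [NormedAddCommGroup G] [NormedSpace ℝ G] [NormedAddCommGroup H]
    [NormedSpace ℝ H] {f : E → G →L[ℝ] H} {g : E → F →L[ℝ] G} {Cf Cg : ℝ} {Lf Lg : NNReal}
    (hf : LipschitzWith Lf f) (hg : LipschitzWith Lg g) (hCf : ∀ x, ‖f x‖ ≤ Cf)
    (hCg : ∀ x, ‖g x‖ ≤ Cg) : ∃ L, LipschitzWith L fun x => (f x).comp (g x) := by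
  have hCf0 : 0 ≤ Cf := (norm_nonneg _).trans (hCf 0)
  have hCg0 : 0 ≤ Cg := (norm_nonneg _).trans (hCg 0)
  refine ⟨Lf * ⟨Cg, hCg0⟩ + ⟨Cf, hCf0⟩ * Lg, LipschitzWith.of_dist_le_mul fun x y => ?_⟩
  have e : (f x).comp (g x) - (f y).comp (g y) =
      (f x - f y).comp (g x) + (f y).comp (g x - g y) := by
    ext u; simp
  have h1 := hf.dist_le_mul x y
  have h2 := hg.dist_le_mul x y
  rw [dist_eq_norm] at h1 h2
  rw [dist_eq_norm, e]
  refine (norm_add_le _ _).trans ?_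
  push_cast
  have k1 := (ContinuousLinearMap.opNorm_comp_le (f x - f y) (g x)).trans
    (mul_le_mul h1 (hCg x) (norm_nonneg _) (by positivity))
  have k2 := (ContinuousLinearMap.opNorm_comp_le (f y) (g x - g y)).trans
    (mul_le_mul (hCf y) h2 (norm_nonneg _) (by positivity))
  refine (add_le_add k1 k2).trans (le_of_eq ?_)
  change _ = (Lf * Cg + Cf * Lg) * dist x y
  ring

theorem exists_orbit_of_conformal {S : R4 → ℝ} {Y : R4 → R4} {r R τ₁ CY m : ℝ} {p : R4}
    (hS : ContDiff ℝ ∞ S) (hY : ContDiff ℝ ∞ Y) (h0 : ∀ x, 0 ≤ S x) (h1 : ∀ x, S x ≤ 1)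
    (hr : r < 1) (hsupp : ∀ x, S x ≠ 1 → x 0 ^ 2 + x 1 ^ 2 ≤ r ∧ x 2 ^ 2 + x 3 ^ 2 ≤ R)
    (hL : ∀ x, fderiv ℝ S x ≠ 0 → ∀ u v : R4,
      omegaBil (fderiv ℝ Y x u) v + omegaBil u (fderiv ℝ Y x v) = omegaBil u v)
    (hg : ∀ x, fderiv ℝ S x ≠ 0 → 0 < fderiv ℝ S x (Y x)) (hCY : ∀ x, ‖Y x‖ ≤ CY)
    (hτ0 : 0 < τ₁) (hτ1 : τ₁ < 1) (hm : π < m * τ₁) (hp : ∀ᶠ x in nhds p, S x = 0) :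
    ∃ (x x' : ℝ → R4) (μ : ℝ → ℝ), (∀ t, x (t + 1) = x t) ∧ (∀ t, HasDerivAt x (x' t) t) ∧
      Continuous μ ∧ ∀ t, fderiv ℝ S (x t) ≠ 0 ∧ 0 < μ t ∧ μ t < m ∧
        ∀ w, omegaBil (x' t) w * fderiv ℝ S (x t) (Y (x t)) = -μ t * fderiv ℝ S (x t) w := by
  have hg0 : ∀ x, 0 ≤ fderiv ℝ S x (Y x) := fun x => by
    by_cases h : fderiv ℝ S x = 0
    · simp [h]
    · exact (hg x h).le
  have hm0 : 0 < m * τ₁ := Real.pi_pos.trans hm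
  have hm1 : 0 < m := pos_of_mul_pos_left hm0 hτ0.le
  obtain ⟨Φ, A, C, hΦ, ⟨LA, hLA⟩, ⟨K, hK⟩, hsur, hC, hout, hpull⟩ :=
    exists_moser_map hS hY h0 h1 hsupp hL hg0 hCY hτ0 hτ1
  have hSn : ∀ x, S x ≠ 1 → ‖x‖ ≤ √(r + R) := by
    intro x hx
    have := hsupp x hx
    refine Real.le_sqrt_of_sq_le ?_
    rw [R4.norm_sq_eq]; linarith
  obtain ⟨CS, hLS, hCS⟩ := exists_lipschitzWith_norm_le_of_contDiff (f := fderiv ℝ S)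
    (R := √(r + R)) (hS.fderiv_right (by simp))
    (fun x hx => hSn x fun h => hx (fderiv_eq_zero_of_eq_one h1 h))
  have hK0 : 0 ≤ K := (norm_nonneg _).trans (hK 0)
  have hΦL : LipschitzWith ⟨K, hK0⟩ Φ := lipschitzWith_of_nnnorm_fderiv_le
    (fun x => (hΦ x).differentiableAt) fun x => by rw [(hΦ x).fderiv]; exact hK x
  obtain ⟨L, hLc⟩ := exists_lipschitzWith_clm_comp (hLS.comp hΦL) hLA (fun x => hCS (Φ x)) hK
  set gh : R4 → R4 := fun x =>
    (m * τ₁) • (InnerProductSpace.toDual ℝ R4).symm ((fderiv ℝ S (Φ x)).comp (A x)) with hgh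
  have hghi : ∀ x w, inner ℝ (gh x) w = (m * τ₁) * fderiv ℝ S (Φ x) (A x w) := by
    intro x w
    rw [hgh, real_inner_smul_left, InnerProductSpace.toDual_symm_apply]; rfl
  have hghL : LipschitzWith (‖m * τ₁‖₊ * L) gh := by
    refine LipschitzWith.of_dist_le_mul fun x y => ?_
    have e1 := hLc.dist_le_mul x y
    rw [hgh, dist_smul₀, LinearIsometryEquiv.dist_map]
    push_cast
    rw [mul_assoc]
    exact mul_le_mul_of_nonneg_left e1 (norm_nonneg _)
  have hh : ∀ x, HasGradientAt (fun x => (m * τ₁) * S (Φ x)) (gh x) x := by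
    intro x
    rw [hasGradientAt_iff_hasFDerivAt]
    have e1 : HasFDerivAt (fun x => S (Φ x)) ((fderiv ℝ S (Φ x)).comp (A x)) x :=
      HasFDerivAt.comp x (hS.differentiable (by simp)).differentiableAt.hasFDerivAt (hΦ x)
    refine (e1.const_mul (m * τ₁)).congr_fderiv ?_
    ext w
    rw [InnerProductSpace.toDual_apply_apply, hghi]; rfl
  obtain ⟨p', rfl⟩ := hsur p
  have hsupp' : ∀ x, (m * τ₁) * S (Φ x) ≠ m * τ₁ →
      x 0 ^ 2 + x 1 ^ 2 ≤ r ∧ x 2 ^ 2 + x 3 ^ 2 ≤ (√(r + R) + C) ^ 2 := by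
    intro x hx
    have hx1 : S (Φ x) ≠ 1 := fun h => hx (by simp [h])
    constructor
    · by_contra! h
      rw [hout x h] at hx1
      exact absurd (hsupp x hx1).1 (not_le.2 h)
    · have e1 : ‖x‖ ≤ √(r + R) + C := by
        have e2 : x = Φ x - (Φ x - x) := by abel
        rw [e2]
        exact (norm_sub_le _ _).trans (add_le_add (hSn _ hx1) (hC x))
      have e3 := pow_le_pow_left₀ (norm_nonneg x) e1 2
      rw [R4.norm_sq_eq] at e3
      nlinarith [sq_nonneg (x 0), sq_nonneg (x 1)]
  obtain ⟨y, hyp, hy, hy0⟩ := exists_orbit_of_cylindrical_ham (h := fun x => (m * τ₁) * S (Φ x))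
    (p := p') (R := (√(r + R) + C) ^ 2) (m := m * τ₁)
    hh hghL (fun x => mul_nonneg hm0.le (h0 _)) (fun x => mul_le_of_le_one_right hm0.le (h1 _))
    hm hr (sq_nonneg _) hsupp'
    (((hΦ p').continuousAt.eventually hp).mono fun x hx => by simp [hx])
  have hdS : ∀ t, fderiv ℝ S (Φ (y t)) ≠ 0 := fun t h => hy0 t (by simp [hgh, h])
  have hψ : ∀ x, 0 < 1 - τ₁ * (1 - S x) := fun x => by nlinarith [h0 x, h1 x]
  have hψg : ∀ x, 0 < 1 - τ₁ * (1 - S x) + τ₁ * fderiv ℝ S x (Y x) := fun x => by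
    nlinarith [hψ x, hg0 x]
  have hyc : Continuous y := continuous_iff_continuousAt.2 fun t => (hy t).continuousAt
  have hxc : Continuous fun t => Φ (y t) := hΦL.continuous.comp hyc
  refine ⟨fun t => Φ (y t), fun t => A (y t) (rotJ (gh (y t))),
    fun t => m * τ₁ * fderiv ℝ S (Φ (y t)) (Y (Φ (y t))) / (1 - τ₁ * (1 - S (Φ (y t))) +
      τ₁ * fderiv ℝ S (Φ (y t)) (Y (Φ (y t)))), fun t => by simp only [hyp],
    fun t => (hΦ (y t)).comp_hasDerivAt t (hy t), ?_, fun t => ⟨hdS t, ?_, ?_, ?_⟩⟩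
  · have c1 : Continuous fun t => S (Φ (y t)) := hS.continuous.comp hxc
    have c2 : Continuous fun t => fderiv ℝ S (Φ (y t)) (Y (Φ (y t))) :=
      ((hS.continuous_fderiv (by simp)).comp hxc).clm_apply (hY.continuous.comp hxc)
    exact (continuous_const.mul c2).div₀ ((continuous_const.sub (continuous_const.mul
      (continuous_const.sub c1))).add (continuous_const.mul c2)) fun t => (hψg _).ne'
  · exact div_pos (mul_pos hm0 (hg _ (hdS t))) (hψg _)
  · rw [div_lt_iff₀ (hψg _)]
    have := mul_pos hm1 (hψ (Φ (y t)))
    linarith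
  · have hS1 : S (Φ (y t)) ≠ 1 := fun h => hdS t (fderiv_eq_zero_of_eq_one h1 h)
    have hinj : Function.Injective (A (y t)) := by
      rw [injective_iff_map_eq_zero]
      intro u hu
      refine eq_of_omegaBil_eq fun w => ?_
      rw [← hpull _ hS1 u w, hu]; simp
    have hAs : Function.Surjective (A (y t)) :=
      (LinearMap.injective_iff_surjective (f := (A (y t) : R4 →ₗ[ℝ] R4))).1 hinj
    have key : ∀ w, omegaBil (A (y t) (rotJ (gh (y t)))) w +
        τ₁ * conf2 S Y (Φ (y t)) (A (y t) (rotJ (gh (y t)))) w =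
        -(m * τ₁) * fderiv ℝ S (Φ (y t)) w := by
      intro w
      obtain ⟨w, rfl⟩ := hAs w
      rw [hpull _ hS1, omegaBil_apply, omegaSt_rotJ, hghi]; ring
    set x' := A (y t) (rotJ (gh (y t)))
    set z := Φ (y t)
    intro w
    have k1 := key x'
    have k2 := key (Y z)
    have k3 := key w
    rw [conf2_apply, omegaBil_self] at k1
    rw [conf2_apply, omegaBil_self] at k2
    rw [conf2_apply] at k3
    have k4 : fderiv ℝ S z x' = 0 := by
      have : (m * τ₁) * fderiv ℝ S z x' = 0 := by linear_combination k1
      exact (mul_eq_zero.1 this).resolve_left hm0.ne'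
    have k5 := omegaBil_swap x' (Y z)
    rw [k4] at k2 k3
    have hp1 := hψ z
    have hp2 := hψg z
    set ψ := 1 - τ₁ * (1 - S z) with hψd
    set g := fderiv ℝ S z (Y z)
    have k6 : (ψ + τ₁ * g) * omegaBil (Y z) x' = m * τ₁ * g := by
      linear_combination -k2 + ψ * k5 + (omegaBil x' (Y z)) * hψd
    rw [← neg_div, neg_mul_eq_neg_mul, div_mul_eq_mul_div, eq_div_iff hp2.ne']
    refine mul_left_cancel₀ hp1.ne' ?_
    linear_combination g * (ψ + τ₁ * g) * k3 + τ₁ * g * fderiv ℝ S z w * k6 +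
      g * (ψ + τ₁ * g) * omegaBil x' w * hψd

lemma integral_clm_mul_fderiv {h : R4 → ℝ} (hh : ContDiff ℝ ∞ h) (hc : HasCompactSupport h)
    (l : R4 →L[ℝ] ℝ) (v : R4) : ∫ x, l x * fderiv ℝ h x v = -∫ x, l v * h x := by
  have hf : ∀ x, fderiv ℝ (fun x => l x) x = l := fun x => l.hasFDerivAt.fderiv
  have hd : Continuous fun x => fderiv ℝ h x v :=
    (hh.continuous_fderiv (by simp)).clm_apply continuous_const
  have hdc : HasCompactSupport fun x => fderiv ℝ h x v := by
    refine (hc.fderiv ℝ).comp_left (g := fun L : R4 →L[ℝ] ℝ => L v) rfl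
  have := integral_mul_fderiv_eq_neg_fderiv_mul_of_integrable (μ := MeasureTheory.volume)
    (f := fun x => l x) (g := h) (v := v)
    (by
      simp only [hf]
      exact (continuous_const.mul hh.continuous).integrable_of_hasCompactSupport
        (hc.mul_left (f := fun _ => l v)))
    ((l.continuous.mul hd).integrable_of_hasCompactSupport hdc.mul_left)
    ((l.continuous.mul hh.continuous).integrable_of_hasCompactSupport hc.mul_left)
    (fun x _ => l.differentiableAt) (fun x _ => (hh.differentiable (by simp)).differentiableAt)
  rw [this]
  simp only [hf]

lemma integral_closed_form_apply_eq_zero {E : R4 → R4 →L[ℝ] R4 →L[ℝ] ℝ} (hE : ContDiff ℝ ∞ E)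
    (hc : HasCompactSupport E)
    (hcl : ∀ x u w z, fderiv ℝ E x u w z + fderiv ℝ E x w z u + fderiv ℝ E x z u w = 0)
    (l : R4 →L[ℝ] ℝ) {u w z : R4} (hu : l u = 1) (hw : l w = 0) (hz : l z = 0) :
    ∫ x, E x w z = 0 := by
  have hs : ∀ a b : R4, ContDiff ℝ ∞ fun x => E x a b := fun a b =>
    (hE.clm_apply contDiff_const).clm_apply contDiff_const
  have hk : ∀ a b : R4, HasCompactSupport fun x => E x a b := fun a b =>
    hc.comp_left (g := fun L : R4 →L[ℝ] R4 →L[ℝ] ℝ => L a b) rfl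
  have hd : ∀ a b v x, fderiv ℝ (fun x => E x a b) x v = fderiv ℝ E x v a b := by
    intro a b v x
    have hE1 : HasFDerivAt E (fderiv ℝ E x) x :=
      (hE.differentiable (by simp)).differentiableAt.hasFDerivAt
    have := (hE1.clm_apply (hasFDerivAt_const a x)).clm_apply (hasFDerivAt_const b x)
    rw [this.fderiv]; simp
  have hi : ∀ a b v, MeasureTheory.Integrable fun x => l x * fderiv ℝ (fun x => E x a b) x v := by
    intro a b v
    have h1 : Continuous fun x => fderiv ℝ (fun x => E x a b) x v :=
      ((hs a b).continuous_fderiv (by simp)).clm_apply continuous_const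
    have h2 : HasCompactSupport fun x => fderiv ℝ (fun x => E x a b) x v :=
      ((hk a b).fderiv ℝ).comp_left (g := fun L : R4 →L[ℝ] ℝ => L v) rfl
    exact (l.continuous.mul h1).integrable_of_hasCompactSupport h2.mul_left
  have e1 := integral_clm_mul_fderiv (hs w z) (hk w z) l u
  have e2 := integral_clm_mul_fderiv (hs z u) (hk z u) l w
  have e3 := integral_clm_mul_fderiv (hs u w) (hk u w) l z
  have e4 := MeasureTheory.integral_add ((hi w z u).add (hi z u w)) (hi u w z)
  have e5 := MeasureTheory.integral_add (hi w z u) (hi z u w)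
  simp only [Pi.add_apply] at e4
  rw [e5, e1, e2, e3] at e4
  have e6 : ∀ x, l x * fderiv ℝ (fun x => E x w z) x u + l x * fderiv ℝ (fun x => E x z u) x w +
      l x * fderiv ℝ (fun x => E x u w) x z = 0 := by
    intro x
    rw [hd, hd, hd, ← mul_add, ← mul_add, hcl, mul_zero]
  simp only [e6, hu, hw, hz, zero_mul, one_mul, MeasureTheory.integral_zero] at e4
  linarith

lemma conf2_single_add (S : R4 → ℝ) (Y : R4 → R4) (x : R4) :
    conf2 S Y x (EuclideanSpace.single 0 1) (EuclideanSpace.single 1 1) +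
      conf2 S Y x (EuclideanSpace.single 2 1) (EuclideanSpace.single 3 1) =
      2 * (S x - 1) + fderiv ℝ S x (Y x) := by
  have hY : Y x = Y x 0 • EuclideanSpace.single (0 : Fin 4) (1 : ℝ) +
      Y x 1 • EuclideanSpace.single (1 : Fin 4) (1 : ℝ) +
      Y x 2 • EuclideanSpace.single (2 : Fin 4) (1 : ℝ) +
      Y x 3 • EuclideanSpace.single (3 : Fin 4) (1 : ℝ) := by
    ext i; fin_cases i <;> simp
  have h1 := congrArg (fderiv ℝ S x) hY
  simp only [map_add, map_smul, smul_eq_mul] at h1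
  rw [h1, conf2_apply, conf2_apply]
  simp only [omegaBil_apply, omegaSt]
  simp
  ring

/-- A conformal factor that is constant outside a compact set and nondecreasing along a
Liouville field, not everywhere trivially so, must take a value below its value at infinity. -/
theorem exists_lt_one_of_conformal {S : R4 → ℝ} {Y : R4 → R4} (hS : ContDiff ℝ ∞ S)
    (hY : ContDiff ℝ ∞ Y) (hc : HasCompactSupport fun x => S x - 1)
    (hL : ∀ x, fderiv ℝ S x ≠ 0 → ∀ u v : R4,
      omegaBil (fderiv ℝ Y x u) v + omegaBil u (fderiv ℝ Y x v) = omegaBil u v)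
    (hg : ∀ x, 0 ≤ fderiv ℝ S x (Y x)) {q : R4} (hq : 0 < fderiv ℝ S q (Y q)) :
    ∃ x, S x < 1 := by
  by_contra! hcon
  have hfd : HasCompactSupport (fderiv ℝ S) := by
    have h1 : fderiv ℝ S = fderiv ℝ fun x => S x - 1 := by
      ext x u; rw [fderiv_sub_const]
    rw [h1]; exact hc.fderiv ℝ
  have hE : HasCompactSupport (conf2 S Y) := by
    refine HasCompactSupport.of_support_subset_isCompact (hc.union hfd) fun x hx => ?_
    by_contra hx'
    rw [Set.mem_union, not_or] at hx'
    apply hx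
    ext u w
    rw [conf2_apply, image_eq_zero_of_notMem_tsupport hx'.1,
      image_eq_zero_of_notMem_tsupport hx'.2]
    simp
  have hEs := contDiff_conf2 hS hY
  have hcl := fun x => conf2_closed (x := x) hS hY (hL x)
  have i1 := integral_closed_form_apply_eq_zero hEs hE hcl (EuclideanSpace.proj (2 : Fin 4))
    (u := EuclideanSpace.single 2 1) (w := EuclideanSpace.single 0 1)
    (z := EuclideanSpace.single 1 1) (by simp) (by simp) (by simp)
  have i2 := integral_closed_form_apply_eq_zero hEs hE hcl (EuclideanSpace.proj (0 : Fin 4))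
    (u := EuclideanSpace.single 0 1) (w := EuclideanSpace.single 2 1)
    (z := EuclideanSpace.single 3 1) (by simp) (by simp) (by simp)
  have hInt : ∀ a b : R4, MeasureTheory.Integrable fun x => conf2 S Y x a b := fun a b =>
    ((hEs.continuous.clm_apply continuous_const).clm_apply
      continuous_const).integrable_of_hasCompactSupport
      (hE.comp_left (g := fun L : R4 →L[ℝ] R4 →L[ℝ] ℝ => L a b) rfl)
  have i3 := MeasureTheory.integral_add
    (hInt (EuclideanSpace.single 0 1) (EuclideanSpace.single 1 1))
    (hInt (EuclideanSpace.single 2 1) (EuclideanSpace.single 3 1))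
  rw [i1, i2, add_zero] at i3
  simp only [conf2_single_add] at i3
  have hpos : 0 < ∫ x, (2 * (S x - 1) + fderiv ℝ S x (Y x)) := by
    refine Continuous.integral_pos_of_hasCompactSupport_nonneg_nonzero (x := q) ?_ ?_ ?_ ?_
    · exact (continuous_const.mul (hS.continuous.sub continuous_const)).add
        ((hS.continuous_fderiv (by simp)).clm_apply hY.continuous)
    · have h1 : HasCompactSupport fun x => 2 * (S x - 1) :=
        hc.comp_left (g := fun t : ℝ => 2 * t) (by simp)
      refine h1.add (HasCompactSupport.of_support_subset_isCompact hfd fun x hx => ?_)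
      by_contra hx'
      exact hx (by simp [image_eq_zero_of_notMem_tsupport hx'])
    · intro x
      have := hcon x
      have := hg x
      simp only [Pi.zero_apply]; linarith
    · have := hcon q
      linarith
  linarith

/-- A one-form that is locally exact on a Euclidean space is exact. -/
lemma exists_fderiv_eq_of_locally {η : R4 → R4 →L[ℝ] ℝ}
    (h : ∀ x, ∃ φ : R4 → ℝ, ContDiff ℝ ∞ φ ∧ η =ᶠ[nhds x] fderiv ℝ φ) :
    ∃ χ : R4 → ℝ, ContDiff ℝ ∞ χ ∧ ∀ x, fderiv ℝ χ x = η x := by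
  have hη : ContDiff ℝ ∞ η := contDiff_iff_contDiffAt.2 fun x => by
    obtain ⟨φ, hφ, he⟩ := h x
    exact ((hφ.fderiv_right (m := ∞) (by simp)).contDiffAt).congr_of_eventuallyEq he
  have hsym : ∀ x u v, fderiv ℝ η x u v = fderiv ℝ η x v u := by
    intro x u v
    obtain ⟨φ, hφ, he⟩ := h x
    rw [he.fderiv_eq]
    exact (hφ.contDiffAt.isSymmSndFDerivAt (by
      rw [minSmoothness_of_isRCLikeNormedField]
      exact WithTop.coe_le_coe.2 le_top)).eq u v
  obtain ⟨χ, hχ⟩ := convex_univ.exists_forall_hasFDerivAt_of_fderiv_symmetric isOpen_univ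
    ((hη.differentiable (by simp)).differentiableOn) (fun x _ u v => hsym x u v)
  have h1 : ∀ x, HasFDerivAt χ (η x) x := fun x => hχ x (Set.mem_univ x)
  have h2 : fderiv ℝ χ = η := funext fun x => (h1 x).fderiv
  refine ⟨χ, contDiff_infty_iff_fderiv.2 ⟨fun x => (h1 x).differentiableAt, ?_⟩,
    fun x => (h1 x).fderiv⟩
  rw [h2]; exact hη

/-- The complement of a product of two discs is connected by lines. -/
lemma exists_eq_const_off_bidisc {f : R4 → ℝ} (hf : Differentiable ℝ f) {r R : ℝ}
    (h : ∀ x, fderiv ℝ f x ≠ 0 → x 0 ^ 2 + x 1 ^ 2 ≤ r ∧ x 2 ^ 2 + x 3 ^ 2 ≤ R) :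
    ∃ c, ∀ x, ¬ (x 0 ^ 2 + x 1 ^ 2 ≤ r ∧ x 2 ^ 2 + x 3 ^ 2 ≤ R) → f x = c := by
  have hline : ∀ x y : R4, (∀ t : ℝ, fderiv ℝ f (x + t • (y - x)) = 0) → f x = f y := by
    intro x y hxy
    have hd : ∀ t : ℝ, HasDerivAt (fun t : ℝ => f (x + t • (y - x))) 0 t := by
      intro t
      have h1 : HasDerivAt (fun t : ℝ => x + t • (y - x)) (y - x) t := by
        simpa using ((hasDerivAt_id t).smul_const (y - x)).const_add x
      have := (hf (x + t • (y - x))).hasFDerivAt.comp_hasDerivAt t h1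
      rw [hxy t, zero_apply] at this
      exact this
    have := is_const_of_deriv_eq_zero (fun t => (hd t).differentiableAt)
      (fun t => (hd t).deriv) 0 1
    simpa using this
  have hz : ∀ x : R4, ¬ (x 0 ^ 2 + x 1 ^ 2 ≤ r ∧ x 2 ^ 2 + x 3 ^ 2 ≤ R) → fderiv ℝ f x = 0 :=
    fun x hx => by_contra fun h' => hx (h x h')
  have hP : ∀ x y : R4, x 0 = y 0 → x 1 = y 1 → r < x 0 ^ 2 + x 1 ^ 2 → f x = f y := by
    intro x y e0 e1 hx
    refine hline x y fun t => hz _ fun hh => ?_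
    have := hh.1
    simp [← e0, ← e1] at this
    linarith
  have hQ : ∀ x y : R4, x 2 = y 2 → x 3 = y 3 → R < x 2 ^ 2 + x 3 ^ 2 → f x = f y := by
    intro x y e0 e1 hx
    refine hline x y fun t => hz _ fun hh => ?_
    have := hh.2
    simp [← e0, ← e1] at this
    linarith
  have hA : r < (|r| + 1) ^ 2 := by nlinarith [abs_nonneg r, le_abs_self r]
  have hB : R < (|R| + 1) ^ 2 := by nlinarith [abs_nonneg R, le_abs_self R]
  refine ⟨f !₂[|r| + 1, 0, |R| + 1, 0], fun x hx => ?_⟩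
  by_cases h1 : x 0 ^ 2 + x 1 ^ 2 ≤ r
  · have h2 : R < x 2 ^ 2 + x 3 ^ 2 := by
      by_contra! h'; exact hx ⟨h1, h'⟩
    rw [hQ x !₂[|r| + 1, 0, x 2, x 3] (by simp) (by simp) h2]
    exact hP _ _ (by simp) (by simp) (by simpa using hA)
  · rw [hP x !₂[x 0, x 1, |R| + 1, 0] (by simp) (by simp) (not_le.1 h1)]
    exact hQ _ _ (by simp) (by simp) (by simpa using hB)

lemma isCompact_bidisc (r R : ℝ) :
    IsCompact {x : R4 | x 0 ^ 2 + x 1 ^ 2 ≤ r ∧ x 2 ^ 2 + x 3 ^ 2 ≤ R} := by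
  refine Metric.isCompact_of_isClosed_isBounded ?_ ?_
  · exact (isClosed_le (f := fun x : R4 => x 0 ^ 2 + x 1 ^ 2) (g := fun _ => r)
      (by fun_prop) (by fun_prop)).inter
      (isClosed_le (f := fun x : R4 => x 2 ^ 2 + x 3 ^ 2) (g := fun _ => R)
      (by fun_prop) (by fun_prop))
  · refine isBounded_iff_forall_norm_le.2 ⟨√(r + R), fun x hx => Real.le_sqrt_of_sq_le ?_⟩
    rw [R4.norm_sq_eq]; linarith [hx.1, hx.2]

lemma exists_contDiff_deriv_eq {b : ℝ → ℝ} (hb : ContDiff ℝ ∞ b) :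
    ∃ B : ℝ → ℝ, ContDiff ℝ ∞ B ∧ ∀ x, HasDerivAt B (b x) x := by
  have h : ∀ x, HasDerivAt (fun x => ∫ t in (0 : ℝ)..x, b t) (b x) x := fun x =>
    intervalIntegral.integral_hasDerivAt_right (hb.continuous.intervalIntegrable _ _)
      (hb.continuous.stronglyMeasurableAtFilter _ _) hb.continuous.continuousAt
  refine ⟨_, contDiff_infty_iff_deriv.2 ⟨fun x => (h x).differentiableAt, ?_⟩, h⟩
  rw [show deriv (fun x => ∫ t in (0 : ℝ)..x, b t) = b from funext fun x => (h x).deriv]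
  exact hb

/-- Near a compact hypersurface of contact type there is a conformal factor which is constant
away from the hypersurface, increasing along the Liouville field and vanishing somewhere. -/
theorem exists_conformal_factor {g : R4 → ℝ} (hg : ContDiff ℝ ∞ g) {Y : R4 → R4}
    (hY : ContDiff ℝ ∞ Y) {V : Set R4} (hV : IsOpen V) (hVc : IsCompact (closure V))
    {q : R4} (hq : g q = 0) (hgV : ∀ x, g x = 0 → x ∈ V)
    (hgY : ∀ x ∈ V, fderiv ℝ g x (Y x) ≠ 0)
    (hL : ∀ x ∈ V, ∀ u v : R4,
      omegaBil (fderiv ℝ Y x u) v + omegaBil u (fderiv ℝ Y x v) = omegaBil u v)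
    {r R : ℝ} (hrR : ∀ x ∈ V, x 0 ^ 2 + x 1 ^ 2 ≤ r ∧ x 2 ^ 2 + x 3 ^ 2 ≤ R)
    {δ : ℝ} (hδ : 0 < δ) :
    ∃ (S : R4 → ℝ) (p : R4), ContDiff ℝ ∞ S ∧ (∀ x, 0 ≤ S x) ∧ (∀ x, S x ≤ 1) ∧
      (∀ x, S x ≠ 1 → x 0 ^ 2 + x 1 ^ 2 ≤ r ∧ x 2 ^ 2 + x 3 ^ 2 ≤ R) ∧
      (∀ᶠ x in nhds p, S x = 0) ∧
      ∀ x, fderiv ℝ S x ≠ 0 → x ∈ V ∧ |g x| < δ ∧ 0 < fderiv ℝ S x (Y x) ∧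
        ∃ c : ℝ, c ≠ 0 ∧ fderiv ℝ S x = c • fderiv ℝ g x := by
  obtain ⟨ε, hε, hεf⟩ : ∃ ε > 0, ∀ x ∈ frontier V, ε ≤ |g x| := by
    have hfc : IsCompact (g '' frontier V) :=
      (hVc.of_isClosed_subset isClosed_frontier frontier_subset_closure).image hg.continuous
    have h0 : (0 : ℝ) ∈ (g '' frontier V)ᶜ := by
      rintro ⟨x, hx, hx0⟩
      have := hV.inter_frontier_eq
      exact (this ▸ (⟨hgV x hx0, hx⟩ : x ∈ V ∩ frontier V) : x ∈ (∅ : Set R4))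
    obtain ⟨ε, hε, hb⟩ := Metric.mem_nhds_iff.1 (hfc.isClosed.isOpen_compl.mem_nhds h0)
    refine ⟨ε, hε, fun x hx => ?_⟩
    by_contra! hlt
    exact hb (by simpa using hlt : g x ∈ Metric.ball 0 ε) ⟨x, hx, rfl⟩
  set d := min δ (ε / 2) with hd
  have hd0 : 0 < d := lt_min hδ (half_pos hε)
  have hdδ : d ≤ δ := min_le_left _ _
  have hdε : d < ε := (min_le_right _ _).trans_lt (half_lt_self hε)
  let b : ContDiffBump (0 : ℝ) := ⟨d / 2, d, half_pos hd0, half_lt_self hd0⟩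
  have hbs : ∀ t, b t ≠ 0 → |t| < d := fun t ht => by
    by_contra! hh
    exact ht (b.zero_of_le_dist (by simpa [b] using hh))
  obtain ⟨B, hB, hBd⟩ := exists_contDiff_deriv_eq (b.contDiff (n := (⊤ : ℕ∞)))
  let sg : R4 → ℝ := fun x => if 0 < fderiv ℝ g x (Y x) then 1 else -1
  have hgYc : Continuous fun x => fderiv ℝ g x (Y x) :=
    (hg.continuous_fderiv (by simp)).clm_apply hY.continuous
  have hsgabs : ∀ x, sg x * fderiv ℝ g x (Y x) = |fderiv ℝ g x (Y x)| := fun x => by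
    by_cases h : 0 < fderiv ℝ g x (Y x)
    · simp [sg, h, abs_of_pos h]
    · simp [sg, h, abs_of_nonpos (not_lt.1 h)]
  have hsg0 : ∀ x, sg x ≠ 0 := fun x => by
    by_cases h : 0 < fderiv ℝ g x (Y x) <;> simp [sg, h]
  classical
  let η : R4 → R4 →L[ℝ] ℝ := fun x => if x ∈ V then (sg x * b (g x)) • fderiv ℝ g x else 0
  have hloc : ∀ x, ∃ φ : R4 → ℝ, ContDiff ℝ ∞ φ ∧ η =ᶠ[nhds x] fderiv ℝ φ := by
    intro x
    by_cases hx : x ∈ V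
    · refine ⟨fun y => sg x * B (g y), contDiff_const.mul (hB.comp hg), ?_⟩
      have hs : ∀ᶠ y in nhds x, sg y = sg x := by
        rcases lt_or_gt_of_ne (hgY x hx) with h | h
        · filter_upwards [hgYc.continuousAt.eventually_lt continuousAt_const h] with y hy
          simp [sg, not_lt.2 h.le, not_lt.2 hy.le]
        · filter_upwards [continuousAt_const.eventually_lt hgYc.continuousAt h] with y hy
          simp [sg, h, hy]
      filter_upwards [hs, hV.mem_nhds hx] with y hy hyV
      have h1 : HasFDerivAt g (fderiv ℝ g y) y :=
        (hg.differentiable (by simp)).differentiableAt.hasFDerivAt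
      have h2 := ((hBd (g y)).comp_hasFDerivAt y h1).const_mul (sg x)
      have h3 : fderiv ℝ (fun y => sg x * B (g y)) y = sg x • b (g y) • fderiv ℝ g y := h2.fderiv
      rw [h3]
      simp [η, hyV, hy, smul_smul]
    · refine ⟨fun _ => 0, contDiff_const, ?_⟩
      have h0 : ∀ᶠ y in nhds x, y ∈ V → b (g y) = 0 := by
        by_cases hxc : x ∈ closure V
        · have hxf : x ∈ frontier V := ⟨hxc, by rwa [hV.interior_eq]⟩
          have := continuousAt_const.eventually_lt (hg.continuous.abs.continuousAt (x := x))
            (hdε.trans_le (hεf x hxf))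
          filter_upwards [this] with y hy _
          by_contra hh
          exact absurd (hbs _ hh) (not_lt.2 hy.le)
        · filter_upwards [isClosed_closure.isOpen_compl.mem_nhds hxc] with y hy hyV
          exact absurd (subset_closure hyV) hy
      filter_upwards [h0] with y hy
      have e0 : fderiv ℝ (fun _ : R4 => (0 : ℝ)) y = 0 := by simp
      rw [e0]
      by_cases hyV : y ∈ V
      · simp [η, hy hyV]
      · simp [η, hyV]
  obtain ⟨χ, hχ, hχd⟩ := exists_fderiv_eq_of_locally hloc
  have hηV : ∀ x, η x ≠ 0 → x ∈ V ∧ b (g x) ≠ 0 ∧ η x = (sg x * b (g x)) • fderiv ℝ g x := by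
    intro x hx
    have hxV : x ∈ V := by
      by_contra h; exact hx (by simp [η, h])
    refine ⟨hxV, fun h => hx (by simp [η, h]), by simp [η, hxV]⟩
  have hηY : ∀ x, η x ≠ 0 → 0 < η x (Y x) := by
    intro x hx
    obtain ⟨h1, h2, h3⟩ := hηV x hx
    have h4 : η x (Y x) = b (g x) * |fderiv ℝ g x (Y x)| := by
      rw [h3, ← hsgabs]; simp; ring
    rw [h4]
    exact mul_pos (lt_of_le_of_ne b.nonneg h2.symm) (abs_pos.2 (hgY x h1))
  obtain ⟨c, hc⟩ := exists_eq_const_off_bidisc (hχ.differentiable (by simp)) (r := r) (R := R)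
    (fun x hx => hrR x (hηV x (hχd x ▸ hx)).1)
  have hFd : ∀ x, fderiv ℝ (fun x => 1 + (χ x - c)) x = η x := fun x => by
    rw [fderiv_const_add, fderiv_sub_const, hχd]
  have hqV := hgV q hq
  have hηq : η q ≠ 0 := by
    intro h
    have h1 : η q (Y q) = sg q * b (g q) * fderiv ℝ g q (Y q) := by simp [η, hqV]
    rw [h, hq, b.one_of_mem_closedBall (by simpa [b] using (half_pos hd0).le)] at h1
    simp only [zero_apply, mul_one] at h1
    exact (mul_ne_zero (hsg0 q) (hgY q hqV)) h1.symm
  obtain ⟨p, hp⟩ := exists_lt_one_of_conformal (S := fun x => 1 + (χ x - c)) (Y := Y) (q := q)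
    (contDiff_const.add (hχ.sub contDiff_const)) hY
    (HasCompactSupport.of_support_subset_isCompact (isCompact_bidisc r R) fun x hx => by
      by_contra h
      exact hx (by simp [hc x h]))
    (fun x hx => hL x (hηV x (by rwa [hFd] at hx)).1)
    (fun x => by
      rw [hFd]
      by_cases h : η x = 0
      · simp [h]
      · exact (hηY x h).le)
    (by rw [hFd]; exact hηY q hηq)
  have ha : 0 < c - χ p := by linarith
  set a := c - χ p with hadef
  let θ : R4 → ℝ := fun x => (χ x - c + a / 2) * (2 / a)
  have hθ : ContDiff ℝ ∞ θ := ((hχ.sub contDiff_const).add contDiff_const).mul contDiff_const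
  have hθd : ∀ x, HasFDerivAt θ ((2 / a) • η x) x := fun x => by
    have h1 : HasFDerivAt χ (η x) x := hχd x ▸
      (hχ.differentiable (by simp)).differentiableAt.hasFDerivAt
    exact ((h1.sub_const c).add_const (a / 2)).mul_const (2 / a)
  have hst : ContDiff ℝ ∞ Real.smoothTransition := Real.smoothTransition.contDiff
  have hSd : ∀ x, fderiv ℝ (fun x => Real.smoothTransition (θ x)) x =
      (deriv Real.smoothTransition (θ x) * (2 / a)) • η x := fun x => by
    have h1 : HasDerivAt Real.smoothTransition (deriv Real.smoothTransition (θ x)) (θ x) :=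
      (hst.differentiable (by simp)).differentiableAt.hasDerivAt
    rw [mul_smul]
    exact (h1.comp_hasFDerivAt x (hθd x)).fderiv
  refine ⟨fun x => Real.smoothTransition (θ x), p, hst.comp hθ,
    fun x => Real.smoothTransition.nonneg _, fun x => Real.smoothTransition.le_one _, ?_, ?_, ?_⟩
  · intro x hx
    by_contra h
    refine hx (Real.smoothTransition.one_of_one_le ?_)
    have : θ x = 1 := by
      simp only [θ, hc x h]
      field_simp; ring
    exact this.ge
  · have hθp : θ p < 0 := by
      have : θ p = -1 := by
        have : χ p - c = -a := by rw [hadef]; ring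
        simp only [θ, this]
        field_simp; ring
      rw [this]; norm_num
    filter_upwards [hθ.continuous.continuousAt.eventually_lt continuousAt_const hθp] with x hx
    exact Real.smoothTransition.zero_of_nonpos hx.le
  · intro x hx
    rw [hSd] at hx ⊢
    have hk0 : 0 ≤ deriv Real.smoothTransition (θ x) * (2 / a) :=
      mul_nonneg Real.smoothTransition.monotone.deriv_nonneg (by positivity)
    have hk := lt_of_le_of_ne hk0 fun h => hx (by rw [← h, zero_smul])
    have hη0 : η x ≠ 0 := fun h => hx (by rw [h, smul_zero])
    obtain ⟨h1, h2, h3⟩ := hηV x hη0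
    refine ⟨h1, (hbs _ h2).trans_le hdδ, mul_pos hk (hηY x hη0),
      deriv Real.smoothTransition (θ x) * (2 / a) * (sg x * b (g x)),
      mul_ne_zero hk.ne' (mul_ne_zero (hsg0 x) h2), by rw [h3, smul_smul]⟩

lemma exists_contDiff_extension {F : Type*} [NormedAddCommGroup F] [NormedSpace ℝ F] {U K : Set R4}
    (hU : IsOpen U) (hK : IsCompact K) (hKU : K ⊆ U) {f : R4 → F} (hf : ContDiffOn ℝ ∞ f U) :
    ∃ f' : R4 → F, ContDiff ℝ ∞ f' ∧ HasCompactSupport f' ∧ ∀ x ∈ K, f' =ᶠ[nhds x] f := by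
  obtain ⟨V, hV, hKV, hVU, hVc⟩ := exists_open_between_and_isCompact_closure hK hU hKU
  obtain ⟨φ, h1, h0, -⟩ := exists_contMDiffMap_one_nhds_of_subset_interior (n := (⊤ : ℕ∞))
    (modelWithCornersSelf ℝ R4) hK.isClosed
    (hKV.trans (interior_maximal subset_closure hV) : K ⊆ interior (closure V))
  have hφ : ContDiff ℝ ∞ φ := φ.contMDiff.contDiff
  refine ⟨fun x => φ x • f x, ?_, ?_, ?_⟩
  · refine contDiff_iff_contDiffAt.2 fun x => ?_
    by_cases hx : x ∈ closure V
    · exact hφ.contDiffAt.smul (hf.contDiffAt (hU.mem_nhds (hVU hx)))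
    · refine (contDiffAt_const (c := (0 : F))).congr_of_eventuallyEq ?_
      filter_upwards [isClosed_closure.isOpen_compl.mem_nhds hx] with y hy
      rw [h0 y hy, zero_smul]
  · refine HasCompactSupport.of_support_subset_isCompact hVc fun x hx => ?_
    by_contra h
    exact hx (by simp [h0 x h])
  · intro x hx
    filter_upwards [h1.filter_mono (nhds_le_nhdsSet hx)] with y hy
    rw [hy, one_smul]

section IntegralCurves

variable {X : R4 → R4} {K : NNReal} {γ γ' : ℝ → R4}

lemma integralCurve_unique (hX : LipschitzWith K X) (h1 : ∀ t, HasDerivAt γ (X (γ t)) t)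
    (h2 : ∀ t, HasDerivAt γ' (X (γ' t)) t) {t₀ : ℝ} (h0 : γ t₀ = γ' t₀) : γ = γ' :=
  ODE_solution_unique_univ (v := fun _ => X) (s := fun _ => Set.univ) (K := K)
    (fun _ => hX.lipschitzOnWith) (fun t => ⟨h1 t, Set.mem_univ _⟩)
    (fun t => ⟨h2 t, Set.mem_univ _⟩) h0

lemma integralCurve_periodic (hX : LipschitzWith K X) (h1 : ∀ t, HasDerivAt γ (X (γ t)) t)
    {T : ℝ} (hT : γ T = γ 0) (t : ℝ) : γ (t + T) = γ t := by
  have h2 : ∀ t, HasDerivAt (fun t => γ (t + T)) (X (γ (t + T))) t := fun t =>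
    (h1 (t + T)).comp_add_const t T
  exact congrFun (integralCurve_unique hX h2 h1 (t₀ := 0) (by simpa using hT)) t

lemma integralCurve_contDiff (hX : ContDiff ℝ ∞ X) (h1 : ∀ t, HasDerivAt γ (X (γ t)) t) :
    ContDiff ℝ ∞ γ := by
  have hd : deriv γ = X ∘ γ := funext fun t => (h1 t).deriv
  refine contDiff_infty.2 fun n => ?_
  induction n with
  | zero => exact contDiff_zero.2 (continuous_iff_continuousAt.2 fun t => (h1 t).continuousAt)
  | succ n ih =>
    push_cast
    refine contDiff_succ_iff_deriv.2 ⟨fun t => (h1 t).differentiableAt, by simp, ?_⟩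
    rw [hd]
    exact (hX.of_le (by exact_mod_cast le_top)).comp ih

lemma integralCurve_reparam (hX : LipschitzWith K X) (h1 : ∀ t, HasDerivAt γ (X (γ t)) t)
    {x : ℝ → R4} {μ : ℝ → ℝ} {m : ℝ} (hμ : Continuous μ) (hμ0 : ∀ t, 0 ≤ μ t)
    (hμm : ∀ t, μ t ≤ m) (hx : ∀ t, HasDerivAt x (μ t • X (x t)) t) (h0 : γ 0 = x 0) (t : ℝ) :
    γ (∫ s in (0 : ℝ)..t, μ s) = x t := by
  have hm : 0 ≤ m := (hμ0 0).trans (hμm 0)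
  have hI : ∀ t, HasDerivAt (fun t => ∫ s in (0 : ℝ)..t, μ s) (μ t) t := fun t =>
    intervalIntegral.integral_hasDerivAt_right (hμ.intervalIntegrable _ _)
      (hμ.stronglyMeasurableAtFilter _ _) hμ.continuousAt
  have h2 : ∀ t, HasDerivAt (fun t => γ (∫ s in (0 : ℝ)..t, μ s))
      (μ t • X (γ (∫ s in (0 : ℝ)..t, μ s))) t := fun t =>
    (h1 (∫ s in (0 : ℝ)..t, μ s)).scomp t (hI t)
  refine congrFun (ODE_solution_unique_univ (v := fun t y => μ t • X y)
    (s := fun _ => Set.univ) (K := m.toNNReal * K) (t₀ := 0) (fun t => ?_)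
    (fun t => ⟨h2 t, Set.mem_univ _⟩) (fun t => ⟨hx t, Set.mem_univ _⟩) (by simpa using h0)) t
  refine (LipschitzWith.of_dist_le_mul fun y z => ?_).lipschitzOnWith
  rw [dist_smul₀, Real.norm_of_nonneg (hμ0 t), NNReal.coe_mul, Real.coe_toNNReal m hm, mul_assoc]
  exact mul_le_mul (hμm t) (hX.dist_le_mul y z) dist_nonneg hm

lemma norm_le_of_integralCurve_closed (hX : LipschitzWith K X) {C : ℝ} (hC : ∀ x, ‖X x‖ ≤ C)
    (h1 : ∀ t, HasDerivAt γ (X (γ t)) t) {T : ℝ} (hT : 0 < T) (hγ : γ T = γ 0) :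
    ‖X (γ 0)‖ ≤ K * C * T := by
  have hC0 : 0 ≤ C := (norm_nonneg _).trans (hC 0)
  have h2 : ∀ t ∈ Set.Icc 0 T, ‖X (γ t) - X (γ 0)‖ ≤ K * C * T := by
    intro t ht
    have h3 : ‖γ t - γ 0‖ ≤ C * (t - 0) :=
      norm_image_sub_le_of_norm_deriv_le_segment' (fun s _ => (h1 s).hasDerivWithinAt)
        (fun s _ => hC _) t ht
    rw [← dist_eq_norm] at h3 ⊢
    refine (hX.dist_le_mul _ _).trans ?_
    rw [mul_assoc]
    refine mul_le_mul_of_nonneg_left (h3.trans ?_) K.2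
    rw [sub_zero]
    exact mul_le_mul_of_nonneg_left ht.2 hC0
  have h4 : ∀ t, HasDerivAt (fun t => γ t - t • X (γ 0)) (X (γ t) - X (γ 0)) t := fun t => by
    have := (h1 t).sub ((hasDerivAt_id t).smul_const (X (γ 0)))
    rwa [one_smul] at this
  have h5 := norm_image_sub_le_of_norm_deriv_le_segment' (fun s _ => (h4 s).hasDerivWithinAt)
    (fun s hs => h2 s ⟨hs.1, hs.2.le⟩) T ⟨hT.le, le_rfl⟩
  have h6 : γ T - T • X (γ 0) - (γ 0 - (0 : ℝ) • X (γ 0)) = -(T • X (γ 0)) := by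
    rw [hγ, zero_smul]; abel
  rw [h6, norm_neg, norm_smul, Real.norm_of_nonneg hT.le, sub_zero, mul_comm] at h5
  exact le_of_mul_le_mul_right h5 hT

end IntegralCurves

/-- A limit of closed integral curves of bounded period through points where the limit field does
not vanish is a closed integral curve. -/
lemma exists_closed_integralCurve_of_tendsto {X : R4 → R4} {K : NNReal} {C : ℝ}
    (hX : LipschitzWith K X) (hC : ∀ x, ‖X x‖ ≤ C) {p : ℕ → R4} {T : ℕ → ℝ} {p₀ : R4} {T₀ : ℝ}
    {γ : ℕ → ℝ → R4} (h1 : ∀ n t, HasDerivAt (γ n) (X (γ n t)) t) (h0 : ∀ n, γ n 0 = p n)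
    (hT : ∀ n, 0 < T n) (hcl : ∀ n, γ n (T n) = p n)
    (hp : Filter.Tendsto p Filter.atTop (nhds p₀)) (hT₀ : Filter.Tendsto T Filter.atTop (nhds T₀))
    (hX0 : X p₀ ≠ 0) :
    0 < T₀ ∧ ∃ γ₀ : ℝ → R4, γ₀ 0 = p₀ ∧ (∀ t, HasDerivAt γ₀ (X (γ₀ t)) t) ∧ γ₀ T₀ = p₀ := by
  have hC0 : 0 ≤ C := (norm_nonneg _).trans (hC 0)
  have hT₀0 : 0 ≤ T₀ := ge_of_tendsto' hT₀ fun n => (hT n).le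
  have hXp : ‖X p₀‖ ≤ K * C * T₀ := by
    refine le_of_tendsto_of_tendsto' ((hX.continuous.tendsto p₀).comp hp).norm
      (hT₀.const_mul (K * C)) fun n => ?_
    have := norm_le_of_integralCurve_closed hX hC (h1 n) (hT n) (by rw [hcl, h0])
    rwa [h0] at this
  have hpos : 0 < T₀ := by
    refine lt_of_le_of_ne hT₀0 fun h => ?_
    rw [← h, mul_zero] at hXp
    exact hX0 (norm_le_zero_iff.1 hXp)
  obtain ⟨γ₀, hγ0, hγ⟩ := exists_solution_of_bounded_lipschitz (v := fun _ => X)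
    (C := ⟨C, hC0⟩) (fun x => continuous_const) (fun _ => hX) (fun _ x => hC x) 0 p₀
  refine ⟨hpos, γ₀, hγ0, hγ, ?_⟩
  have hgr : ∀ n, dist (p n) (γ₀ (T n)) ≤ dist (p n) p₀ * Real.exp (K * T n) := by
    intro n
    have := dist_le_of_trajectories_ODE (v := fun _ => X) (K := K) (a := 0) (b := T n)
      (fun _ => hX) (fun t _ => (h1 n t).continuousAt.continuousWithinAt)
      (fun t _ => (h1 n t).hasDerivWithinAt) (fun t _ => (hγ t).continuousAt.continuousWithinAt)
      (fun t _ => (hγ t).hasDerivWithinAt) (le_refl (dist (γ n 0) (γ₀ 0))) (T n)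
      ⟨(hT n).le, le_rfl⟩
    rwa [hcl, h0, hγ0, sub_zero] at this
  have hlim : Filter.Tendsto (fun n => dist (p n) (γ₀ (T n))) Filter.atTop
      (nhds (dist p₀ (γ₀ T₀))) :=
    hp.dist (((hγ T₀).continuousAt.tendsto).comp hT₀)
  have hlim2 : Filter.Tendsto (fun n => dist (p n) p₀ * Real.exp (K * T n)) Filter.atTop
      (nhds (dist p₀ p₀ * Real.exp (K * T₀))) :=
    (hp.dist tendsto_const_nhds).mul
      ((Real.continuous_exp.tendsto _).comp (hT₀.const_mul (K : ℝ)))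
  have := le_of_tendsto_of_tendsto' hlim hlim2 hgr
  rw [dist_self, zero_mul] at this
  exact (dist_le_zero.1 this).symm

/-- Closed characteristics of bounded period exist on level sets arbitrarily close to a compact
hypersurface of contact type in the cylinder. -/
lemma exists_closed_integralCurve_near {g : R4 → ℝ} (hg : ContDiff ℝ ∞ g) {Y : R4 → R4}
    (hY : ContDiff ℝ ∞ Y) {V : Set R4} (hV : IsOpen V) (hVc : IsCompact (closure V))
    {q : R4} (hq : g q = 0) (hgV : ∀ x, g x = 0 → x ∈ V)
    (hgY : ∀ x ∈ V, fderiv ℝ g x (Y x) ≠ 0)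
    (hL : ∀ x ∈ V, ∀ u v : R4,
      omegaBil (fderiv ℝ Y x u) v + omegaBil u (fderiv ℝ Y x v) = omegaBil u v)
    {r R CY : ℝ} (hr : r < 1) (hrR : ∀ x ∈ V, x 0 ^ 2 + x 1 ^ 2 ≤ r ∧ x 2 ^ 2 + x 3 ^ 2 ≤ R)
    (hCY : ∀ x, ‖Y x‖ ≤ CY) {X : R4 → R4} {K C : NNReal} (hX : LipschitzWith K X)
    (hC : ∀ x, ‖X x‖ ≤ C)
    (hXV : ∀ x ∈ V, X x = -(fderiv ℝ g x (Y x))⁻¹ • sharp (fderiv ℝ g x)) {δ : ℝ} (hδ : 0 < δ) :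
    ∃ (p : R4) (T : ℝ) (γ : ℝ → R4), p ∈ V ∧ |g p| < δ ∧ 0 < T ∧ T ≤ π + δ ∧ γ 0 = p ∧
      (∀ t, HasDerivAt γ (X (γ t)) t) ∧ γ T = p := by
  obtain ⟨S, p₀, hS, h0, h1, hsupp, hp₀, hdS⟩ :=
    exists_conformal_factor hg hY hV hVc hq hgV hgY hL hrR hδ
  have hm0 : 0 < π + δ := by positivity
  obtain ⟨τ, hτ1, hτ2⟩ := exists_between ((div_lt_one hm0).2 (by linarith : π < π + δ))
  have hτ0 : 0 < τ := (div_pos Real.pi_pos hm0).trans hτ1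
  obtain ⟨x, x', μ, hper, hx, hμ, hxμ⟩ := exists_orbit_of_conformal hS hY h0 h1 hr hsupp
    (fun x hx => hL x (hdS x hx).1) (fun x hx => (hdS x hx).2.2.1) hCY hτ0 hτ2
    (m := π + δ) ((div_lt_iff₀' hm0).1 hτ1) hp₀
  have hxX : ∀ t, HasDerivAt x (μ t • X (x t)) t := by
    intro t
    obtain ⟨hne, -, -, hw⟩ := hxμ t
    obtain ⟨hV', -, -, c, hc, hcS⟩ := hdS _ hne
    have hD := hgY _ hV'
    have : x' t = μ t • X (x t) := by
      refine eq_of_omegaBil_eq fun w => ?_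
      have := hw w
      rw [hcS] at this
      simp only [smul_apply, smul_eq_mul] at this
      rw [hXV _ hV']
      simp only [map_smul, smul_apply, smul_eq_mul, omegaBil_sharp]
      field_simp
      refine mul_left_cancel₀ hc ?_
      linear_combination this
    rw [← this]; exact hx t
  obtain ⟨γ, hγ0, hγ⟩ := exists_solution_of_bounded_lipschitz (v := fun _ => X)
    (fun x => continuous_const) (fun _ => hX) (fun _ x => hC x) 0 (x 0)
  have hrep := integralCurve_reparam hX hγ hμ (fun t => (hxμ t).2.1.le)
    (fun t => (hxμ t).2.2.1.le) hxX hγ0 1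
  obtain ⟨hV0, hg0, -⟩ := hdS _ (hxμ 0).1
  refine ⟨x 0, ∫ s in (0 : ℝ)..1, μ s, γ, hV0, hg0, ?_, ?_, hγ0, hγ, ?_⟩
  · exact intervalIntegral.intervalIntegral_pos_of_pos (hμ.intervalIntegrable _ _)
      (fun t => (hxμ t).2.1) one_pos
  · have := intervalIntegral.integral_mono_on
      (μ := MeasureTheory.volume) (zero_le_one' ℝ) (hμ.intervalIntegrable _ _)
      (intervalIntegrable_const (c := π + δ)) (fun t _ => (hxμ t).2.2.1.le)
    simpa using this
  · rw [hrep, ← hper 0, zero_add]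

/-- Upper-bound half of c(Z) = π: a compact contact-type hypersurface
M = g⁻¹(0) contained in the open cylinder Z = B² × ℝ² carries a closed Reeb
orbit of the induced contact form α = (ι_Y ω_st)|TM of period at most π. -/
theorem contact_type_in_cylinder_short_reeb_orbit
    (g : R4 → ℝ) (hg : ContDiff ℝ ∞ g)
    (M : Set R4) (hM : M = g ⁻¹' {0})
    (hMne : M.Nonempty) (hMcpt : IsCompact M)
    (hMcyl : M ⊆ {x : R4 | x 0 ^ 2 + x 1 ^ 2 < 1})
    (hreg : ∀ x ∈ M, fderiv ℝ g x ≠ 0)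
    (U : Set R4) (hU : IsOpen U) (hMU : M ⊆ U)
    (Y : R4 → R4) (hY : ContDiffOn ℝ ∞ Y U)
    (hLiou : ∀ x ∈ U, ∀ u v : R4,
      omegaSt (fderiv ℝ Y x u) v + omegaSt u (fderiv ℝ Y x v) = omegaSt u v)
    (htrans : ∀ x ∈ M, fderiv ℝ g x (Y x) ≠ 0) :
    ∃ (T : ℝ) (γ : ℝ → R4), 0 < T ∧ T ≤ π ∧ ContDiff ℝ ∞ γ ∧ (∃ t s, γ t ≠ γ s) ∧
      (∀ t, γ t ∈ M) ∧ (∀ t, γ (t + T) = γ t) ∧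
      -- γ′(t) is tangent to M:
      (∀ t, fderiv ℝ g (γ t) (deriv γ t) = 0) ∧
      -- γ′(t) lies in the kernel of ω_st restricted to T_{γ(t)}M:
      (∀ t, ∀ v : R4, fderiv ℝ g (γ t) v = 0 → omegaSt (deriv γ t) v = 0) ∧
      -- normalisation α(γ′) = ω_st(Y, γ′) = 1:
      (∀ t, omegaSt (Y (γ t)) (deriv γ t) = 1) := by
  obtain ⟨q, hq⟩ := hMne
  have hMg : ∀ x, x ∈ M ↔ g x = 0 := fun x => by rw [hM]; rfl
  have hdg : ContDiff ℝ ∞ (fderiv ℝ g) := hg.fderiv_right (by simp)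
  have hgYs : ContDiffOn ℝ ∞ (fun x => fderiv ℝ g x (Y x)) U := hdg.contDiffOn.clm_apply hY
  set W : Set R4 := (U ∩ (fun x => fderiv ℝ g x (Y x)) ⁻¹' {0}ᶜ) ∩
    {x : R4 | x 0 ^ 2 + x 1 ^ 2 < 1} with hWdef
  have hW : IsOpen W := (hgYs.continuousOn.isOpen_inter_preimage hU isOpen_compl_singleton).inter
    (isOpen_lt (f := fun x : R4 => x 0 ^ 2 + x 1 ^ 2) (g := fun _ => 1) (by fun_prop)
      (by fun_prop))
  have hMW : M ⊆ W := fun x hx => ⟨⟨hMU hx, htrans x hx⟩, hMcyl hx⟩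
  obtain ⟨V, hV, hMV, hVW, hVc⟩ := exists_open_between_and_isCompact_closure hMcpt hW hMW
  have hWU : W ⊆ U := fun x hx => hx.1.1
  obtain ⟨Z, hZ, hZc, hZY⟩ := exists_contDiff_extension hW hVc hVW (hY.mono hWU)
  obtain ⟨ψ, hψ, hψc, hψe⟩ := exists_contDiff_extension hW hVc hVW
    ((hgYs.mono hWU).inv fun x hx => hx.1.2)
  let X : R4 → R4 := fun x => (-ψ x) • sharp (fderiv ℝ g x)
  have hXs : ContDiff ℝ ∞ X := hψ.neg.smul (sharp.contDiff.comp hdg)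
  have hXc : HasCompactSupport X :=
    HasCompactSupport.of_support_subset_isCompact hψc fun x hx => by
      by_contra h
      exact hx (by simp [X, image_eq_zero_of_notMem_tsupport h])
  obtain ⟨K, hK⟩ := hXs.lipschitzWith_of_hasCompactSupport hXc (by simp)
  obtain ⟨C, hC⟩ := hXc.exists_bound_of_continuous hXs.continuous
  have hC0 : 0 ≤ C := (norm_nonneg _).trans (hC 0)
  obtain ⟨CY, hCY⟩ := hZc.exists_bound_of_continuous hZ.continuous
  have hqV : q ∈ closure V := subset_closure (hMV hq)
  obtain ⟨a, haV, ha⟩ := hVc.exists_isMaxOn ⟨q, hqV⟩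
    (f := fun x : R4 => x 0 ^ 2 + x 1 ^ 2) (by fun_prop)
  obtain ⟨b, -, hb⟩ := hVc.exists_isMaxOn ⟨q, hqV⟩
    (f := fun x : R4 => x 2 ^ 2 + x 3 ^ 2) (by fun_prop)
  have hZx : ∀ x ∈ closure V, Z x = Y x := fun x hx => (hZY x hx).self_of_nhds
  have hXx : ∀ x ∈ closure V, X x = -(fderiv ℝ g x (Y x))⁻¹ • sharp (fderiv ℝ g x) :=
    fun x hx => by simp only [X, (hψe x hx).self_of_nhds]; rfl
  have hnear := fun n : ℕ => exists_closed_integralCurve_near hg hZ hV hVc ((hMg q).1 hq)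
    (fun x hx => hMV ((hMg x).2 hx))
    (fun x hx => by rw [hZx x (subset_closure hx)]; exact (hVW (subset_closure hx)).1.2)
    (fun x hx u v => by
      rw [(hZY x (subset_closure hx)).fderiv_eq]
      simp only [omegaBil_apply]
      exact hLiou x (hWU (hVW (subset_closure hx))) u v)
    (hVW haV).2 (fun x hx => ⟨ha (subset_closure hx), hb (subset_closure hx)⟩) hCY hK
    (C := ⟨C, hC0⟩) hC
    (fun x hx => by rw [hXx x (subset_closure hx), hZx x (subset_closure hx)])
    (δ := 1 / ((n : ℝ) + 1)) (by positivity)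
  choose p T γ hpV hgp hT0 hTle hγ0 hγ hγT using hnear
  have hTb : ∀ n, T n ∈ Set.Icc 0 (π + 1) := fun n =>
    ⟨(hT0 n).le, (hTle n).trans (by
      have : 1 / ((n : ℝ) + 1) ≤ 1 := by
        rw [div_le_one (by positivity)]; linarith [n.cast_nonneg (α := ℝ)]
      linarith)⟩
  obtain ⟨⟨p₀, T₀⟩, hpT, φ, hφ, hlim⟩ := (hVc.prod (isCompact_Icc (a := (0 : ℝ)) (b := π + 1))
    ).tendsto_subseq (x := fun n => (p n, T n)) fun n => ⟨subset_closure (hpV n), hTb n⟩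
  have hlimp : Filter.Tendsto (p ∘ φ) Filter.atTop (nhds p₀) :=
    (continuous_fst.tendsto _).comp hlim
  have hlimT : Filter.Tendsto (T ∘ φ) Filter.atTop (nhds T₀) :=
    (continuous_snd.tendsto _).comp hlim
  have hε : Filter.Tendsto (fun n => 1 / ((φ n : ℝ) + 1)) Filter.atTop (nhds 0) :=
    tendsto_one_div_add_atTop_nhds_zero_nat.comp hφ.tendsto_atTop
  have hT₀π : T₀ ≤ π := by
    have h1 : Filter.Tendsto (fun n => π + 1 / ((φ n : ℝ) + 1)) Filter.atTop (nhds (π + 0)) :=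
      hε.const_add π
    rw [add_zero] at h1
    exact le_of_tendsto_of_tendsto' hlimT h1 fun n => hTle (φ n)
  have hgp₀ : g p₀ = 0 := by
    have h1 := le_of_tendsto_of_tendsto' ((hg.continuous.tendsto p₀).comp hlimp).abs hε
      fun n => (hgp (φ n)).le
    exact abs_eq_zero.1 (le_antisymm h1 (abs_nonneg _))
  have hMVc : ∀ x, g x = 0 → x ∈ closure V := fun x hx => subset_closure (hMV ((hMg x).2 hx))
  have hYX : ∀ x, g x = 0 → omegaBil (Y x) (X x) = 1 := by
    intro x hx
    have hD : fderiv ℝ g x (Y x) ≠ 0 := htrans x ((hMg x).2 hx)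
    rw [hXx x (hMVc x hx), map_smul, omegaBil_swap, omegaBil_sharp, smul_eq_mul]
    field_simp
  have hX0 : ∀ x, g x = 0 → X x ≠ 0 := fun x hx h => by
    have := hYX x hx
    rw [h, map_zero] at this
    exact zero_ne_one this
  obtain ⟨hT₀, c, hc0, hc, hcT⟩ := exists_closed_integralCurve_of_tendsto hK hC
    (fun n => hγ (φ n)) (fun n => hγ0 (φ n)) (fun n => hT0 (φ n)) (fun n => hγT (φ n))
    hlimp hlimT (hX0 p₀ hgp₀)
  have hdgX : ∀ x, fderiv ℝ g x (X x) = 0 := fun x => by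
    simp only [X, map_smul, ← omegaBil_sharp (fderiv ℝ g x), omegaBil_self, smul_zero]
  have hgc : ∀ t, g (c t) = 0 := by
    have hd : ∀ t, HasDerivAt (g ∘ c) 0 t := fun t => by
      have h1 : HasFDerivAt g (fderiv ℝ g (c t)) (c t) :=
        (hg.differentiable (by simp)).differentiableAt.hasFDerivAt
      simpa only [hdgX] using h1.comp_hasDerivAt t (hc t)
    intro t
    have := is_const_of_deriv_eq_zero (fun t => (hd t).differentiableAt)
      (fun t => (hd t).deriv) t 0
    simpa [hc0, hgp₀] using this
  have hcd : ∀ t, deriv c t = X (c t) := fun t => (hc t).deriv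
  refine ⟨T₀, c, hT₀, hT₀π, integralCurve_contDiff hXs hc, ?_, fun t => (hMg _).2 (hgc t),
    integralCurve_periodic hK hc (hcT.trans hc0.symm), fun t => by rw [hcd, hdgX],
    fun t v hv => ?_, fun t => ?_⟩
  · by_contra! h
    have h1 : c = fun _ => c 0 := funext fun t => h t 0
    have h2 := hcd 0
    rw [h1, deriv_const] at h2
    exact hX0 _ (hgc 0) h2.symm
  · rw [← omegaBil_apply, hcd]
    simp only [X, map_smul, smul_apply, omegaBil_sharp, hv, smul_zero]
  · rw [← omegaBil_apply, hcd, hYX _ (hgc t)]
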